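/- arXiv:2308.13216 — 15 statements merged into one kernel-verified Lean document; each statement's English description precedes it below -/
import Mathlib

section
/- Let a < b be real numbers and let μ be a Borel probability measure on [a,b] such that ∫ x^k dμ(x) = (1/(b-a)) ∫_a^b x^k dx for k = 1, 2, 3. Then for every continuous 3-convex function f : [a,b] → ℝ one has (1/2)·[ f( ((3-√3)/6)·a + ((3+√3)/6)·b ) + f( ((3+√3)/6)·a + ((3-√3)/6)·b ) ] ≤ ∫ f dμ. -/
open MeasureTheory Set

/-- Divided differences: `dividedDiff f k x` is `f[x 0, x 1, ..., x k]`,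
defined by the recursion `f[x₁] = f(x₁)` and
`f[x₁,…,x_k] = (f[x₂,…,x_k] − f[x₁,…,x_{k−1}]) / (x_k − x₁)`. -/
noncomputable def dividedDiff (f : ℝ → ℝ) : (k : ℕ) → (Fin (k + 1) → ℝ) → ℝ
  | 0, x => f (x 0)
  | k + 1, x =>
      (dividedDiff f k (fun i => x i.succ) - dividedDiff f k (fun i => x i.castSucc)) /
        (x (Fin.last (k + 1)) - x 0)

/-- `f` is `n`-convex on `I` if every divided difference of `f` at `n + 2`
pairwise distinct points of `I` is nonnegative. -/
def NConvexOn (n : ℕ) (I : Set ℝ) (f : ℝ → ℝ) : Prop :=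
  ∀ x : Fin (n + 2) → ℝ, (∀ i, x i ∈ I) → Function.Injective x →
    0 ≤ dividedDiff f (n + 1) x

lemma mul3_le {x y z x' y' z' : ℝ} (hx : 0 ≤ x) (hy : 0 ≤ y) (hz : 0 ≤ z) (h1 : x ≤ x')
    (h2 : y ≤ y') (h3 : z ≤ z') : x * y * z ≤ x' * y' * z' := by
  have : 0 ≤ x' := hx.trans h1
  have : 0 ≤ y' := hy.trans h2
  gcongr

lemma dd_identity (f : ℝ → ℝ) (p r s q x : ℝ) (hpr : p ≠ r) (hps : p ≠ s) (hpq : p ≠ q)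
    (hrs : r ≠ s) (hrq : r ≠ q) (hsq : s ≠ q) (hxp : x ≠ p) (hxr : x ≠ r) (hxs : x ≠ s)
    (hxq : x ≠ q) :
    dividedDiff f 4 ![p, r, s, q, x] * ((x - p) * (x - r) * (x - s) * (x - q)) =
      f x - (f p / ((p - r) * (p - s) * (p - q)) * ((x - r) * (x - s) * (x - q)) +
        f r / ((r - p) * (r - s) * (r - q)) * ((x - p) * (x - s) * (x - q)) +
        f s / ((s - p) * (s - r) * (s - q)) * ((x - p) * (x - r) * (x - q)) +
        f q / ((q - p) * (q - r) * (q - s)) * ((x - p) * (x - r) * (x - s))) := by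
  have e : dividedDiff f 4 ![p, r, s, q, x] =
      ((((f x - f q) / (x - q) - (f q - f s) / (q - s)) / (x - s) -
        ((f q - f s) / (q - s) - (f s - f r) / (s - r)) / (q - r)) / (x - r) -
       (((f q - f s) / (q - s) - (f s - f r) / (s - r)) / (q - r) -
        ((f s - f r) / (s - r) - (f r - f p) / (r - p)) / (s - p)) / (q - p)) / (x - p) := by
    rfl
  rw [e]
  have h1 : p - r ≠ 0 := sub_ne_zero.2 hpr
  have h2 : p - s ≠ 0 := sub_ne_zero.2 hps
  have h3 : p - q ≠ 0 := sub_ne_zero.2 hpq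
  have h4 : r - s ≠ 0 := sub_ne_zero.2 hrs
  have h5 : r - q ≠ 0 := sub_ne_zero.2 hrq
  have h6 : s - q ≠ 0 := sub_ne_zero.2 hsq
  have h7 : x - p ≠ 0 := sub_ne_zero.2 hxp
  have h8 : x - r ≠ 0 := sub_ne_zero.2 hxr
  have h9 : x - s ≠ 0 := sub_ne_zero.2 hxs
  have h10 : x - q ≠ 0 := sub_ne_zero.2 hxq
  rw [← neg_sub p r, ← neg_sub p s, ← neg_sub p q, ← neg_sub r s, ← neg_sub r q, ← neg_sub s q]
  field_simp
  ring

lemma bound_lem (p r s q x h D w K fp fr fs fq fx : ℝ) (hr : r = p + h) (hs : s = p + D - h)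
    (hq : q = p + D) (hh : 0 < h) (hD : 4 * h ≤ D) (hx1 : p ≤ x) (hx2 : x ≤ r)
    (b1 : |fx - fp| ≤ w) (b2 : |fx - fr| ≤ w) (b3 : |fx - fs| ≤ K) (b4 : |fx - fq| ≤ K) :
    -(3 * w + 4 * h * K / D) ≤
      fx - (fp / ((p - r) * (p - s) * (p - q)) * ((x - r) * (x - s) * (x - q)) +
        fr / ((r - p) * (r - s) * (r - q)) * ((x - p) * (x - s) * (x - q)) +
        fs / ((s - p) * (s - r) * (s - q)) * ((x - p) * (x - r) * (x - q)) +
        fq / ((q - p) * (q - r) * (q - s)) * ((x - p) * (x - r) * (x - s))) := by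
  obtain ⟨t, rfl⟩ : ∃ t, x = p + t := ⟨x - p, by ring⟩
  subst hr hs hq
  have ht : 0 ≤ t := by linarith
  have hth : 0 ≤ h - t := by linarith
  have hD0 : 0 < D := by linarith
  have hD1 : 0 < D - h := by linarith
  have hD2 : 0 < D - 2 * h := by linarith
  have hDt : 0 ≤ D - t := by linarith
  have hDht : 0 ≤ D - h - t := by linarith
  set lp := (h - t) * (D - h - t) * (D - t) / (h * (D - h) * D) with hlp
  set lr := t * (D - h - t) * (D - t) / (h * (D - 2 * h) * (D - h)) with hlr
  set ls := t * (h - t) * (D - t) / (h * (D - h) * (D - 2 * h)) with hls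
  set lq := t * (h - t) * (D - h - t) / (h * D * (D - h)) with hlq
  have e : fx - (fp / ((p - (p + h)) * (p - (p + D - h)) * (p - (p + D))) *
          ((p + t - (p + h)) * (p + t - (p + D - h)) * (p + t - (p + D))) +
        fr / ((p + h - p) * (p + h - (p + D - h)) * (p + h - (p + D))) *
          ((p + t - p) * (p + t - (p + D - h)) * (p + t - (p + D))) +
        fs / ((p + D - h - p) * (p + D - h - (p + h)) * (p + D - h - (p + D))) *
          ((p + t - p) * (p + t - (p + h)) * (p + t - (p + D))) +
        fq / ((p + D - p) * (p + D - (p + h)) * (p + D - (p + D - h))) *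
          ((p + t - p) * (p + t - (p + h)) * (p + t - (p + D - h)))) =
      (fx - fp) * lp + (fx - fr) * lr - (fx - fs) * ls + (fx - fq) * lq := by
    have a1 : p - (p + h) = -h := by ring
    have a2 : p - (p + D - h) = -(D - h) := by ring
    have a3 : p - (p + D) = -D := by ring
    have a4 : p + h - p = h := by ring
    have a5 : p + h - (p + D - h) = -(D - 2 * h) := by ring
    have a6 : p + h - (p + D) = -(D - h) := by ring
    have a7 : p + D - h - p = D - h := by ring
    have a8 : p + D - h - (p + h) = D - 2 * h := by ring
    have a9 : p + D - h - (p + D) = -h := by ring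
    have a10 : p + D - p = D := by ring
    have a11 : p + D - (p + h) = D - h := by ring
    have a12 : p + D - (p + D - h) = h := by ring
    rw [a1, a2, a3, a4, a5, a6, a7, a8, a9, a10, a11, a12, hlp, hlr, hls, hlq]
    have := hh.ne'
    have := hD0.ne'
    have := hD1.ne'
    have h2n := hD2.ne'
    obtain ⟨E2, hE2⟩ : ∃ E2, E2 = D - 2 * h := ⟨_, rfl⟩
    rw [← hE2] at h2n ⊢
    field_simp
    rw [hE2]
    ring
  rw [e]
  have lp0 : 0 ≤ lp := by positivity
  have lr0 : 0 ≤ lr := by positivity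
  have ls0 : 0 ≤ ls := by positivity
  have lq0 : 0 ≤ lq := by positivity
  have lp1 : lp ≤ 1 := by
    rw [hlp, div_le_one (by positivity)]
    apply mul3_le <;> linarith
  have lr1 : lr ≤ 2 := by
    rw [hlr, div_le_iff₀ (by positivity)]
    have h3 : t * (D - h - t) * (D - t) ≤ h * (D - h) * (2 * (D - 2 * h)) := by
      apply mul3_le <;> linarith
    linarith
  have ls1 : ls ≤ 3 * (h / D) := by
    rw [hls, div_le_iff₀ (by positivity)]
    have h1 : t * (h - t) * (D - t) ≤ h * h * D := by apply mul3_le <;> linarith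
    have h2 : D * D ≤ 3 * ((D - h) * (D - 2 * h)) := by nlinarith
    have h3 : D ≤ 3 * ((D - h) * (D - 2 * h)) / D := by
      rw [le_div_iff₀ hD0]; exact h2
    calc _ ≤ h * h * D := h1
      _ ≤ h * h * (3 * ((D - h) * (D - 2 * h)) / D) := by gcongr
      _ = _ := by ring
  have lq1 : lq ≤ h / D := by
    rw [hlq, div_le_div_iff₀ (by positivity) (by positivity)]
    have : t * (h - t) * (D - h - t) ≤ h * h * (D - h) := by apply mul3_le <;> linarith
    nlinarith
  have w0 : 0 ≤ w := (abs_nonneg _).trans b1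
  have K0 : 0 ≤ K := (abs_nonneg _).trans b3
  rw [abs_le] at b1 b2 b3 b4
  have c1 : -w * lp ≤ (fx - fp) * lp := mul_le_mul_of_nonneg_right b1.1 lp0
  have c2 : -w * lr ≤ (fx - fr) * lr := mul_le_mul_of_nonneg_right b2.1 lr0
  have c3 : (fx - fs) * ls ≤ K * ls := mul_le_mul_of_nonneg_right b3.2 ls0
  have c4 : -K * lq ≤ (fx - fq) * lq := mul_le_mul_of_nonneg_right b4.1 lq0
  have d1 := mul_le_mul_of_nonneg_left lp1 w0
  have d2 := mul_le_mul_of_nonneg_left lr1 w0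
  have d3 := mul_le_mul_of_nonneg_left ls1 K0
  have d4 := mul_le_mul_of_nonneg_left lq1 K0
  have : 4 * h * K / D = K * (3 * (h / D)) + K * (h / D) := by ring
  rw [this]
  linarith

lemma inj5 (p r s q x : ℝ) (hpr : p ≠ r) (hps : p ≠ s) (hpq : p ≠ q)
    (hrs : r ≠ s) (hrq : r ≠ q) (hsq : s ≠ q) (hxp : x ≠ p) (hxr : x ≠ r) (hxs : x ≠ s)
    (hxq : x ≠ q) : Function.Injective ![p, r, s, q, x] := by
  intro i j hij
  fin_cases i <;> fin_cases j <;>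
    simp [hpr, hps, hpq, hrs, hrq, hsq, hxp, hxr, hxs, hxq, hpr.symm, hps.symm, hpq.symm,
      hrs.symm, hrq.symm, hsq.symm, hxp.symm, hxr.symm, hxs.symm, hxq.symm] at hij ⊢

set_option maxHeartbeats 1000000 in
lemma key (a b : ℝ) (f : ℝ → ℝ) (hcont : ContinuousOn f (Icc a b))
    (hconv : NConvexOn 3 (Icc a b) f) (p q : ℝ) (hap : a ≤ p) (hpq : p < q) (hqb : q ≤ b)
    (ε : ℝ) (hε : 0 < ε) :
    ∃ c0 c1 c2 c3 : ℝ, c0 + c1 * p + c2 * p ^ 2 + c3 * p ^ 3 = f p ∧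
      c0 + c1 * q + c2 * q ^ 2 + c3 * q ^ 3 = f q ∧
      ∀ x ∈ Icc a b, c0 + c1 * x + c2 * x ^ 2 + c3 * x ^ 3 - ε ≤ f x := by
  obtain ⟨M, hM⟩ := isCompact_Icc.exists_bound_of_continuousOn hcont
  have huc := isCompact_Icc.uniformContinuousOn_of_continuous hcont
  rw [Metric.uniformContinuousOn_iff] at huc
  obtain ⟨δ, hδ, huc⟩ := huc (ε / 6) (by positivity)
  have hM0 : 0 ≤ M := (norm_nonneg _).trans (hM p ⟨hap, by linarith⟩)
  obtain ⟨D, hDdef⟩ : ∃ D, D = q - p := ⟨_, rfl⟩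
  have hD : 0 < D := by linarith
  obtain ⟨K, hKdef⟩ : ∃ K, K = 2 * M + 1 := ⟨_, rfl⟩
  have hK : 0 < K := by linarith
  obtain ⟨h, hh, h1, h2, h3⟩ : ∃ h, 0 < h ∧ h < δ ∧ 4 * h ≤ D ∧ h ≤ ε * D / (8 * K) := by
    refine ⟨min (δ / 2) (min (D / 4) (ε * D / (8 * K))), by positivity, ?_, ?_, ?_⟩
    · linarith [min_le_left (δ / 2) (min (D / 4) (ε * D / (8 * K)))]
    · linarith [min_le_right (δ / 2) (min (D / 4) (ε * D / (8 * K))),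
        min_le_left (D / 4) (ε * D / (8 * K))]
    · linarith [min_le_right (δ / 2) (min (D / 4) (ε * D / (8 * K))),
        min_le_right (D / 4) (ε * D / (8 * K))]
  have hsmall : 3 * (ε / 6) + 4 * h * K / D ≤ ε := by
    rw [le_div_iff₀ (by positivity)] at h3
    have : 4 * h * K / D ≤ ε / 2 := by
      rw [div_le_iff₀ hD]; linarith
    linarith
  have hbd : ∀ x ∈ Icc a b, ∀ y ∈ Icc a b, |f x - f y| ≤ K := by
    intro x hx y hy
    have h1 := hM x hx
    have h2 := hM y hy
    rw [Real.norm_eq_abs, abs_le] at h1 h2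
    rw [abs_le]
    constructor <;> linarith [h1.1, h1.2, h2.1, h2.2]
  have hw : ∀ x ∈ Icc a b, ∀ y ∈ Icc a b, |x - y| ≤ h → |f x - f y| ≤ ε / 6 := by
    intro x hx y hy hxy
    exact (huc x hx y hy (by rw [Real.dist_eq]; linarith)).le
  obtain ⟨r, hr⟩ : ∃ r, r = p + h := ⟨_, rfl⟩
  obtain ⟨s, hs⟩ : ∃ s, s = p + D - h := ⟨_, rfl⟩
  have hpr : p < r := by linarith
  have hrs : r < s := by linarith
  have hsq : s < q := by linarith
  have mp : p ∈ Icc a b := ⟨by linarith, by linarith⟩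
  have mr : r ∈ Icc a b := ⟨by linarith, by linarith⟩
  have ms : s ∈ Icc a b := ⟨by linarith, by linarith⟩
  have mq : q ∈ Icc a b := ⟨by linarith, by linarith⟩
  have main : ∀ x ∈ Icc a b, -ε ≤
      f x - (f p / ((p - r) * (p - s) * (p - q)) * ((x - r) * (x - s) * (x - q)) +
        f r / ((r - p) * (r - s) * (r - q)) * ((x - p) * (x - s) * (x - q)) +
        f s / ((s - p) * (s - r) * (s - q)) * ((x - p) * (x - r) * (x - q)) +
        f q / ((q - p) * (q - r) * (q - s)) * ((x - p) * (x - r) * (x - s))) := by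
    intro x hx
    by_cases i1 : p ≤ x ∧ x ≤ r
    · have := bound_lem p r s q x h D (ε / 6) K (f p) (f r) (f s) (f q) (f x) hr hs
        (by linarith) hh h2 i1.1 i1.2
        (hw x hx p mp (by rw [abs_le]; constructor <;> linarith [i1.1, i1.2]))
        (hw x hx r mr (by rw [abs_le]; constructor <;> linarith [i1.1, i1.2]))
        (hbd x hx s ms) (hbd x hx q mq)
      linarith
    by_cases i2 : s ≤ x ∧ x ≤ q
    · have := bound_lem (-q) (-s) (-r) (-p) (-x) h D (ε / 6) K (f q) (f s) (f r) (f p) (f x)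
        (by linarith) (by linarith)
        (by linarith) hh h2 (by linarith [i2.2]) (by linarith [i2.1])
        (hw x hx q mq (by rw [abs_le]; constructor <;> linarith [i2.1, i2.2]))
        (hw x hx s ms (by rw [abs_le]; constructor <;> linarith [i2.1, i2.2]))
        (hbd x hx r mr) (hbd x hx p mp)
      have sw' : ∀ u v w y : ℝ, (-y - -u) * (-y - -v) * (-y - -w) =
          -((y - w) * (y - v) * (y - u)) := by
        intro u v w y; ring
      simp only [sw', div_neg, neg_mul_neg] at this
      linarith
    · have hpos : 0 ≤ (x - p) * (x - r) * (x - s) * (x - q) := by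
        have e1 : 0 ≤ (x - p) * (x - r) := by
          by_cases hc : p ≤ x
          · have : r < x := by by_contra hcc; exact i1 ⟨hc, by linarith⟩
            exact mul_nonneg (by linarith) (by linarith)
          · exact mul_nonneg_of_nonpos_of_nonpos (by linarith) (by linarith)
        have e2 : 0 ≤ (x - s) * (x - q) := by
          by_cases hc : s ≤ x
          · have : q < x := by by_contra hcc; exact i2 ⟨hc, by linarith⟩
            exact mul_nonneg (by linarith) (by linarith)
          · exact mul_nonneg_of_nonpos_of_nonpos (by linarith) (by linarith)
        have := mul_nonneg e1 e2
        linarith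
      have xp : x ≠ p := by rintro rfl; exact i1 ⟨le_rfl, hpr.le⟩
      have xr : x ≠ r := by rintro rfl; exact i1 ⟨hpr.le, le_rfl⟩
      have xs : x ≠ s := by rintro rfl; exact i2 ⟨le_rfl, hsq.le⟩
      have xq : x ≠ q := by rintro rfl; exact i2 ⟨hsq.le, le_rfl⟩
      have hps : p < s := by linarith
      have hrq : r < q := by linarith
      rw [← dd_identity f p r s q x hpr.ne hps.ne hpq.ne hrs.ne hrq.ne hsq.ne xp xr xs xq]
      have hdd : 0 ≤ dividedDiff f 4 ![p, r, s, q, x] := by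
        apply hconv
        · intro i
          fin_cases i
          exacts [mp, mr, ms, mq, hx]
        · exact inj5 p r s q x hpr.ne hps.ne hpq.ne hrs.ne hrq.ne hsq.ne xp xr xs xq
      have := mul_nonneg hdd hpos
      linarith
  have n1 : (p - r) * (p - s) * (p - q) ≠ 0 :=
    mul_ne_zero (mul_ne_zero (by linarith) (by linarith)) (by linarith)
  have n2 : (q - p) * (q - r) * (q - s) ≠ 0 :=
    mul_ne_zero (mul_ne_zero (by linarith) (by linarith)) (by linarith)
  have v1 := div_mul_cancel₀ (f p) n1
  have v2 := div_mul_cancel₀ (f q) n2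
  generalize f p / ((p - r) * (p - s) * (p - q)) = A at *
  generalize f r / ((r - p) * (r - s) * (r - q)) = B at *
  generalize f s / ((s - p) * (s - r) * (s - q)) = C at *
  generalize f q / ((q - p) * (q - r) * (q - s)) = E at *
  refine ⟨-(A * r * s * q + B * p * s * q + C * p * r * q + E * p * r * s),
    A * (r * s + r * q + s * q) + B * (p * s + p * q + s * q) + C * (p * r + p * q + r * q)
      + E * (p * r + p * s + r * s),
    -(A * (r + s + q) + B * (p + s + q) + C * (p + r + q) + E * (p + r + s)),
    A + B + C + E, ?_, ?_, ?_⟩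
  · rw [← v1]; ring
  · rw [← v2]; ring
  · intro x hx
    have := main x hx
    linarith

theorem stmt1 (a b : ℝ) (hab : a < b) (μ : Measure ℝ) [IsProbabilityMeasure μ]
    (hsupp : μ (Set.Icc a b) = 1)
    (hmom : ∀ k ∈ Finset.Icc 1 3, ∫ x, x ^ k ∂μ = (b - a)⁻¹ * ∫ x in a..b, x ^ k)
    (f : ℝ → ℝ) (hcont : ContinuousOn f (Set.Icc a b))
    (hconv : NConvexOn 3 (Set.Icc a b) f) :
    (1 / 2) * (f ((3 - Real.sqrt 3) / 6 * a + (3 + Real.sqrt 3) / 6 * b) +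
        f ((3 + Real.sqrt 3) / 6 * a + (3 - Real.sqrt 3) / 6 * b)) ≤ ∫ x, f x ∂μ := by
  have hae : ∀ᵐ x ∂μ, x ∈ Icc a b := by
    rw [← prob_compl_eq_zero_iff measurableSet_Icc] at hsupp
    exact hsupp
  have hres : μ.restrict (Icc a b) = μ := Measure.restrict_eq_self_of_ae_mem hae
  have hint : ∀ g : ℝ → ℝ, ContinuousOn g (Icc a b) → Integrable g μ := by
    intro g hg
    have := hg.integrableOn_compact (μ := μ) isCompact_Icc
    rwa [IntegrableOn, hres] at this
  have h3 : Real.sqrt 3 ^ 2 = 3 := Real.sq_sqrt (by norm_num)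
  have hs0 : 0 < Real.sqrt 3 := by positivity
  have hs3 : Real.sqrt 3 < 3 := by nlinarith
  generalize Real.sqrt 3 = σ at *
  have hba : b - a ≠ 0 := by linarith
  have m1 := hmom 1 (by simp)
  have m2 := hmom 2 (by simp)
  have m3 := hmom 3 (by simp)
  rw [integral_pow] at m1 m2 m3
  obtain ⟨q, hq⟩ : ∃ q, q = (3 - σ) / 6 * a + (3 + σ) / 6 * b := ⟨_, rfl⟩
  obtain ⟨p, hp⟩ : ∃ p, p = (3 + σ) / 6 * a + (3 - σ) / 6 * b := ⟨_, rfl⟩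
  rw [← hq, ← hp]
  have k1 : ∫ x, x ^ 1 ∂μ = (p ^ 1 + q ^ 1) / 2 := by
    rw [m1, hp, hq]; push_cast; field_simp; ring
  have k2 : ∫ x, x ^ 2 ∂μ = (p ^ 2 + q ^ 2) / 2 := by
    have : (p ^ 2 + q ^ 2) / 2 = (a ^ 2 + a * b + b ^ 2) / 3 := by
      rw [hp, hq]; linear_combination (a - b) ^ 2 / 36 * h3
    rw [m2, this]; push_cast; field_simp; ring
  have k3 : ∫ x, x ^ 3 ∂μ = (p ^ 3 + q ^ 3) / 2 := by
    have : (p ^ 3 + q ^ 3) / 2 = (a + b) * (a ^ 2 + b ^ 2) / 4 := by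
      rw [hp, hq]; linear_combination (a - b) ^ 2 * (a + b) / 24 * h3
    rw [m3, this]; push_cast; field_simp; ring
  have hpq : p < q := by
    have : q - p = σ / 3 * (b - a) := by rw [hp, hq]; ring
    have : 0 < σ / 3 * (b - a) := mul_pos (by linarith) (by linarith)
    linarith
  have hap : a ≤ p := by
    have : p - a = (3 - σ) / 6 * (b - a) := by rw [hp]; ring
    have : 0 < (3 - σ) / 6 * (b - a) := mul_pos (by linarith) (by linarith)
    linarith
  have hqb : q ≤ b := by
    have : b - q = (3 - σ) / 6 * (b - a) := by rw [hq]; ring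
    have : 0 < (3 - σ) / 6 * (b - a) := mul_pos (by linarith) (by linarith)
    linarith
  apply le_of_forall_pos_le_add
  intro ε hε
  obtain ⟨c0, c1, c2, c3, e1, e2, hle⟩ := key a b f hcont hconv p q hap hpq hqb ε hε
  have i1 : Integrable (fun x : ℝ => x ^ 1) μ := hint _ (by fun_prop)
  have i2 : Integrable (fun x : ℝ => x ^ 2) μ := hint _ (by fun_prop)
  have i3 : Integrable (fun x : ℝ => x ^ 3) μ := hint _ (by fun_prop)
  have hmono : ∫ x, ((c0 - ε) + c1 * x ^ 1 + c2 * x ^ 2 + c3 * x ^ 3) ∂μ ≤ ∫ x, f x ∂μ := by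
    apply integral_mono_ae (hint _ (by fun_prop)) (hint _ hcont)
    filter_upwards [hae] with x hx
    have := hle x hx
    simp only [pow_one]
    linarith
  have hval : ∫ x, ((c0 - ε) + c1 * x ^ 1 + c2 * x ^ 2 + c3 * x ^ 3) ∂μ =
      (c0 - ε) + c1 * ((p ^ 1 + q ^ 1) / 2) + c2 * ((p ^ 2 + q ^ 2) / 2) +
        c3 * ((p ^ 3 + q ^ 3) / 2) := by
    rw [integral_add (hint _ (by fun_prop)) (hint _ (by fun_prop)),
      integral_add (hint _ (by fun_prop)) (hint _ (by fun_prop)),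
      integral_add (hint _ (by fun_prop)) (hint _ (by fun_prop)),
      integral_const_mul, integral_const_mul, integral_const_mul, k1, k2, k3]
    simp
  rw [hval] at hmono
  rw [← e1, ← e2]
  linarith
end

section
/- Let a < b be real numbers and let μ be a Borel probability measure on [a,b] such that ∫ x^k dμ(x) = (1/(b-a)) ∫_a^b x^k dx for k = 1, 2, 3. Then for every continuous 3-convex function f : [a,b] → ℝ one has ∫ f dμ ≤ (1/6)·f(a) + (2/3)·f((a+b)/2) + (1/6)·f(b). -/
open MeasureTheory Set

noncomputable def qN (f : ℝ → ℝ) (a m b x : ℝ) : ℝ :=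
  f a + (f m - f a) / (m - a) * (x - a) +
    ((f b - f m) / (b - m) - (f m - f a) / (m - a)) / (b - a) * ((x - a) * (x - m))

noncomputable def sN (f : ℝ → ℝ) (a m b x : ℝ) : ℝ :=
  (f x - qN f a m b x) / ((x - a) * (x - m) * (x - b))

lemma sN_mono (f : ℝ → ℝ) (a m b x y : ℝ) (ham : a < m) (hmb : m < b)
    (hconv : NConvexOn 3 (Set.Icc a b) f) (hx : x ∈ Ioo a m) (hy : y ∈ Ioo m b) :
    sN f a m b x ≤ sN f a m b y := by
  obtain ⟨hx1, hx2⟩ := hx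
  obtain ⟨hy1, hy2⟩ := hy
  have h := hconv ![x, a, m, b, y] (by
      intro i
      fin_cases i <;> simp <;> (try constructor) <;> linarith) (by
      intro i j hij
      fin_cases i <;> fin_cases j <;> simp at hij ⊢ <;> linarith)
  have e : dividedDiff f (3 + 1) ![x, a, m, b, y] =
      ((((f y - f b) / (y - b) - (f b - f m) / (b - m)) / (y - m) -
        ((f b - f m) / (b - m) - (f m - f a) / (m - a)) / (b - a)) / (y - a) -
       (((f b - f m) / (b - m) - (f m - f a) / (m - a)) / (b - a) -
        ((f m - f a) / (m - a) - (f a - f x) / (a - x)) / (m - x)) / (b - x)) / (y - x) := by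
    rfl
  rw [e] at h
  have n1 : y - b ≠ 0 := by intro h; linarith
  have n2 : b - m ≠ 0 := by intro h; linarith
  have n3 : y - m ≠ 0 := by intro h; linarith
  have n4 : m - a ≠ 0 := by intro h; linarith
  have n5 : b - a ≠ 0 := by intro h; linarith
  have n6 : y - a ≠ 0 := by intro h; linarith
  have n7 : a - x ≠ 0 := by intro h; linarith
  have n8 : m - x ≠ 0 := by intro h; linarith
  have n9 : b - x ≠ 0 := by intro h; linarith
  have n7' : x - a ≠ 0 := by intro h; linarith
  have n8' : x - m ≠ 0 := by intro h; linarith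
  have n9' : x - b ≠ 0 := by intro h; linarith
  have ey : sN f a m b y = (((f y - f b) / (y - b) - (f b - f m) / (b - m)) / (y - m) -
        ((f b - f m) / (b - m) - (f m - f a) / (m - a)) / (b - a)) / (y - a) := by
    unfold sN qN
    field_simp
    ring
  have ex : sN f a m b x = (((f b - f m) / (b - m) - (f m - f a) / (m - a)) / (b - a) -
        ((f m - f a) / (m - a) - (f a - f x) / (a - x)) / (m - x)) / (b - x) := by
    have : (f a - f x) / (a - x) = (f x - f a) / (x - a) := by
      rw [div_eq_div_iff n7 n7']; ring
    rw [this, ← neg_sub x m, ← neg_sub x b]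
    unfold sN qN
    field_simp
    ring
  rw [← ey, ← ex] at h
  have hyx : 0 < y - x := by linarith
  by_contra hc
  push Not at hc
  have := div_neg_of_neg_of_pos (sub_neg.2 hc) hyx
  linarith

lemma exists_cubic (f : ℝ → ℝ) (a m b : ℝ) (ham : a < m) (hmb : m < b)
    (hconv : NConvexOn 3 (Set.Icc a b) f) :
    ∃ c : ℝ, ∀ x ∈ Icc a b, f x ≤ qN f a m b x + c * ((x - a) * (x - m) * (x - b)) := by
  have hbd : ∀ y ∈ Ioo m b, sN f a m b y ∈ upperBounds (sN f a m b '' Ioo a m) := by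
    rintro y hy _ ⟨x, hx, rfl⟩
    exact sN_mono f a m b x y ham hmb hconv hx hy
  have hne : (sN f a m b '' Ioo a m).Nonempty := (nonempty_Ioo.2 ham).image _
  obtain ⟨y0, hy0⟩ := nonempty_Ioo.2 hmb
  have n2 : b - m ≠ 0 := by intro h; linarith
  have n4 : m - a ≠ 0 := by intro h; linarith
  have n5 : b - a ≠ 0 := by intro h; linarith
  refine ⟨sSup (sN f a m b '' Ioo a m), fun x hx => ?_⟩
  rcases eq_or_lt_of_le hx.1 with rfl | h1
  · simp [qN]
  rcases eq_or_lt_of_le hx.2 with rfl | h2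
  · apply le_of_eq
    unfold qN
    field_simp
    ring
  rcases lt_trichotomy x m with h3 | rfl | h3
  · have h := le_csSup ⟨_, hbd y0 hy0⟩ (mem_image_of_mem (sN f a m b) (⟨h1, h3⟩ : x ∈ Ioo a m))
    have hw : 0 < (x - a) * (x - m) * (x - b) :=
      mul_pos_of_neg_of_neg (mul_neg_of_pos_of_neg (by linarith) (by linarith)) (by linarith)
    have := (div_le_iff₀ hw).1 h
    linarith
  · apply le_of_eq
    unfold qN
    field_simp
    ring
  · have h := csSup_le hne (hbd x ⟨h3, h2⟩)
    have hw : (x - a) * (x - m) * (x - b) < 0 :=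
      mul_neg_of_pos_of_neg (mul_pos (by linarith) (by linarith)) (by linarith)
    have := (le_div_iff_of_neg hw).1 h
    linarith

theorem stmt2 (a b : ℝ) (hab : a < b) (μ : Measure ℝ) [IsProbabilityMeasure μ]
    (hsupp : μ (Set.Icc a b) = 1)
    (hmom : ∀ k ∈ Finset.Icc 1 3, ∫ x, x ^ k ∂μ = (b - a)⁻¹ * ∫ x in a..b, x ^ k)
    (f : ℝ → ℝ) (hcont : ContinuousOn f (Set.Icc a b))
    (hconv : NConvexOn 3 (Set.Icc a b) f) :
    ∫ x, f x ∂μ ≤ (1 / 6) * f a + (2 / 3) * f ((a + b) / 2) + (1 / 6) * f b := by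
  have hae : ∀ᵐ x ∂μ, x ∈ Icc a b := by
    rw [← prob_compl_eq_zero_iff measurableSet_Icc] at hsupp
    exact hsupp
  have hres : μ.restrict (Icc a b) = μ := Measure.restrict_eq_self_of_ae_mem hae
  have hint : ∀ g : ℝ → ℝ, ContinuousOn g (Icc a b) → Integrable g μ := by
    intro g hg
    have := hg.integrableOn_compact (μ := μ) isCompact_Icc
    rwa [IntegrableOn, hres] at this
  obtain ⟨c, hc⟩ := exists_cubic f a ((a + b) / 2) b (by linarith) (by linarith) hconv
  obtain ⟨h, rfl⟩ : ∃ h, b = a + 2 * h := ⟨(b - a) / 2, by ring⟩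
  have hm : (a + (a + 2 * h)) / 2 = a + h := by ring
  rw [hm] at hc ⊢
  have hh : h ≠ 0 := by intro h0; subst h0; linarith
  have m1 := hmom 1 (by simp)
  have m2 := hmom 2 (by simp)
  have m3 := hmom 3 (by simp)
  rw [integral_pow] at m1 m2 m3
  obtain ⟨A, hA⟩ : ∃ A, A = f a := ⟨_, rfl⟩
  obtain ⟨M, hM⟩ : ∃ M, M = f (a + h) := ⟨_, rfl⟩
  obtain ⟨B, hB⟩ : ∃ B, B = f (a + 2 * h) := ⟨_, rfl⟩
  rw [← hA, ← hM, ← hB]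
  set p := (M - A) / h with hp
  set r := (B - 2 * M + A) / (2 * h ^ 2) with hr
  have hle : ∀ x ∈ Icc a (a + 2 * h), f x ≤
      (A - p * a + r * (a * (a + h)) - c * (a * (a + h) * (a + 2 * h)))
      + (p - r * (2 * a + h) + c * (3 * a ^ 2 + 6 * a * h + 2 * h ^ 2)) * x ^ 1
      + (r - c * (3 * a + 3 * h)) * x ^ 2 + c * x ^ 3 := by
    intro x hx
    refine (hc x hx).trans (le_of_eq ?_)
    have e1 : a + h - a = h := by ring
    have e2 : a + 2 * h - (a + h) = h := by ring
    have e3 : a + 2 * h - a = 2 * h := by ring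
    rw [qN, e1, e2, e3, hp, hr, ← hA, ← hM, ← hB]
    field_simp
    ring
  have i1 : Integrable (fun x : ℝ => x ^ 1) μ := hint _ (by fun_prop)
  have i2 : Integrable (fun x : ℝ => x ^ 2) μ := hint _ (by fun_prop)
  have i3 : Integrable (fun x : ℝ => x ^ 3) μ := hint _ (by fun_prop)
  have hI := integral_mono_ae (hint f hcont) (hint _ (by fun_prop)) (hae.mono hle)
  refine hI.trans (le_of_eq ?_)
  rw [integral_add (hint _ (by fun_prop)) (hint _ (by fun_prop)),
    integral_add (hint _ (by fun_prop)) (hint _ (by fun_prop)),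
    integral_add (hint _ (by fun_prop)) (hint _ (by fun_prop)),
    integral_const_mul, integral_const_mul, integral_const_mul, m1, m2, m3, integral_const,
    hp, hr]
  have e3 : a + 2 * h - a = 2 * h := by ring
  rw [e3]
  simp only [probReal_univ, one_smul]
  push_cast
  field_simp
  ring
end

section
/- Let a < b be real numbers and let μ be a Borel probability measure on [a,b] such that ∫ x^k dμ(x) = (1/(b-a)) ∫_a^b x^k dx for k = 1, 2. Then for every continuous 2-convex function f : [a,b] → ℝ one has (1/4)·f(a) + (3/4)·f((a+2b)/3) ≤ ∫ f dμ. -/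
open MeasureTheory Set

theorem key_mono (a b c : ℝ) (f : ℝ → ℝ) (hconv : NConvexOn 2 (Set.Icc a b) f)
    (x y : ℝ) (h1 : a < x) (h2 : x < c) (h3 : c < y) (h4 : y ≤ b) :
    (f x - f a - (f c - f a) / (c - a) * (x - a)) / ((x - a) * (x - c)) ≤
    (f y - f a - (f c - f a) / (c - a) * (y - a)) / ((y - a) * (y - c)) := by
  have hm : StrictMono ![a, x, c, y] := by
    rw [Fin.strictMono_iff_lt_succ]
    intro i
    fin_cases i <;> simp <;> assumption
  have h := hconv ![a, x, c, y] (by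
    intro i
    fin_cases i <;> simp <;> (try constructor) <;> linarith) hm.injective
  have e : dividedDiff f 3 ![a, x, c, y] =
      (((f y - f c) / (y - c) - (f c - f x) / (c - x)) / (y - x) -
       ((f c - f x) / (c - x) - (f x - f a) / (x - a)) / (c - a)) / (y - a) := by
    rfl
  rw [e] at h
  have n1 : x - a ≠ 0 := by linarith
  have n2 : x - c ≠ 0 := by intro h; linarith
  have n2' : c - x ≠ 0 := by intro h; linarith
  have n3 : y - c ≠ 0 := by linarith
  have n4 : y - a ≠ 0 := by linarith
  have n5 : c - a ≠ 0 := by linarith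
  have n6 : y - x ≠ 0 := by linarith
  have e2 : (f y - f a - (f c - f a) / (c - a) * (y - a)) / ((y - a) * (y - c)) -
      (f x - f a - (f c - f a) / (c - a) * (x - a)) / ((x - a) * (x - c)) = (y - x) *
      ((((f y - f c) / (y - c) - (f c - f x) / (c - x)) / (y - x) -
       ((f c - f x) / (c - x) - (f x - f a) / (x - a)) / (c - a)) / (y - a)) := by
    rw [show x - c = -(c - x) by ring]
    field_simp
    ring
  have := mul_nonneg (show 0 ≤ y - x by linarith) h
  linarith

theorem key_quad (a b c : ℝ) (f : ℝ → ℝ) (hac : a < c) (hcb : c < b)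
    (hconv : NConvexOn 2 (Set.Icc a b) f) :
    ∃ s : ℝ, ∀ x ∈ Set.Icc a b,
      f a + (f c - f a) / (c - a) * (x - a) + s * ((x - a) * (x - c)) ≤ f x := by
  set g : ℝ → ℝ := fun x =>
    (f x - f a - (f c - f a) / (c - a) * (x - a)) / ((x - a) * (x - c)) with hg
  have hmono : ∀ x y, a < x → x < c → c < y → y ≤ b → g x ≤ g y :=
    fun x y => key_mono a b c f hconv x y
  have hne : (g '' Set.Ioo a c).Nonempty := (Set.nonempty_Ioo.2 hac).image g
  have hbd : BddAbove (g '' Set.Ioo a c) := by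
    refine ⟨g b, ?_⟩
    rintro _ ⟨x, hx, rfl⟩
    exact hmono x b hx.1 hx.2 hcb le_rfl
  refine ⟨sSup (g '' Set.Ioo a c), fun x hx => ?_⟩
  rcases eq_or_lt_of_le hx.1 with h | h
  · subst h; simp
  have hid : x ≠ c → g x * ((x - a) * (x - c)) =
      f x - f a - (f c - f a) / (c - a) * (x - a) := by
    intro hxc
    exact div_mul_cancel₀ _ (mul_ne_zero (by linarith) (sub_ne_zero.2 hxc))
  rcases lt_trichotomy x c with h' | h' | h'
  · have h1 : g x ≤ sSup (g '' Set.Ioo a c) := le_csSup hbd ⟨x, ⟨h, h'⟩, rfl⟩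
    have h2 := hid h'.ne
    have h3 : (x - a) * (x - c) ≤ 0 :=
      mul_nonpos_of_nonneg_of_nonpos (by linarith) (by linarith)
    have := mul_le_mul_of_nonpos_right h1 h3
    linarith
  · subst h'
    have : (f x - f a) / (x - a) * (x - a) = f x - f a := div_mul_cancel₀ _ (by linarith)
    rw [this]; simp
  · have h1 : sSup (g '' Set.Ioo a c) ≤ g x := by
      apply csSup_le hne
      rintro _ ⟨z, hz, rfl⟩
      exact hmono z x hz.1 hz.2 h' hx.2
    have h2 := hid h'.ne'
    have h3 : 0 ≤ (x - a) * (x - c) := mul_nonneg (by linarith) (by linarith)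
    have := mul_le_mul_of_nonneg_right h1 h3
    linarith

theorem stmt3 (a b : ℝ) (hab : a < b) (μ : Measure ℝ) [IsProbabilityMeasure μ]
    (hsupp : μ (Set.Icc a b) = 1)
    (hmom : ∀ k ∈ Finset.Icc 1 2, ∫ x, x ^ k ∂μ = (b - a)⁻¹ * ∫ x in a..b, x ^ k)
    (f : ℝ → ℝ) (hcont : ContinuousOn f (Set.Icc a b))
    (hconv : NConvexOn 2 (Set.Icc a b) f) :
    (1 / 4) * f a + (3 / 4) * f ((a + 2 * b) / 3) ≤ ∫ x, f x ∂μ := by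
  obtain ⟨s, hs⟩ := key_quad a b ((a + 2 * b) / 3) f (by linarith) (by linarith) hconv
  have hae : ∀ᵐ x ∂μ, x ∈ Set.Icc a b := by
    rw [← prob_compl_eq_zero_iff measurableSet_Icc] at hsupp
    exact hsupp
  have hint : ∀ h : ℝ → ℝ, ContinuousOn h (Set.Icc a b) → Integrable h μ := by
    intro h hh
    have := hh.integrableOn_compact (μ := μ) isCompact_Icc
    rwa [IntegrableOn, Measure.restrict_eq_self_of_ae_mem hae] at this
  have m1 := hmom 1 (by simp)
  have m2 := hmom 2 (by simp)
  have hba : b - a ≠ 0 := by linarith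
  rw [integral_pow] at m1 m2
  set c := (a + 2 * b) / 3 with hc
  set d := (f c - f a) / (c - a) with hd
  have hle : ∫ x, ((f a - d * a + s * (a * c)) + (d - s * (a + c)) * x ^ 1 + s * x ^ 2) ∂μ
      ≤ ∫ x, f x ∂μ := by
    apply integral_mono_ae (hint _ (by fun_prop)) (hint _ hcont)
    filter_upwards [hae] with x hx
    have := hs x hx
    linarith
  have i1 : Integrable (fun x : ℝ => (d - s * (a + c)) * x ^ 1) μ := hint _ (by fun_prop)
  have i2 : Integrable (fun x : ℝ => s * x ^ 2) μ := hint _ (by fun_prop)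
  have i0 : Integrable (fun x : ℝ => (f a - d * a + s * (a * c)) + (d - s * (a + c)) * x ^ 1) μ :=
    hint _ (by fun_prop)
  rw [integral_add i0 i2, integral_add (integrable_const _) i1, integral_const_mul,
    integral_const_mul, m1, m2] at hle
  simp only [integral_const, probReal_univ, one_smul] at hle
  have e1 : (b - a)⁻¹ * ((b ^ (1 + 1) - a ^ (1 + 1)) / (((1 : ℕ) : ℝ) + 1)) = (a + b) / 2 := by
    push_cast; field_simp; ring
  have e2 : (b - a)⁻¹ * ((b ^ (2 + 1) - a ^ (2 + 1)) / (((2 : ℕ) : ℝ) + 1))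
      = (a ^ 2 + a * b + b ^ 2) / 3 := by
    push_cast; field_simp; ring
  rw [e1, e2] at hle
  have hca : d * (c - a) = f c - f a := div_mul_cancel₀ _ (by rw [hc]; intro h; linarith)
  have hfc : f c = f a + d * (c - a) := by linarith
  refine le_trans (le_of_eq ?_) hle
  rw [hfc]
  clear_value d
  rw [hc]
  ring
end

section
/- Let a < b be real numbers and let μ be a Borel probability measure on [a,b] such that ∫ x^k dμ(x) = (1/(b-a)) ∫_a^b x^k dx for k = 1, 2. Then for every continuous 2-convex function f : [a,b] → ℝ one has ∫ f dμ ≤ (3/4)·f((2a+b)/3) + (1/4)·f(b). -/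
open MeasureTheory Set

lemma aux_D (a b : ℝ) (f : ℝ → ℝ) (hconv : NConvexOn 2 (Set.Icc a b) f)
    (c x y : ℝ) (hx : a ≤ x) (hxc : x < c) (hcy : c < y) (hyb : y < b) :
    ((f x - f c) / (x - c) - (f b - f c) / (b - c)) / (x - b) ≤
    ((f y - f c) / (y - c) - (f b - f c) / (b - c)) / (y - b) := by
  have h := hconv ![x, c, b, y] (by
    intro i
    fin_cases i <;> simp <;> (try constructor) <;> linarith) (by
    have h1 : x ≠ c := hxc.ne
    have h2 : x ≠ b := (by linarith : x < b).ne
    have h3 : x ≠ y := (by linarith : x < y).ne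
    have h4 : c ≠ b := (by linarith : c < b).ne
    have h5 : c ≠ y := hcy.ne
    have h6 : b ≠ y := hyb.ne'
    intro i j hij
    fin_cases i <;> fin_cases j <;> simp_all)
  have e : dividedDiff f (2 + 1) ![x, c, b, y] =
    ((((f y - f b) / (y - b) - (f b - f c) / (b - c)) / (y - c)) -
      (((f b - f c) / (b - c) - (f c - f x) / (c - x)) / (b - x))) / (y - x) := by
    simp [dividedDiff]
  rw [e] at h
  have hyx : 0 < y - x := by linarith
  have h' : 0 ≤ (((f y - f b) / (y - b) - (f b - f c) / (b - c)) / (y - c)) -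
      (((f b - f c) / (b - c) - (f c - f x) / (c - x)) / (b - x)) := by
    by_contra hh
    push Not at hh
    exact absurd h (not_le.mpr (div_neg_of_neg_of_pos hh hyx))
  have e1 : ((f y - f b) / (y - b) - (f b - f c) / (b - c)) / (y - c) =
      ((f y - f c) / (y - c) - (f b - f c) / (b - c)) / (y - b) := by
    have h1 : y - b ≠ 0 := (by linarith : y - b < 0).ne
    have h2 : b - c ≠ 0 := (by linarith : 0 < b - c).ne'
    have h3 : y - c ≠ 0 := (by linarith : 0 < y - c).ne'
    field_simp
    ring
  have e2 : ((f b - f c) / (b - c) - (f c - f x) / (c - x)) / (b - x) =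
      ((f x - f c) / (x - c) - (f b - f c) / (b - c)) / (x - b) := by
    rw [← neg_sub (f x) (f c), ← neg_sub x c, neg_div_neg_eq, ← neg_sub x b, div_neg,
      ← neg_div, neg_sub]
  rw [e1, e2] at h'
  linarith

theorem stmt4 (a b : ℝ) (hab : a < b) (μ : Measure ℝ) [IsProbabilityMeasure μ]
    (hsupp : μ (Set.Icc a b) = 1)
    (hmom : ∀ k ∈ Finset.Icc 1 2, ∫ x, x ^ k ∂μ = (b - a)⁻¹ * ∫ x in a..b, x ^ k)
    (f : ℝ → ℝ) (hcont : ContinuousOn f (Set.Icc a b))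
    (hconv : NConvexOn 2 (Set.Icc a b) f) :
    ∫ x, f x ∂μ ≤ (3 / 4) * f ((2 * a + b) / 3) + (1 / 4) * f b := by
  have hba : b - a ≠ 0 := (sub_pos.mpr hab).ne'
  have hae : ∀ᵐ x ∂μ, x ∈ Set.Icc a b := by
    exact (mem_ae_iff_prob_eq_one measurableSet_Icc).2 hsupp
  have hres : μ.restrict (Set.Icc a b) = μ := Measure.restrict_eq_self_of_ae_mem hae
  have hint : ∀ g : ℝ → ℝ, ContinuousOn g (Set.Icc a b) → Integrable g μ := by
    intro g hg
    have := hg.integrableOn_compact (μ := μ) isCompact_Icc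
    rwa [IntegrableOn, hres] at this
  have m1 : ∫ x, x ∂μ = (a + b) / 2 := by
    have := hmom 1 (by simp)
    rw [integral_pow] at this
    simp only [pow_one] at this
    rw [this]; field_simp; push_cast; ring
  have m2 : ∫ x, x ^ 2 ∂μ = (a ^ 2 + a * b + b ^ 2) / 3 := by
    have := hmom 2 (by simp)
    rw [integral_pow] at this
    rw [this]; field_simp; push_cast; ring
  obtain ⟨c, hc⟩ : ∃ c, c = (2 * a + b) / 3 := ⟨_, rfl⟩
  rw [← hc]
  have hac : a < c := by rw [hc]; linarith
  have hcb : c < b := by rw [hc]; linarith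
  set m := (f b - f c) / (b - c) with hm
  set D : ℝ → ℝ := fun x => ((f x - f c) / (x - c) - m) / (x - b) with hD
  have hDm : ∀ x y, a ≤ x → x < c → c < y → y < b → D x ≤ D y := fun x y h1 h2 h3 h4 =>
    aux_D a b f hconv c x y h1 h2 h3 h4
  obtain ⟨s, hs1, hs2⟩ : ∃ s, (∀ x, a ≤ x → x < c → D x ≤ s) ∧
      (∀ y, c < y → y < b → s ≤ D y) := by
    refine ⟨sSup (D '' Set.Ico a c), ?_, ?_⟩
    · intro x h1 h2
      refine le_csSup ⟨D ((c + b) / 2), ?_⟩ ⟨x, ⟨h1, h2⟩, rfl⟩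
      rintro _ ⟨z, hz, rfl⟩
      exact hDm z _ hz.1 hz.2 (by linarith) (by linarith)
    · intro y h1 h2
      refine csSup_le ⟨D a, a, ⟨le_rfl, hac⟩, rfl⟩ ?_
      rintro _ ⟨z, hz, rfl⟩
      exact hDm z _ hz.1 hz.2 h1 h2
  have hfD : ∀ x, x ≠ c → x ≠ b → f x = f c + (x - c) * m + (x - c) * (x - b) * D x := by
    intro x h1 h2
    have h1' := sub_ne_zero.mpr h1
    have h2' := sub_ne_zero.mpr h2
    simp only [hD]
    field_simp
    ring
  have hmb : f b = f c + (b - c) * m := by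
    have : b - c ≠ 0 := (sub_pos.mpr hcb).ne'
    rw [hm]; field_simp; ring
  have hle : ∀ x ∈ Set.Icc a b, f x ≤ f c + (x - c) * m + (x - c) * (x - b) * s := by
    intro x hx
    rcases eq_or_ne x b with rfl | hxb
    · rw [hmb]; simp
    rcases lt_trichotomy x c with h | rfl | h
    · have h1 := hfD x h.ne hxb
      have h2 := hs1 x hx.1 h
      have h3 : 0 ≤ (x - c) * (x - b) := mul_nonneg_of_nonpos_of_nonpos (by linarith) (by linarith)
      have := mul_le_mul_of_nonneg_left h2 h3
      linarith
    · simp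
    · have hxb' := lt_of_le_of_ne hx.2 hxb
      have h1 := hfD x h.ne' hxb
      have h2 := hs2 x h hxb'
      have h3 : (x - c) * (x - b) ≤ 0 := mul_nonpos_of_nonneg_of_nonpos (by linarith) (by linarith)
      have := mul_le_mul_of_nonpos_left h2 h3
      linarith
  have key : ∫ x, f x ∂μ ≤ ∫ x, ((f c - c * m + c * b * s) + (m - (b + c) * s) * x + s * x ^ 2) ∂μ := by
    refine integral_mono_ae (hint f hcont) (hint _ (by fun_prop)) ?_
    filter_upwards [hae] with x hx
    have := hle x hx
    nlinarith
  rw [integral_add (hint _ (by fun_prop)) (hint _ (by fun_prop)),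
    integral_add (hint _ (by fun_prop)) (hint _ (by fun_prop)),
    integral_const_mul, integral_const_mul, m1, m2] at key
  simp only [integral_const, probReal_univ, one_smul] at key
  refine key.trans (le_of_eq ?_)
  rw [hmb, hc]
  ring
end

section
/- Let μ be a Borel probability measure on [-1,1] such that ∫ x dμ = 0, ∫ x² dμ = 1/3, ∫ x³ dμ = 0, ∫ x⁴ dμ = 1/5 and ∫ x⁵ dμ = 0 (i.e. the first five moments of μ agree with those of the normalized Lebesgue measure on [-1,1]). Then for every continuous 5-convex function f : [-1,1] → ℝ one has (5/18)·f(−√(3/5)) + (4/9)·f(0) + (5/18)·f(√(3/5)) ≤ ∫ f dμ. -/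
open MeasureTheory Set

lemma dd_sub (f g : ℝ → ℝ) : ∀ (k : ℕ) (x : Fin (k + 1) → ℝ),
    dividedDiff (fun t => f t - g t) k x = dividedDiff f k x - dividedDiff g k x
  | 0, x => rfl
  | k + 1, x => by
      simp only [dividedDiff, dd_sub f g k]
      ring

lemma dd_add (f g : ℝ → ℝ) : ∀ (k : ℕ) (x : Fin (k + 1) → ℝ),
    dividedDiff (fun t => f t + g t) k x = dividedDiff f k x + dividedDiff g k x
  | 0, x => rfl
  | k + 1, x => by
      simp only [dividedDiff, dd_add f g k]
      ring

lemma dd_smul (c : ℝ) (g : ℝ → ℝ) : ∀ (k : ℕ) (x : Fin (k + 1) → ℝ),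
    dividedDiff (fun t => c * g t) k x = c * dividedDiff g k x
  | 0, x => rfl
  | k + 1, x => by
      simp only [dividedDiff, dd_smul c g k]
      ring

lemma dd_mul (g : ℝ → ℝ) : ∀ (k : ℕ) (x : Fin (k + 2) → ℝ), Function.Injective x →
    dividedDiff (fun t => t * g t) (k + 1) x =
      x 0 * dividedDiff g (k + 1) x + dividedDiff g k (fun i => x i.succ)
  | 0, x, hx => by
      have h : x 1 - x 0 ≠ 0 := sub_ne_zero.2 (fun h => by simpa using hx h)
      simp [dividedDiff]
      field_simp
      ring
  | k + 1, x, hx => by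
      have h : x (Fin.last (k + 2)) - x 0 ≠ 0 :=
        sub_ne_zero.2 (fun h => by simpa [Fin.ext_iff] using hx h)
      have h' : x (Fin.last (k + 2)) - x 1 ≠ 0 :=
        sub_ne_zero.2 (fun h => by simpa [Fin.ext_iff] using hx h)
      have e1 := dd_mul g k (fun i => x i.succ) (hx.comp (Fin.succ_injective _))
      have e2 := dd_mul g k (fun i => x i.castSucc) (hx.comp (Fin.castSucc_injective _))
      have e3 : dividedDiff g (k+1) (fun i => x i.succ) * (x (Fin.last (k + 2)) - x 1) =
        dividedDiff g k (fun i => x i.succ.succ) - dividedDiff g k (fun i => x i.succ.castSucc) := by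
        rw [dividedDiff]
        exact div_mul_cancel₀ _ h'
      rw [dividedDiff, e1, e2, dividedDiff.eq_2 g (k+1)]
      have e4 : x (Fin.succ 0) = x 1 := rfl
      have e5 : x (Fin.castSucc 0) = x 0 := rfl
      rw [e4, e5]
      field_simp
      linear_combination (-1 : ℝ) * e3

lemma dd_const : ∀ (k : ℕ) (x : Fin (k + 2) → ℝ),
    dividedDiff (fun _ => 1) (k + 1) x = 0
  | 0, x => by simp [dividedDiff]
  | k + 1, x => by rw [dividedDiff, dd_const k, dd_const k]; simp

lemma dd_pow : ∀ (n k : ℕ) (x : Fin (k + 1) → ℝ), n < k → Function.Injective x →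
    dividedDiff (fun t => t ^ n) k x = 0
  | 0, 0, _, h, _ => by omega
  | 0, k + 1, x, _, _ => by simpa using dd_const k x
  | n + 1, 0, _, h, _ => by omega
  | n + 1, k + 1, x, h, hx => by
      have : (fun t : ℝ => t ^ (n+1)) = fun t => t * t ^ n := by ext t; ring
      rw [this, dd_mul _ k x hx, dd_pow n (k+1) x (by omega) hx,
        dd_pow n k (fun i => x i.succ) (by omega) (hx.comp (Fin.succ_injective _))]
      simp

lemma dd_zero (g : ℝ → ℝ) : ∀ (k : ℕ) (x : Fin (k + 1) → ℝ), (∀ i, g (x i) = 0) →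
    dividedDiff g k x = 0
  | 0, x, h => h 0
  | k + 1, x, h => by
      rw [dividedDiff, dd_zero g k _ (fun i => h _), dd_zero g k _ (fun i => h _)]; simp

lemma dd_last (g : ℝ → ℝ) : ∀ (k : ℕ) (x : Fin (k + 1) → ℝ),
    (∀ i : Fin k, g (x i.castSucc) = 0) →
    dividedDiff g k x = g (x (Fin.last k)) / ∏ i : Fin k, (x (Fin.last k) - x i.castSucc)
  | 0, x, h => by simp [dividedDiff]
  | k + 1, x, h => by
      rw [dividedDiff, dd_last g k _ (fun i => h i.succ), dd_zero g k _ (fun i => h _),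
        Fin.prod_univ_succ, sub_zero, div_div, mul_comm]
      rfl

lemma key_s5 (f : ℝ → ℝ) (hconv : NConvexOn 5 (Set.Icc (-1 : ℝ) 1) f) (p : ℝ → ℝ)
    (a0 a1 a2 a3 a4 a5 : ℝ)
    (hp : p = fun t => a0 * t^0 + a1 * t^1 + a2 * t^2 + a3 * t^3 + a4 * t^4 + a5 * t^5)
    (x : Fin 7 → ℝ) (hI : ∀ i, x i ∈ Set.Icc (-1 : ℝ) 1) (hx : Function.Injective x)
    (he : ∀ i : Fin 6, f (x i.castSucc) = p (x i.castSucc))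
    (hpos : 0 < ∏ i : Fin 6, (x (Fin.last 6) - x i.castSucc)) :
    p (x (Fin.last 6)) ≤ f (x (Fin.last 6)) := by
  have h := hconv x hI hx
  have hz : dividedDiff p 6 x = 0 := by
    rw [hp]
    simp only [dd_add, dd_smul]
    rw [dd_pow 0 6 x (by norm_num) hx, dd_pow 1 6 x (by norm_num) hx,
      dd_pow 2 6 x (by norm_num) hx, dd_pow 3 6 x (by norm_num) hx,
      dd_pow 4 6 x (by norm_num) hx, dd_pow 5 6 x (by norm_num) hx]
    simp
  have h2 := dd_last (fun t => f t - p t) 6 x (fun i => sub_eq_zero.2 (he i))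
  rw [dd_sub, hz, sub_zero] at h2
  have h' : 0 ≤ dividedDiff f 6 x := h
  rw [h2] at h'
  have := (le_div_iff₀ hpos).1 h'
  rw [zero_mul] at this
  linarith

lemma interp3 (u v w A B C : ℝ) (h1 : u ≠ v) (h2 : u ≠ w) (h3 : v ≠ w) :
    ∃ a b c : ℝ, a + b * u + c * u^2 = A ∧ a + b * v + c * v^2 = B ∧ a + b * w + c * w^2 = C := by
  have h1 : v - u ≠ 0 := sub_ne_zero.2 h1.symm
  have h2 : w - u ≠ 0 := sub_ne_zero.2 h2.symm
  have h3 : w - v ≠ 0 := sub_ne_zero.2 h3.symm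
  obtain ⟨m, hm⟩ : ∃ m, m * (v - u) = B - A := ⟨(B-A)/(v-u), div_mul_cancel₀ _ h1⟩
  obtain ⟨c, hc⟩ : ∃ c, c * ((w - u) * (w - v)) = C - A - m * (w - u) :=
    ⟨_, div_mul_cancel₀ _ (mul_ne_zero h2 h3)⟩
  refine ⟨A - m * u + c * u * v, m - c * (u + v), c, by ring, ?_, ?_⟩
  · linear_combination hm
  · linear_combination hc

/-- the degree five polynomial -/
noncomputable def PP (q0 q1 q2 : ℝ) (r : ℝ × ℝ × ℝ) (t : ℝ) : ℝ :=
  q0 + q1 * t + q2 * t^2 + (t^3 - 3/5 * t) * (r.1 + r.2.1 * t + r.2.2 * t^2)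

lemma step (f : ℝ → ℝ) (hconv : NConvexOn 5 (Set.Icc (-1 : ℝ) 1) f) (s q0 q1 q2 : ℝ)
    (hs : s^2 = 3/5) (hs0 : 0.77 < s) (hs1 : s < 0.78)
    (e1 : q0 + q1 * (-s) + q2 * (-s)^2 = f (-s)) (e2 : q0 + q1 * 0 + q2 * 0^2 = f 0)
    (e3 : q0 + q1 * s + q2 * s^2 = f s) (h : ℝ) (h0 : 0 < h) (h1 : h ≤ 1/10) :
    ∃ r : ℝ × ℝ × ℝ, ∀ t ∈ Set.Icc (-1 : ℝ) 1, t ∉ Icc (-s) (-s+h) → t ∉ Icc 0 h →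
      t ∉ Icc s (s+h) → PP q0 q1 q2 r t ≤ f t := by
  norm_num at hs0 hs1
  have hw : ∀ t : ℝ, t^3 - 3/5*t = t * (t - s) * (t + s) := by
    intro t; linear_combination t * hs
  have n1 : (-s+h)^3 - 3/5*(-s+h) ≠ 0 := by
    rw [hw]; exact mul_ne_zero (mul_ne_zero (by linarith) (by linarith)) (by linarith)
  have n2 : h^3 - 3/5*h ≠ 0 := by
    rw [hw]; exact mul_ne_zero (mul_ne_zero (by linarith) (by linarith)) (by linarith)
  have n3 : (s+h)^3 - 3/5*(s+h) ≠ 0 := by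
    rw [hw]; exact mul_ne_zero (mul_ne_zero (by linarith) (by linarith)) (by linarith)
  obtain ⟨a, b, c, i1, i2, i3⟩ := interp3 (-s+h) h (s+h)
    ((f (-s+h) - (q0 + q1 * (-s+h) + q2 * (-s+h)^2)) / ((-s+h)^3 - 3/5*(-s+h)))
    ((f h - (q0 + q1 * h + q2 * h^2)) / (h^3 - 3/5*h))
    ((f (s+h) - (q0 + q1 * (s+h) + q2 * (s+h)^2)) / ((s+h)^3 - 3/5*(s+h)))
    (by linarith) (by linarith) (by linarith)
  rw [eq_div_iff n1] at i1
  rw [eq_div_iff n2] at i2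
  rw [eq_div_iff n3] at i3
  refine ⟨(a, b, c), fun t ht g1 g2 g3 => ?_⟩
  have p1 : 0 < (t + s) * (t - (-s+h)) := by
    rw [mem_Icc, not_and_or, not_le, not_le] at g1
    rcases g1 with g | g
    · exact mul_pos_of_neg_of_neg (by linarith) (by linarith)
    · exact mul_pos (by linarith) (by linarith)
  have p2 : 0 < t * (t - h) := by
    rw [mem_Icc, not_and_or, not_le, not_le] at g2
    rcases g2 with g | g
    · exact mul_pos_of_neg_of_neg (by linarith) (by linarith)
    · exact mul_pos (by linarith) (by linarith)
  have p3 : 0 < (t - s) * (t - (s+h)) := by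
    rw [mem_Icc, not_and_or, not_le, not_le] at g3
    rcases g3 with g | g
    · exact mul_pos_of_neg_of_neg (by linarith) (by linarith)
    · exact mul_pos (by linarith) (by linarith)
  have ne1 : t ≠ -s := by rintro rfl; simp at p1
  have ne2 : t ≠ -s+h := by rintro rfl; simp at p1
  have ne3 : t ≠ 0 := by rintro rfl; simp at p2
  have ne4 : t ≠ h := by rintro rfl; simp at p2
  have ne5 : t ≠ s := by rintro rfl; simp at p3
  have ne6 : t ≠ s + h := by rintro rfl; simp at p3
  obtain ⟨ht0, ht1⟩ := ht
  have hmono : StrictMono ![-s, -s+h, 0, h, s, s+h] := by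
    rw [Fin.strictMono_iff_lt_succ]
    intro i
    fin_cases i <;> simp <;> linarith
  refine key_s5 f hconv (PP q0 q1 q2 (a,b,c)) q0 (q1 - 3/5*a) (q2 - 3/5*b) (a - 3/5*c) b c ?_
    (Fin.snoc ![-s, -s+h, 0, h, s, s+h] t : Fin 7 → ℝ) ?_ ?_ ?_ ?_ |>.trans_eq' ?_ |>.trans_eq ?_
  · ext t; simp only [PP]; ring
  · intro i
    refine Fin.lastCases ?_ (fun i => ?_) i
    · simp only [Fin.snoc_last]; exact ⟨ht0, ht1⟩
    · simp only [Fin.snoc_castSucc]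
      fin_cases i <;> simp <;> constructor <;> linarith
  · rw [Fin.snoc_injective_iff]
    refine ⟨hmono.injective, ?_⟩
    rintro ⟨i, hi⟩
    fin_cases i <;> simp at hi <;> first | exact ne1 hi.symm | exact ne2 hi.symm | exact ne3 hi.symm | exact ne4 hi.symm | exact ne5 hi.symm | exact ne6 hi.symm
  · intro i
    simp only [Fin.snoc_castSucc]
    fin_cases i <;> simp [PP]
    · linear_combination -e1 + (s * (a - b*s + c*s^2)) * hs
    · linear_combination -i1
    · linear_combination -e2
    · linear_combination -i2
    · linear_combination -e3 + (-s * (a + b*s + c*s^2)) * hs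
    · linear_combination -i3
  · simp only [Fin.snoc_castSucc, Fin.snoc_last]
    have := mul_pos (mul_pos p1 p2) p3
    rw [Fin.prod_univ_six]
    change 0 < (t - -s)*(t-(-s+h))*(t-0)*(t-h)*(t-s)*(t-(s+h))
    linarith [this]
  · simp only [Fin.snoc_last]
  · simp only [Fin.snoc_last]

lemma exists_poly (f : ℝ → ℝ) (hconv : NConvexOn 5 (Set.Icc (-1 : ℝ) 1) f) (s q0 q1 q2 : ℝ)
    (hs : s^2 = 3/5) (hs0 : 0.77 < s) (hs1 : s < 0.78)
    (e1 : q0 + q1 * (-s) + q2 * (-s)^2 = f (-s)) (e2 : q0 + q1 * 0 + q2 * 0^2 = f 0)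
    (e3 : q0 + q1 * s + q2 * s^2 = f s) :
    ∃ r : ℝ × ℝ × ℝ, ∀ t ∈ Set.Icc (-1 : ℝ) 1, PP q0 q1 q2 r t ≤ f t := by
  have hpos : ∀ n : ℕ, (0:ℝ) < 1 / ((n:ℝ) + 10) := fun n => by positivity
  have hle : ∀ n : ℕ, 1 / ((n:ℝ) + 10) ≤ 1/10 := fun n => by
    apply one_div_le_one_div_of_le <;> norm_num
  choose r hr using fun n : ℕ => step f hconv s q0 q1 q2 hs hs0 hs1 e1 e2 e3 _ (hpos n) (hle n)
  norm_num at hs0 hs1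
  obtain ⟨C, hC0, c1, c2, c3, c4⟩ : ∃ C : ℝ, 0 ≤ C ∧
      f (-(9/10)) - (q0 + q1 * (-(9/10)) + q2 * (-(9/10))^2) ≤ C ∧
      f (-(1/2)) - (q0 + q1 * (-(1/2)) + q2 * (-(1/2))^2) ≤ C ∧
      f (1/2) - (q0 + q1 * (1/2) + q2 * (1/2)^2) ≤ C ∧
      f (9/10) - (q0 + q1 * (9/10) + q2 * (9/10)^2) ≤ C := by
    refine ⟨max 0 (max (f (-(9/10)) - (q0 + q1 * (-(9/10)) + q2 * (-(9/10))^2))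
      (max (f (-(1/2)) - (q0 + q1 * (-(1/2)) + q2 * (-(1/2))^2))
      (max (f (1/2) - (q0 + q1 * (1/2) + q2 * (1/2)^2))
      (f (9/10) - (q0 + q1 * (9/10) + q2 * (9/10)^2))))), ?_, ?_, ?_, ?_, ?_⟩ <;> simp
  have hb : ∀ n, r n ∈ Icc ((-(1000*C), -(1000*C), -(1000*C)) : ℝ × ℝ × ℝ)
      (1000*C, 1000*C, 1000*C) := by
    intro n
    have hp := hpos n
    have hl := hle n
    have H : ∀ t, t ∈ Icc (-1:ℝ) 1 → t ∉ Icc (-s) (-s+1/10) → t ∉ Icc (0:ℝ) (1/10) →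
      t ∉ Icc s (s+1/10) → PP q0 q1 q2 (r n) t ≤ f t := by
      intro t ht g1 g2 g3
      refine hr n t ht (fun h => g1 ⟨h.1, ?_⟩) (fun h => g2 ⟨h.1, ?_⟩) (fun h => g3 ⟨h.1, ?_⟩)
      · linarith [h.2]
      · linarith [h.2]
      · linarith [h.2]
    have H1 := H (-(9/10)) (by constructor <;> norm_num) (fun h => by linarith [h.1])
      (fun h => by linarith [h.1]) (fun h => by linarith [h.1])
    have H2 := H (-(1/2)) (by constructor <;> norm_num) (fun h => by linarith [h.2])
      (fun h => by linarith [h.1]) (fun h => by linarith [h.1])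
    have H3 := H (1/2) (by constructor <;> norm_num) (fun h => by linarith [h.2])
      (fun h => by linarith [h.2]) (fun h => by linarith [h.1])
    have H4 := H (9/10) (by constructor <;> norm_num) (fun h => by linarith [h.2])
      (fun h => by linarith [h.2]) (fun h => by linarith [h.2])
    generalize r n = ρ at *
    obtain ⟨a, b, c⟩ := ρ
    simp only [PP] at H1 H2 H3 H4
    norm_num at H1 H2 H3 H4 c1 c2 c3 c4
    refine ⟨⟨?_, ?_, ?_⟩, ⟨?_, ?_, ?_⟩⟩ <;> simp only <;> linarith
  obtain ⟨ρ, -, φ, hφ, hlim⟩ := isCompact_Icc.tendsto_subseq hb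
  refine ⟨ρ, fun t ht => ?_⟩
  have hcont : Continuous (fun r => PP q0 q1 q2 r t) := by unfold PP; fun_prop
  by_cases t1 : t = -s
  · subst t1; rw [← e1]; apply le_of_eq; simp only [PP]
    linear_combination (-s * (ρ.1 - ρ.2.1 * s + ρ.2.2 * s^2)) * hs
  by_cases t2 : t = 0
  · subst t2; rw [← e2]; apply le_of_eq; simp only [PP]; ring
  by_cases t3 : t = s
  · subst t3; rw [← e3]; apply le_of_eq; simp only [PP]
    linear_combination (t * (ρ.1 + ρ.2.1 * t + ρ.2.2 * t^2)) * hs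
  have ht0 : Filter.Tendsto (fun n : ℕ => 1 / ((φ n : ℝ) + 10)) Filter.atTop (nhds 0) := by
    have : Filter.Tendsto (fun n : ℕ => 1 / ((n : ℝ) + 10)) Filter.atTop (nhds 0) := by
      apply Filter.Tendsto.div_atTop tendsto_const_nhds
      exact Filter.tendsto_atTop_add_const_right _ _ tendsto_natCast_atTop_atTop
    exact this.comp hφ.tendsto_atTop
  have hev : ∀ u : ℝ, t ≠ u → ∀ᶠ n : ℕ in Filter.atTop, t ∉ Icc u (u + 1 / ((φ n : ℝ) + 10)) := by
    intro u hu
    rcases lt_or_gt_of_ne hu with h | h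
    · exact Filter.Eventually.of_forall fun n hn => absurd hn.1 (not_le.2 h)
    · filter_upwards [ht0.eventually_lt_const (sub_pos.2 h)] with n hn hm
      linarith [hm.2]
  refine le_of_tendsto ((hcont.tendsto ρ).comp hlim) ?_
  filter_upwards [hev _ t1, hev _ t2, hev _ t3] with n g1 g2 g3
  rw [zero_add] at g2
  exact hr (φ n) t ht g1 g2 g3

theorem stmt5 (μ : Measure ℝ) [IsProbabilityMeasure μ]
    (hsupp : μ (Set.Icc (-1 : ℝ) 1) = 1)
    (h1 : ∫ x, x ∂μ = 0) (h2 : ∫ x, x ^ 2 ∂μ = 1 / 3) (h3 : ∫ x, x ^ 3 ∂μ = 0)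
    (h4 : ∫ x, x ^ 4 ∂μ = 1 / 5) (h5 : ∫ x, x ^ 5 ∂μ = 0)
    (f : ℝ → ℝ) (hcont : ContinuousOn f (Set.Icc (-1 : ℝ) 1))
    (hconv : NConvexOn 5 (Set.Icc (-1 : ℝ) 1) f) :
    (5 / 18) * f (-Real.sqrt (3 / 5)) + (4 / 9) * f 0 + (5 / 18) * f (Real.sqrt (3 / 5)) ≤
      ∫ x, f x ∂μ := by
  obtain ⟨s, hsd⟩ : ∃ s, s = Real.sqrt (3 / 5) := ⟨_, rfl⟩
  have hs : s^2 = 3/5 := by rw [hsd]; exact Real.sq_sqrt (by norm_num)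
  have hsn : 0 ≤ s := by rw [hsd]; exact Real.sqrt_nonneg _
  have hs0 : 0.77 < s := by norm_num; nlinarith
  have hs1 : s < 0.78 := by norm_num; nlinarith
  rw [← hsd]
  have hs0' : 0 < s := by norm_num at hs0; linarith
  obtain ⟨q0, q1, q2, e1, e2, e3⟩ := interp3 (-s) 0 s (f (-s)) (f 0) (f s)
    (by linarith) (by linarith) (by linarith)
  obtain ⟨⟨a, b, c⟩, hr⟩ := exists_poly f hconv s q0 q1 q2 hs hs0 hs1 e1 e2 e3
  have hae : ∀ᵐ x ∂μ, x ∈ Icc (-1:ℝ) 1 :=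
    (prob_compl_eq_zero_iff measurableSet_Icc).2 hsupp
  have hres : μ.restrict (Icc (-1:ℝ) 1) = μ := Measure.restrict_eq_self_of_ae_mem hae
  have hint : ∀ g : ℝ → ℝ, ContinuousOn g (Icc (-1:ℝ) 1) → Integrable g μ := by
    intro g hg
    have := hg.integrableOn_compact (μ := μ) isCompact_Icc
    rwa [IntegrableOn, hres] at this
  have hmono : ∫ x, PP q0 q1 q2 (a, b, c) x ∂μ ≤ ∫ x, f x ∂μ := by
    refine integral_mono_ae (hint _ ?_) (hint f hcont) ?_
    · apply Continuous.continuousOn; unfold PP; fun_prop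
    · filter_upwards [hae] with x hx using hr x hx
  have hI : ∀ (d : ℝ) (n : ℕ), Integrable (fun x : ℝ => d * x ^ n) μ := fun d n =>
    hint _ (by fun_prop)
  have hP : ∫ x, PP q0 q1 q2 (a, b, c) x ∂μ =
      q0 + q2 * (1/3) - 3/5 * b * (1/3) + b * (1/5) := by
    have : ∀ x, PP q0 q1 q2 (a, b, c) x = q0 * x^0 + ((q1 - 3/5*a) * x^1 +
        ((q2 - 3/5*b) * x^2 + ((a - 3/5*c) * x^3 + (b * x^4 + c * x^5)))) := by
      intro x; simp only [PP]; ring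
    simp_rw [this]
    rw [integral_add, integral_add, integral_add, integral_add, integral_add]
    rotate_left
    all_goals try exact hint _ (by fun_prop)
    have h1' : ∫ x : ℝ, x ^ 1 ∂μ = 0 := by simpa using h1
    have h0' : ∫ x : ℝ, x ^ 0 ∂μ = 1 := by simp
    simp only [integral_const_mul, h2, h3, h4, h5, h1', h0']
    ring
  rw [hP] at hmono
  refine le_trans (le_of_eq ?_) hmono
  rw [← e1, ← e2, ← e3]
  linear_combination (5/9 * q2) * hs
end

section
/- Let μ be a Borel probability measure on [-1,1] such that ∫ x dμ = 0, ∫ x² dμ = 1/3, ∫ x³ dμ = 0, ∫ x⁴ dμ = 1/5 and ∫ x⁵ dμ = 0 (i.e. the first five moments of μ agree with those of the normalized Lebesgue measure on [-1,1]). Then for every continuous 5-convex function f : [-1,1] → ℝ one has ∫ f dμ ≤ (1/12)·f(−1) + (5/12)·f(−1/√5) + (5/12)·f(1/√5) + (1/12)·f(1). -/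
open MeasureTheory Set

noncomputable def ddW (f : ℝ → ℝ) (S : Finset ℝ) : ℝ :=
  ∑ s ∈ S, f s * ∏ t ∈ S.erase s, (s - t)⁻¹

lemma ddW_erase (f : ℝ → ℝ) (S : Finset ℝ) (a : ℝ) (ha : a ∈ S) :
    ddW f (S.erase a) = ∑ s ∈ S, f s * (∏ t ∈ S.erase s, (s - t)⁻¹) * (s - a) := by
  rw [← Finset.add_sum_erase S _ ha]
  simp only [sub_self, mul_zero, zero_add]
  unfold ddW
  apply Finset.sum_congr rfl
  intro s hs
  have hsa : s ≠ a := Finset.ne_of_mem_erase hs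
  have ha' : a ∈ S.erase s := Finset.mem_erase.2 ⟨hsa.symm, ha⟩
  rw [← Finset.mul_prod_erase (S.erase s) _ ha', Finset.erase_right_comm]
  have : s - a ≠ 0 := sub_ne_zero.2 hsa
  field_simp

lemma ddW_rec (f : ℝ → ℝ) (S : Finset ℝ) (a b : ℝ) (ha : a ∈ S) (hb : b ∈ S) :
    ddW f (S.erase a) - ddW f (S.erase b) = (b - a) * ddW f S := by
  rw [ddW_erase f S a ha, ddW_erase f S b hb, ddW, Finset.mul_sum, ← Finset.sum_sub_distrib]
  apply Finset.sum_congr rfl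
  intro s _
  ring

lemma dividedDiff_eq (f : ℝ → ℝ) : ∀ (k : ℕ) (x : Fin (k + 1) → ℝ), Function.Injective x →
    dividedDiff f k x = ddW f (Finset.univ.image x) := by
  intro k
  induction k with
  | zero =>
    intro x hx
    simp [dividedDiff, ddW]
  | succ k ih =>
    intro x hx
    rw [dividedDiff, ih (fun i => x i.succ) (hx.comp (Fin.succ_injective _)),
      ih (fun i => x i.castSucc) (hx.comp (Fin.castSucc_injective _))]
    have e1 : Finset.univ.image (fun i : Fin (k+1) => x i.succ)
        = (Finset.univ.image x).erase (x 0) := by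
      ext t
      simp only [Finset.mem_image, Finset.mem_univ, true_and, Finset.mem_erase]
      constructor
      · rintro ⟨i, rfl⟩
        exact ⟨fun h => Fin.succ_ne_zero i (hx h), _, rfl⟩
      · rintro ⟨h, i, rfl⟩
        have : i ≠ 0 := fun h' => h (by rw [h'])
        exact ⟨i.pred this, by simp⟩
    have e2 : Finset.univ.image (fun i : Fin (k+1) => x i.castSucc)
        = (Finset.univ.image x).erase (x (Fin.last (k+1))) := by
      ext t
      simp only [Finset.mem_image, Finset.mem_univ, true_and, Finset.mem_erase]
      constructor
      · rintro ⟨i, rfl⟩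
        exact ⟨fun h => (Fin.castSucc_lt_last i).ne (hx h), _, rfl⟩
      · rintro ⟨h, i, rfl⟩
        have : i ≠ Fin.last (k+1) := fun h' => h (by rw [h'])
        exact ⟨i.castPred this, by simp⟩
    have hne : x (Fin.last (k+1)) - x 0 ≠ 0 :=
      sub_ne_zero.2 fun h => (Fin.last_pos).ne' (hx h)
    rw [e1, e2, ddW_rec f _ _ _ (by simp) (by simp)]
    field_simp

lemma ddW_nonneg (f : ℝ → ℝ) (I : Set ℝ) (hf : NConvexOn 5 I f) (S : Finset ℝ)
    (hS : S.card = 7) (hI : ∀ s ∈ S, s ∈ I) : 0 ≤ ddW f S := by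
  have h := hf (S.orderEmbOfFin hS) (fun i => hI _ (Finset.orderEmbOfFin_mem S hS i))
    (S.orderEmbOfFin hS).injective
  rw [dividedDiff_eq f _ _ (S.orderEmbOfFin hS).injective] at h
  rwa [Finset.image_orderEmbOfFin_univ] at h

lemma ddW_convex (f : ℝ → ℝ) (I : Set ℝ) (hf : NConvexOn 5 I f) (N : Finset ℝ)
    (hN : N.card = 4) (hI : ∀ s ∈ N, s ∈ I) (x y z : ℝ) (hx : x ∈ I) (hy : y ∈ I) (hz : z ∈ I)
    (hx' : x ∉ N) (hy' : y ∉ N) (hz' : z ∉ N) (hxy : x < y) (hyz : y < z) :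
    (z - x) * ddW f (insert y N) ≤ (z - y) * ddW f (insert x N) + (y - x) * ddW f (insert z N) := by
  have hxz := hxy.trans hyz
  have a1 : ddW f (insert y N) - ddW f (insert x N) = (y - x) * ddW f (insert x (insert y N)) := by
    rw [← ddW_rec f _ x y (by simp) (by simp)]
    congr 2 <;> ext t <;> simp only [Finset.mem_erase, Finset.mem_insert] <;> grind
  have a2 : ddW f (insert z N) - ddW f (insert y N) = (z - y) * ddW f (insert y (insert z N)) := by
    rw [← ddW_rec f _ y z (by simp) (by simp)]
    congr 2 <;> ext t <;> simp only [Finset.mem_erase, Finset.mem_insert] <;> grind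
  have a3 : ddW f (insert y (insert z N)) - ddW f (insert x (insert y N))
      = (z - x) * ddW f (insert x (insert y (insert z N))) := by
    rw [← ddW_rec f _ x z (by simp) (by simp)]
    congr 2 <;> ext t <;> simp only [Finset.mem_erase, Finset.mem_insert] <;> grind
  have a4 : 0 ≤ ddW f (insert x (insert y (insert z N))) := by
    apply ddW_nonneg f I hf
    · rw [Finset.card_insert_of_notMem, Finset.card_insert_of_notMem,
        Finset.card_insert_of_notMem hz', hN]
      · simp [hyz.ne, hy']
      · simp [hxy.ne, hxz.ne, hx']
    · intro s hs
      simp only [Finset.mem_insert] at hs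
      rcases hs with rfl | rfl | rfl | hs <;> simp_all
  have a5 : 0 ≤ (y - x) * (z - y) * ((z - x) * ddW f (insert x (insert y (insert z N)))) := by
    have := sub_pos.2 hxy
    have := sub_pos.2 hyz
    have := sub_pos.2 hxz
    positivity
  rw [← a3] at a5
  have : (y - x) * (z - y) * (ddW f (insert y (insert z N)) - ddW f (insert x (insert y N)))
    = (y - x) * (ddW f (insert z N) - ddW f (insert y N))
      - (z - y) * (ddW f (insert y N) - ddW f (insert x N)) := by rw [a1, a2]; ring
  linarith

lemma exists_line (G : ℝ → ℝ) (a : ℝ) (ha : 2/5 < a) (ha' : a < 1/2)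
    (hG : ∀ x y z : ℝ, -1 < x → z < 1 → x ≠ a → x ≠ -a → y ≠ a → y ≠ -a → z ≠ a → z ≠ -a →
      x < y → y < z → (z - x) * G y ≤ (z - y) * G x + (y - x) * G z) :
    ∃ u v : ℝ, (∀ x, -a < x → x < a → G x ≤ u + v * x) ∧
      (∀ x, -1 < x → x < -a → u + v * x ≤ G x) ∧ (∀ x, a < x → x < 1 → u + v * x ≤ G x) := by
  have key : ∀ b, 0 < b → b < a → ∃ u v : ℝ, (∀ x, -b < x → x < b → G x ≤ u + v * x) ∧
      (∀ x, -1 < x → x < -a → u + v * x ≤ G x) ∧ (∀ x, a < x → x < 1 → u + v * x ≤ G x) := by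
    intro b hb hba
    obtain ⟨u, v, h1, h2⟩ : ∃ u v : ℝ, u + v * b = G b ∧ u - v * b = G (-b) :=
      ⟨(G b + G (-b)) / 2, (G b - G (-b)) / (2 * b), by field_simp; ring, by field_simp; ring⟩
    refine ⟨u, v, ?_, ?_, ?_⟩
    · intro x hx hx'
      have := hG (-b) x b (by linarith) (by linarith) (by intro h; linarith) (by intro h; linarith)
        (by intro h; linarith) (by intro h; linarith) (by intro h; linarith)
        (by intro h; linarith) hx hx'
      rw [← h1, ← h2] at this
      have h2b : 0 < b - -b := by linarith
      refine le_of_mul_le_mul_left ?_ h2b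
      linarith
    · intro x hx hx'
      have := hG x (-b) b (by linarith) (by linarith) (by intro h; linarith) (by intro h; linarith)
        (by intro h; linarith) (by intro h; linarith) (by intro h; linarith)
        (by intro h; linarith) (by linarith) (by linarith)
      rw [← h1, ← h2] at this
      have h2b : 0 < b - -b := by linarith
      refine le_of_mul_le_mul_left ?_ h2b
      linarith
    · intro x hx hx'
      have := hG (-b) b x (by linarith) (by linarith) (by intro h; linarith) (by intro h; linarith)
        (by intro h; linarith) (by intro h; linarith) (by intro h; linarith)
        (by intro h; linarith) (by linarith) (by linarith)
      rw [← h1, ← h2] at this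
      have h2b : 0 < b - -b := by linarith
      refine le_of_mul_le_mul_left ?_ h2b
      linarith
  have hbn : ∀ n : ℕ, 0 < a - 1 / ((n : ℝ) + 10) ∧ a - 1 / ((n : ℝ) + 10) < a := by
    intro n
    have h1 : 1 / ((n : ℝ) + 10) ≤ 1 / 10 :=
      one_div_le_one_div_of_le (by norm_num) (by linarith [Nat.cast_nonneg (α := ℝ) n])
    have h2 : 0 < 1 / ((n : ℝ) + 10) := by positivity
    constructor <;> linarith
  choose u v hin hl hr using fun n : ℕ => key _ (hbn n).1 (hbn n).2
  have hK : IsCompact ((Icc (G 0) ((G (9/10) + G (-(9/10))) / 2)) ×ˢ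
      (Icc ((G 0 - G (-(9/10))) / (9/10)) ((G (9/10) - G 0) / (9/10)))) :=
    isCompact_Icc.prod isCompact_Icc
  obtain ⟨p, -, φ, hφ, hlim⟩ := hK.tendsto_subseq (x := fun n => (u n, v n)) (by
    intro n
    have e1 := hin n 0 (by linarith [(hbn n).1]) (hbn n).1
    have e2 := hl n (-(9/10)) (by norm_num) (by linarith)
    have e3 := hr n (9/10) (by linarith) (by norm_num)
    simp only [mem_prod, mem_Icc]
    refine ⟨⟨?_, ?_⟩, ?_, ?_⟩ <;> linarith)
  have hlx : ∀ x, Filter.Tendsto (fun n => u (φ n) + v (φ n) * x) Filter.atTop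
      (nhds (p.1 + p.2 * x)) := fun x =>
    ((continuous_fst.tendsto p).comp hlim).add (((continuous_snd.tendsto p).comp hlim).mul_const x)
  refine ⟨p.1, p.2, ?_, ?_, ?_⟩
  · intro x hx hx'
    refine ge_of_tendsto (hlx x) ?_
    have t : Filter.Tendsto (fun n : ℕ => 1 / (((φ n : ℕ) : ℝ) + 10)) Filter.atTop (nhds 0) := by
      have : Filter.Tendsto (fun n : ℕ => 1 / ((n : ℝ) + 10)) Filter.atTop (nhds 0) := by
        simp only [one_div]
        exact (Filter.tendsto_atTop_add_const_right _ _ tendsto_natCast_atTop_atTop).inv_tendsto_atTop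
      exact this.comp hφ.tendsto_atTop
    filter_upwards [t.eventually_lt_const (show 0 < a - x by linarith),
      t.eventually_lt_const (show 0 < x + a by linarith)] with n h1 h2
    exact hin _ x (by linarith) (by linarith)
  · intro x hx hx'
    exact le_of_tendsto (hlx x) (Filter.Eventually.of_forall fun n => hl _ x hx hx')
  · intro x hx hx'
    exact le_of_tendsto (hlx x) (Filter.Eventually.of_forall fun n => hr _ x hx hx')

lemma ddW_formula (f : ℝ → ℝ) (a : ℝ) (h5 : a ^ 2 = 1 / 5) (ha : 2/5 < a) (ha' : a < 1/2)
    (x : ℝ) (hx1 : x ≠ -1) (hx2 : x ≠ -a) (hx3 : x ≠ a) (hx4 : x ≠ 1) :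
    f x = (x ^ 2 - 1) * (x ^ 2 - 1/5) * ddW f (insert x {-1, -a, a, 1})
      + (-(5/8) * (x - 1) * (x^2 - 1/5) * f (-1) + (5/8) * (x + 1) * (x^2 - 1/5) * f 1
      - (25 * a / 8) * (x^2-1) * (x + a) * f a + (25 * a / 8) * (x^2-1) * (x - a) * f (-a)) := by
  have n1 : (-1 : ℝ) ≠ -a := by intro h; linarith
  have n2 : (-1 : ℝ) ≠ a := by intro h; linarith
  have n3 : (-1 : ℝ) ≠ 1 := by norm_num
  have n4 : -a ≠ a := by intro h; linarith
  have n5 : -a ≠ 1 := by intro h; linarith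
  have n6 : a ≠ 1 := by intro h; linarith
  have e0 : (insert x {-1, -a, a, 1} : Finset ℝ).erase x = {-1, -a, a, 1} := by
    ext t; simp only [Finset.mem_erase, Finset.mem_insert, Finset.mem_singleton]; grind
  have e1 : (insert x {-1, -a, a, 1} : Finset ℝ).erase (-1) = {x, -a, a, 1} := by
    ext t; simp only [Finset.mem_erase, Finset.mem_insert, Finset.mem_singleton]; grind
  have e2 : (insert x {-1, -a, a, 1} : Finset ℝ).erase (-a) = {x, -1, a, 1} := by
    ext t; simp only [Finset.mem_erase, Finset.mem_insert, Finset.mem_singleton]; grind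
  have e3 : (insert x {-1, -a, a, 1} : Finset ℝ).erase a = {x, -1, -a, 1} := by
    ext t; simp only [Finset.mem_erase, Finset.mem_insert, Finset.mem_singleton]; grind
  have e4 : (insert x {-1, -a, a, 1} : Finset ℝ).erase 1 = {x, -1, -a, a} := by
    ext t; simp only [Finset.mem_erase, Finset.mem_insert, Finset.mem_singleton]; grind
  have hW : ddW f (insert x {-1, -a, a, 1}) =
      f x * ((x - -1)⁻¹ * ((x - -a)⁻¹ * ((x - a)⁻¹ * (x - 1)⁻¹)))
      + (f (-1) * ((-1 - x)⁻¹ * ((-1 - -a)⁻¹ * ((-1 - a)⁻¹ * (-1 - 1)⁻¹)))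
      + (f (-a) * ((-a - x)⁻¹ * ((-a - -1)⁻¹ * ((-a - a)⁻¹ * (-a - 1)⁻¹)))
      + (f a * ((a - x)⁻¹ * ((a - -1)⁻¹ * ((a - -a)⁻¹ * (a - 1)⁻¹)))
      + f 1 * ((1 - x)⁻¹ * ((1 - -1)⁻¹ * ((1 - -a)⁻¹ * (1 - a)⁻¹)))))) := by
    rw [ddW, Finset.sum_insert (by simp [*]), Finset.sum_insert (by simp [*]),
      Finset.sum_insert (by simp [*]), Finset.sum_insert (by simp [*]), Finset.sum_singleton,
      e0, e1, e2, e3, e4]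
    congr 2
    · rw [Finset.prod_insert (by simp [*]), Finset.prod_insert (by simp [*]),
        Finset.prod_insert (by simp [*]), Finset.prod_singleton]
    · rw [Finset.prod_insert (by simp [*]), Finset.prod_insert (by simp [*]),
        Finset.prod_insert (by simp [*]), Finset.prod_singleton]
    congr 2
    · rw [Finset.prod_insert (by simp [*]), Finset.prod_insert (by simp [*]),
        Finset.prod_insert (by simp [*]), Finset.prod_singleton]
    congr 2
    · rw [Finset.prod_insert (by simp [*]), Finset.prod_insert (by simp [*]),
        Finset.prod_insert (by simp [*]), Finset.prod_singleton]
    · rw [Finset.prod_insert (by simp [*]), Finset.prod_insert (by simp [*]),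
        Finset.prod_insert (by simp [*]), Finset.prod_singleton]
  have d1 : x + 1 ≠ 0 := fun h => hx1 (by linarith)
  have d2 : x + a ≠ 0 := fun h => hx2 (by linarith)
  have d3 : x - a ≠ 0 := fun h => hx3 (by linarith)
  have d4 : x - 1 ≠ 0 := fun h => hx4 (by linarith)
  have i1 : (-1 - x)⁻¹ = -(x+1)⁻¹ := by rw [← inv_neg]; congr 1; ring
  have i2 : (-a - x)⁻¹ = -(x+a)⁻¹ := by rw [← inv_neg]; congr 1; ring
  have i3 : (a - x)⁻¹ = -(x-a)⁻¹ := by rw [← inv_neg]; congr 1; ring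
  have i4 : (1 - x)⁻¹ = -(x-1)⁻¹ := by rw [← inv_neg]; congr 1; ring
  have k1 : (-1 - -a)⁻¹ * ((-1 - a)⁻¹ * (-1 - 1)⁻¹) = -(5/8) := by
    rw [← mul_inv, ← mul_inv, inv_eq_iff_eq_inv]; linear_combination (2) * h5
  have k4 : (1 - -1)⁻¹ * ((1 - -a)⁻¹ * (1 - a)⁻¹) = 5/8 := by
    rw [← mul_inv, ← mul_inv, inv_eq_iff_eq_inv]; linear_combination (-2) * h5
  have k2 : (-a - -1)⁻¹ * ((-a - a)⁻¹ * (-a - 1)⁻¹) = 25 * a / 8 := by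
    rw [← mul_inv, ← mul_inv, inv_eq_iff_eq_inv]
    apply eq_inv_of_mul_eq_one_left
    linear_combination (-(25/4) * a^2 + 5) * h5
  have k3 : (a - -1)⁻¹ * ((a - -a)⁻¹ * (a - 1)⁻¹) = -(25 * a / 8) := by
    rw [← mul_inv, ← mul_inv, inv_eq_iff_eq_inv]
    apply eq_inv_of_mul_eq_one_left
    linear_combination (-(25/4) * a^2 + 5) * h5
  rw [k1, k2, k3, k4, i1, i2, i3, i4] at hW
  rw [hW, ← h5, sub_neg_eq_add, sub_neg_eq_add]
  field_simp
  ring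

theorem stmt6 (μ : Measure ℝ) [IsProbabilityMeasure μ]
    (hsupp : μ (Set.Icc (-1 : ℝ) 1) = 1)
    (h1 : ∫ x, x ∂μ = 0) (h2 : ∫ x, x ^ 2 ∂μ = 1 / 3) (h3 : ∫ x, x ^ 3 ∂μ = 0)
    (h4 : ∫ x, x ^ 4 ∂μ = 1 / 5) (h5 : ∫ x, x ^ 5 ∂μ = 0)
    (f : ℝ → ℝ) (hcont : ContinuousOn f (Set.Icc (-1 : ℝ) 1))
    (hconv : NConvexOn 5 (Set.Icc (-1 : ℝ) 1) f) :
    ∫ x, f x ∂μ ≤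
      (1 / 12) * f (-1) + (5 / 12) * f (-(1 / Real.sqrt 5)) + (5 / 12) * f (1 / Real.sqrt 5) +
        (1 / 12) * f 1 := by
  have ha2 : (1 / Real.sqrt 5) ^ 2 = 1 / 5 := by
    rw [div_pow, Real.sq_sqrt (by norm_num)]; norm_num
  have hapos : 0 < 1 / Real.sqrt 5 := by positivity
  generalize 1 / Real.sqrt 5 = a at ha2 hapos ⊢
  have ha : 2/5 < a := by nlinarith
  have ha' : a < 1/2 := by nlinarith
  have n1 : (-1 : ℝ) ≠ -a := by intro h; linarith
  have n2 : (-1 : ℝ) ≠ a := by intro h; linarith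
  have n3 : (-1 : ℝ) ≠ 1 := by norm_num
  have n4 : -a ≠ a := by intro h; linarith
  have n5 : -a ≠ 1 := by intro h; linarith
  have n6 : a ≠ 1 := by intro h; linarith
  have hcard : ({-1, -a, a, 1} : Finset ℝ).card = 4 := by
    rw [Finset.card_insert_of_notMem (by simp [*]), Finset.card_insert_of_notMem (by simp [*]),
      Finset.card_insert_of_notMem (by simp [*]), Finset.card_singleton]
  have hNI : ∀ s ∈ ({-1, -a, a, 1} : Finset ℝ), s ∈ Icc (-1 : ℝ) 1 := by
    intro s hs
    simp only [Finset.mem_insert, Finset.mem_singleton] at hs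
    rcases hs with rfl | rfl | rfl | rfl <;> constructor <;> linarith
  obtain ⟨u, v, hin, hl, hr⟩ := exists_line (fun x => ddW f (insert x {-1, -a, a, 1})) a ha ha' (by
    intro x y z hx hz hxa hxa' hya hya' hza hza' hxy hyz
    apply ddW_convex f _ hconv _ hcard hNI x y z ⟨by linarith, by linarith⟩
      ⟨by linarith, by linarith⟩ ⟨by linarith, by linarith⟩ _ _ _ hxy hyz
    all_goals
      simp only [Finset.mem_insert, Finset.mem_singleton]
      rintro (h | h | h | h) <;> first | contradiction | linarith)
  have hfP : ∀ x ∈ Icc (-1 : ℝ) 1, f x ≤ (x ^ 2 - 1) * (x ^ 2 - 1/5) * (u + v * x)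
      + (-(5/8) * (x - 1) * (x^2 - 1/5) * f (-1) + (5/8) * (x + 1) * (x^2 - 1/5) * f 1
      - (25 * a / 8) * (x^2-1) * (x + a) * f a + (25 * a / 8) * (x^2-1) * (x - a) * f (-a)) := by
    intro x hx
    by_cases hx1 : x = -1
    · subst hx1; apply le_of_eq; ring
    by_cases hx4 : x = 1
    · subst hx4; apply le_of_eq; ring
    by_cases hx2 : x = -a
    · subst hx2; apply le_of_eq; rw [← ha2]; 
      linear_combination (25/4 * a^2 - 5) * f (-a) * ha2
    by_cases hx3 : x = a
    · subst hx3; apply le_of_eq; rw [← ha2]; 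
      linear_combination (25/4 * x^2 - 5) * f x * ha2
    have hx1' : -1 < x := lt_of_le_of_ne hx.1 (Ne.symm hx1)
    have hx4' : x < 1 := lt_of_le_of_ne hx.2 hx4
    conv_lhs => rw [ddW_formula f a ha2 ha ha' x hx1 hx2 hx3 hx4]
    have hq1 : x^2 - 1 < 0 := by nlinarith
    rw [add_le_add_iff_right]
    rcases lt_or_gt_of_ne hx2 with h | h
    · have : 0 < x^2 - 1/5 := by nlinarith
      exact mul_le_mul_of_nonpos_left (hl x hx1' h) (mul_neg_of_neg_of_pos hq1 this).le
    rcases lt_or_gt_of_ne hx3 with h' | h'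
    · have : x^2 - 1/5 < 0 := by nlinarith
      exact mul_le_mul_of_nonneg_left (hin x h h') (mul_pos_of_neg_of_neg hq1 this).le
    · have : 0 < x^2 - 1/5 := by nlinarith
      exact mul_le_mul_of_nonpos_left (hr x h' hx4') (mul_neg_of_neg_of_pos hq1 this).le
  have hae : ∀ᵐ x ∂μ, x ∈ Icc (-1 : ℝ) 1 := (prob_compl_eq_zero_iff measurableSet_Icc).2 hsupp
  have hres : μ.restrict (Icc (-1 : ℝ) 1) = μ := Measure.restrict_eq_self_of_ae_mem hae
  have hint : ∀ g : ℝ → ℝ, ContinuousOn g (Icc (-1 : ℝ) 1) → Integrable g μ := by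
    intro g hg
    have := hg.integrableOn_compact (μ := μ) isCompact_Icc
    rwa [IntegrableOn, hres] at this
  obtain ⟨c0, c1, c2, c3, c4, c5, hP, hc⟩ : ∃ c0 c1 c2 c3 c4 c5 : ℝ,
      (∀ x, (x ^ 2 - 1) * (x ^ 2 - 1/5) * (u + v * x)
      + (-(5/8) * (x - 1) * (x^2 - 1/5) * f (-1) + (5/8) * (x + 1) * (x^2 - 1/5) * f 1
      - (25 * a / 8) * (x^2-1) * (x + a) * f a + (25 * a / 8) * (x^2-1) * (x - a) * f (-a))
      = c0 + c1 * x + c2 * x^2 + c3 * x^3 + c4 * x^4 + c5 * x^5) ∧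
      c0 + c2 / 3 + c4 / 5 =
      (1 / 12) * f (-1) + (5 / 12) * f (-a) + (5 / 12) * f a + (1 / 12) * f 1 := by
    refine ⟨u/5 - f (-1)/8 - f 1 /8 + 25*a^2/8 * (f a + f (-a)),
      v/5 + f (-1)/8 - f 1/8 + 25*a/8*(f a - f (-a)),
      -(6/5)*u + 5/8*(f (-1) + f 1) - 25*a^2/8*(f a + f (-a)),
      -(6/5)*v + 5/8*(f 1 - f (-1)) - 25*a/8*(f a - f (-a)), u, v, ?_, ?_⟩
    · intro x; ring
    · rw [ha2]; ring
  calc ∫ x, f x ∂μ ≤ ∫ x, (c0 + c1 * x + c2 * x^2 + c3 * x^3 + c4 * x^4 + c5 * x^5) ∂μ := by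
        apply integral_mono_ae (hint f hcont) (hint _ (by fun_prop))
        filter_upwards [hae] with x hx
        rw [← hP x]
        exact hfP x hx
    _ = c0 + c2 / 3 + c4 / 5 := by
        rw [integral_add (hint _ (by fun_prop)) (hint _ (by fun_prop)),
          integral_add (hint _ (by fun_prop)) (hint _ (by fun_prop)),
          integral_add (hint _ (by fun_prop)) (hint _ (by fun_prop)),
          integral_add (hint _ (by fun_prop)) (hint _ (by fun_prop)),
          integral_add (hint _ (by fun_prop)) (hint _ (by fun_prop)),
          integral_const_mul, integral_const_mul, integral_const_mul, integral_const_mul,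
          integral_const_mul, h1, h2, h3, h4, h5]
        simp
        ring
    _ = _ := hc
end

section
/- Let μ be a Borel probability measure on [-1,1] such that ∫ x dμ = 0, ∫ x² dμ = 1/3, ∫ x³ dμ = 0 and ∫ x⁴ dμ = 1/5 (i.e. the first four moments of μ agree with those of the normalized Lebesgue measure on [-1,1]). Then for every continuous 4-convex function f : [-1,1] → ℝ one has (1/9)·f(−1) + ((16+√6)/36)·f((1−√6)/5) + ((16−√6)/36)·f((1+√6)/5) ≤ ∫ f dμ. -/
open MeasureTheory Set

noncomputable def LL (f : ℝ → ℝ) (a b c d e : ℝ) : ℝ :=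
  f a / ((a - b) * (a - c) * (a - d) * (a - e)) +
  f b / ((b - a) * (b - c) * (b - d) * (b - e)) +
  f c / ((c - a) * (c - b) * (c - d) * (c - e)) +
  f d / ((d - a) * (d - b) * (d - c) * (d - e)) +
  f e / ((e - a) * (e - b) * (e - c) * (e - d))

noncomputable def NN (f : ℝ → ℝ) (a b c d x : ℝ) : ℝ :=
  f a * ((x - b) * (x - c) * (x - d)) / ((a - b) * (a - c) * (a - d)) +
  f b * ((x - a) * (x - c) * (x - d)) / ((b - a) * (b - c) * (b - d)) +
  f c * ((x - a) * (x - b) * (x - d)) / ((c - a) * (c - b) * (c - d)) +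
  f d * ((x - a) * (x - b) * (x - c)) / ((d - a) * (d - b) * (d - c))

lemma dd3 (f : ℝ → ℝ) (a b c d : ℝ) (hab : a ≠ b) (hac : a ≠ c) (had : a ≠ d)
    (hbc : b ≠ c) (hbd : b ≠ d) (hcd : c ≠ d) :
    dividedDiff f 3 ![a, b, c, d] =
      f a / ((a - b) * (a - c) * (a - d)) + f b / ((b - a) * (b - c) * (b - d)) +
      f c / ((c - a) * (c - b) * (c - d)) + f d / ((d - a) * (d - b) * (d - c)) := by
  have h1 := sub_ne_zero.2 hab
  have h2 := sub_ne_zero.2 hac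
  have h3 := sub_ne_zero.2 had
  have h4 := sub_ne_zero.2 hbc
  have h5 := sub_ne_zero.2 hbd
  have h6 := sub_ne_zero.2 hcd
  have e : dividedDiff f 3 ![a, b, c, d] =
    (((f d - f c) / (d - c) - (f c - f b) / (c - b)) / (d - b)
      - ((f c - f b) / (c - b) - (f b - f a) / (b - a)) / (c - a)) / (d - a) := rfl
  rw [e]
  rw [← neg_sub a b, ← neg_sub a c, ← neg_sub a d, ← neg_sub b c, ← neg_sub b d, ← neg_sub c d]
  field_simp
  ring

lemma dd4 (f : ℝ → ℝ) (a b c d e : ℝ) (hab : a ≠ b) (hac : a ≠ c) (had : a ≠ d) (hae : a ≠ e)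
    (hbc : b ≠ c) (hbd : b ≠ d) (hbe : b ≠ e) (hcd : c ≠ d) (hce : c ≠ e) (hde : d ≠ e) :
    dividedDiff f 4 ![a, b, c, d, e] = LL f a b c d e := by
  have h1 := sub_ne_zero.2 hab
  have h2 := sub_ne_zero.2 hac
  have h3 := sub_ne_zero.2 had
  have h4 := sub_ne_zero.2 hbc
  have h5 := sub_ne_zero.2 hbd
  have h6 := sub_ne_zero.2 hcd
  have h7 := sub_ne_zero.2 hae
  have h8 := sub_ne_zero.2 hbe
  have h9 := sub_ne_zero.2 hce
  have h10 := sub_ne_zero.2 hde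
  have e0 : dividedDiff f 4 ![a, b, c, d, e] =
    (dividedDiff f 3 ![b, c, d, e] - dividedDiff f 3 ![a, b, c, d]) / (e - a) := by
    rw [dividedDiff]
    congr 3
    ext i; fin_cases i <;> rfl
  rw [e0, dd3 f a b c d hab hac had hbc hbd hcd, dd3 f b c d e hbc hbd hbe hcd hce hde, LL]
  rw [← neg_sub a b, ← neg_sub a c, ← neg_sub a d, ← neg_sub b c, ← neg_sub b d, ← neg_sub c d,
    ← neg_sub a e, ← neg_sub b e, ← neg_sub c e, ← neg_sub d e]
  field_simp
  ring

lemma LL_rot (f : ℝ → ℝ) (a b c d e : ℝ) : LL f e a b c d = LL f a b c d e := by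
  unfold LL; ring

lemma LL_swap (f : ℝ → ℝ) (a b c d e : ℝ) : LL f a b c e d = LL f a b c d e := by
  unfold LL; ring

lemma LL_mono {f : ℝ → ℝ} (hf : NConvexOn 4 (Icc (-1 : ℝ) 1) f) (a b c d s t : ℝ)
    (ha : a ∈ Icc (-1 : ℝ) 1) (hb : b ∈ Icc (-1 : ℝ) 1) (hc : c ∈ Icc (-1 : ℝ) 1)
    (hd : d ∈ Icc (-1 : ℝ) 1) (hs : s ∈ Icc (-1 : ℝ) 1) (ht : t ∈ Icc (-1 : ℝ) 1)
    (hab : a ≠ b) (hac : a ≠ c) (had : a ≠ d)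
    (hbc : b ≠ c) (hbd : b ≠ d) (hcd : c ≠ d)
    (has : s ≠ a) (hbs : s ≠ b) (hcs : s ≠ c) (hds : s ≠ d)
    (hat : t ≠ a) (hbt : t ≠ b) (hct : t ≠ c) (hdt : t ≠ d) (hst : s < t) :
    LL f a b c d s ≤ LL f a b c d t := by
  have h := hf ![s, a, b, c, d, t]
    (by intro i; fin_cases i <;> assumption)
    (by
      have := hst.ne
      intro i j hij
      fin_cases i <;> fin_cases j <;> first | rfl | (exfalso; simp at hij; simp_all))
  have e0 : dividedDiff f 5 ![s, a, b, c, d, t] =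
    (dividedDiff f 4 ![a, b, c, d, t] - dividedDiff f 4 ![s, a, b, c, d]) / (t - s) := by
    rw [dividedDiff]
    congr 3
    ext i; fin_cases i <;> rfl
  rw [e0, dd4 f a b c d t hab hac had hat.symm hbc hbd hbt.symm hcd hct.symm hdt.symm,
    dd4 f s a b c d has hbs hcs hds hab hac had hbc hbd hcd, LL_rot f a b c d s] at h
  have h' := mul_nonneg h (sub_pos.2 hst).le
  rw [div_mul_cancel₀ _ (sub_pos.2 hst).ne'] at h'
  linarith

lemma NN_add (f : ℝ → ℝ) (a b c d x : ℝ) (hab : a ≠ b) (hac : a ≠ c) (had : a ≠ d)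
    (hbc : b ≠ c) (hbd : b ≠ d) (hcd : c ≠ d)
    (has : x ≠ a) (hbs : x ≠ b) (hcs : x ≠ c) (hds : x ≠ d) :
    f x = NN f a b c d x + (x - a) * (x - b) * (x - c) * (x - d) * LL f a b c d x := by
  have h1 := sub_ne_zero.2 hab
  have h2 := sub_ne_zero.2 hac
  have h3 := sub_ne_zero.2 had
  have h4 := sub_ne_zero.2 hbc
  have h5 := sub_ne_zero.2 hbd
  have h6 := sub_ne_zero.2 hcd
  have h7 := sub_ne_zero.2 has
  have h8 := sub_ne_zero.2 hbs
  have h9 := sub_ne_zero.2 hcs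
  have h10 := sub_ne_zero.2 hds
  unfold NN LL
  rw [← neg_sub a b, ← neg_sub a c, ← neg_sub a d, ← neg_sub b c, ← neg_sub b d, ← neg_sub c d,
    ← neg_sub x a, ← neg_sub x b, ← neg_sub x c, ← neg_sub x d]
  field_simp
  ring

lemma NN_a (f : ℝ → ℝ) (a b c d : ℝ) (hab : a ≠ b) (hac : a ≠ c) (had : a ≠ d) :
    NN f a b c d a = f a := by
  have h1 := sub_ne_zero.2 hab
  have h2 := sub_ne_zero.2 hac
  have h3 := sub_ne_zero.2 had
  unfold NN
  simp only [sub_self]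
  field_simp
  ring

lemma NN_b (f : ℝ → ℝ) (a b c d : ℝ) (hab : b ≠ a) (hac : b ≠ c) (had : b ≠ d) :
    NN f a b c d b = f b := by
  rw [← NN_a f b a c d hab hac had]; unfold NN; ring

lemma NN_c (f : ℝ → ℝ) (a b c d : ℝ) (hab : c ≠ a) (hac : c ≠ b) (had : c ≠ d) :
    NN f a b c d c = f c := by
  rw [← NN_a f c a b d hab hac had]; unfold NN; ring

lemma NN_d (f : ℝ → ℝ) (a b c d : ℝ) (hab : d ≠ a) (hac : d ≠ b) (had : d ≠ c) :
    NN f a b c d d = f d := by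
  rw [← NN_a f d a b c hab hac had]; unfold NN; ring

lemma cubic (k p q r : ℝ) : ∃ k0 k1 k2 k3 : ℝ, ∀ x : ℝ,
    k * ((x - p) * (x - q) * (x - r)) = k0 + k1 * x + k2 * x ^ 2 + k3 * x ^ 3 :=
  ⟨-k * p * q * r, k * (p * q + p * r + q * r), -k * (p + q + r), k, fun x => by ring⟩

lemma quartic (f : ℝ → ℝ) (a b c d A : ℝ) : ∃ k0 k1 k2 k3 k4 : ℝ, ∀ x : ℝ,
    NN f a b c d x + (x - a) * (x - b) * (x - c) * (x - d) * A =
      k0 + k1 * x + k2 * x ^ 2 + k3 * x ^ 3 + k4 * x ^ 4 := by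
  obtain ⟨p0, p1, p2, p3, hp⟩ := cubic (f a / ((a - b) * (a - c) * (a - d))) b c d
  obtain ⟨q0, q1, q2, q3, hq⟩ := cubic (f b / ((b - a) * (b - c) * (b - d))) a c d
  obtain ⟨r0, r1, r2, r3, hr⟩ := cubic (f c / ((c - a) * (c - b) * (c - d))) a b d
  obtain ⟨s0, s1, s2, s3, hs⟩ := cubic (f d / ((d - a) * (d - b) * (d - c))) a b c
  obtain ⟨t0, t1, t2, t3, ht⟩ := cubic A a b c
  refine ⟨p0 + q0 + r0 + s0 - d * t0, p1 + q1 + r1 + s1 + t0 - d * t1,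
    p2 + q2 + r2 + s2 + t1 - d * t2, p3 + q3 + r3 + s3 + t2 - d * t3, t3, fun x => ?_⟩
  unfold NN
  linear_combination hp x + hq x + hr x + hs x + (x - d) * ht x

lemma lower {f : ℝ → ℝ} (hf : NConvexOn 4 (Icc (-1 : ℝ) 1) f) (b c h x : ℝ)
    (hb1 : -3/10 < b) (hb2 : b < -28/100) (hc1 : 68/100 < c) (hc2 : c < 7/10)
    (h0 : 0 < h) (h1 : h < 1/10) (hx : x ∈ Icc (-1 : ℝ) 1) :
    NN f (-1) b c (b + h) x + (x - (-1)) * (x - b) * (x - c) * (x - (b + h)) *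
      LL f (-1) b c (b + h) (c + h) -
    16 * (|LL f (-1) b c (-2/5) (-1/2)| + |LL f (-1) b c 1 (9/10)|) *
      (Ioo b (b + h) ∪ Ioo c (c + h)).indicator (fun _ => (1 : ℝ)) x ≤ f x := by
  obtain ⟨hx1, hx2⟩ := hx
  set C := |LL f (-1) b c (-2/5) (-1/2)| + |LL f (-1) b c 1 (9/10)| with hC
  have hC0 : 0 ≤ C := by positivity
  have hI : 0 ≤ (Ioo b (b + h) ∪ Ioo c (c + h)).indicator (fun _ => (1 : ℝ)) x :=
    indicator_nonneg (fun _ _ => zero_le_one) x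
  have hCI := mul_nonneg (mul_nonneg (by norm_num : (0:ℝ) ≤ 16) hC0) hI
  have nab : (-1 : ℝ) ≠ b := by linarith
  have nac : (-1 : ℝ) ≠ c := by linarith
  have nad : (-1 : ℝ) ≠ b + h := by linarith
  have nbc : b ≠ c := by linarith
  have nbd : b ≠ b + h := by linarith
  have ncd : c ≠ b + h := by linarith
  have ma : (-1 : ℝ) ∈ Icc (-1 : ℝ) 1 := by constructor <;> linarith
  have mb : b ∈ Icc (-1 : ℝ) 1 := by constructor <;> linarith
  have mc : c ∈ Icc (-1 : ℝ) 1 := by constructor <;> linarith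
  have md : b + h ∈ Icc (-1 : ℝ) 1 := by constructor <;> linarith
  have me : c + h ∈ Icc (-1 : ℝ) 1 := by constructor <;> linarith
  have mono := fun s t => LL_mono hf (-1) b c (b + h) s t ma mb mc md
  by_cases xa : x = -1
  · subst xa; rw [NN_a f _ _ _ _ nab nac nad]; linarith
  by_cases xb : x = b
  · subst xb; rw [NN_b f _ _ _ _ nab.symm nbc nbd]; linarith
  by_cases xc : x = c
  · subst xc; rw [NN_c f _ _ _ _ nac.symm nbc.symm ncd]; linarith
  by_cases xd : x = b + h
  · rw [xd] at hCI ⊢; rw [NN_d f _ _ _ _ nad.symm nbd.symm ncd.symm]; linarith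
  have key := NN_add f (-1) b c (b + h) x nab nac nad nbc nbd ncd xa xb xc xd
  by_cases xe : x = c + h
  · rw [xe] at hCI key ⊢; linarith
  have xa' : 0 < x - (-1) := by
    have := lt_of_le_of_ne hx1 (Ne.symm xa); linarith
  set W := (x - (-1)) * (x - b) * (x - c) * (x - (b + h)) with hW
  set A := LL f (-1) b c (b + h) (c + h) with hA
  set B := LL f (-1) b c (b + h) x with hB
  have AB : x < c + h → B ≤ A := fun hh => mono x (c + h) ⟨hx1, hx2⟩ me nab nac nad nbc nbd ncd
    xa xb xc xd (by linarith) (by linarith) (by linarith) (by linarith) hh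
  have BA : c + h < x → A ≤ B := fun hh => mono (c + h) x me ⟨hx1, hx2⟩ nab nac nad nbc nbd ncd
    (by linarith) (by linarith) (by linarith) (by linarith) xa xb xc xd hh
  have bad : b < x → 0 ≤ W → x ∈ (Ioo b (b + h) ∪ Ioo c (c + h)) → 
      NN f (-1) b c (b + h) x + W * A - 16 * C *
      (Ioo b (b + h) ∪ Ioo c (c + h)).indicator (fun _ => (1 : ℝ)) x ≤ f x := by
    intro hbx hW0 hmem
    rw [indicator_of_mem hmem, key]
    have hB1 : LL f (-1) b c (-2/5) (-1/2) ≤ B := by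
      have i1 := mono (-2/5) x (by constructor <;> linarith) ⟨hx1, hx2⟩ nab nac nad nbc nbd ncd
        (by linarith) (by linarith) (by linarith) (by linarith) xa xb xc xd (by linarith)
      have i2 := LL_mono hf (-1) b c (-2/5) (-1/2) (b + h) ma mb mc (by constructor <;> linarith)
        (by constructor <;> linarith) md nab nac (by linarith) nbc (by linarith) (by linarith)
        (by linarith) (by linarith) (by linarith) (by linarith)
        (by linarith) (by linarith) (by linarith) (by linarith) (by linarith)
      rw [LL_swap f (-1) b c (b + h) (-2/5)] at i2
      linarith
    have hA1 : A ≤ LL f (-1) b c 1 (9/10) := by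
      have i1 := mono (c + h) 1 me (by constructor <;> linarith) nab nac nad nbc nbd ncd
        (by linarith) (by linarith) (by linarith) (by linarith) (by linarith) (by linarith)
        (by linarith) (by linarith) (by linarith)
      have i2 := LL_mono hf (-1) b c 1 (b + h) (9/10) ma mb mc (by constructor <;> linarith)
        md (by constructor <;> linarith) nab nac (by linarith) nbc (by linarith) (by linarith)
        (by linarith) (by linarith) (by linarith) (by linarith)
        (by linarith) (by linarith) (by linarith) (by linarith) (by linarith)
      rw [LL_swap] at i2
      linarith
    have hAB : A - B ≤ C := by
      have := neg_abs_le (LL f (-1) b c (-2/5) (-1/2))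
      have := le_abs_self (LL f (-1) b c 1 (9/10))
      linarith
    have hW16 : W ≤ 16 := by
      have a1 : |x - (-1)| ≤ 2 := by rw [abs_le]; constructor <;> linarith
      have a2 : |x - b| ≤ 2 := by rw [abs_le]; constructor <;> linarith
      have a3 : |x - c| ≤ 2 := by rw [abs_le]; constructor <;> linarith
      have a4 : |x - (b + h)| ≤ 2 := by rw [abs_le]; constructor <;> linarith
      calc W ≤ |W| := le_abs_self _
        _ = |x - (-1)| * |x - b| * |x - c| * |x - (b + h)| := by rw [hW, abs_mul, abs_mul, abs_mul]
        _ ≤ 2 * 2 * 2 * 2 := by gcongr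
        _ = 16 := by norm_num
    have := mul_le_mul_of_nonneg_left hAB hW0
    have := mul_le_mul_of_nonneg_right hW16 hC0
    linarith
  rcases lt_or_gt_of_ne xb with l1 | l1
  · have hW0 : W ≤ 0 := by
      have : 0 ≤ (x - (-1)) * (b - x) * (c - x) * (b + h - x) := by
        have : 0 ≤ b - x := by linarith
        have : 0 ≤ c - x := by linarith
        have : 0 ≤ b + h - x := by linarith
        positivity
      rw [hW]; linarith
    have := mul_le_mul_of_nonpos_left (AB (by linarith)) hW0
    linarith
  rcases lt_or_gt_of_ne xd with l2 | l2
  · refine bad l1 ?_ (Or.inl ⟨l1, l2⟩)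
    have : 0 ≤ (x - (-1)) * (x - b) * (c - x) * (b + h - x) := by
      have : 0 ≤ x - b := by linarith
      have : 0 ≤ c - x := by linarith
      have : 0 ≤ b + h - x := by linarith
      positivity
    rw [hW]; linarith
  rcases lt_or_gt_of_ne xc with l3 | l3
  · have hW0 : W ≤ 0 := by
      have : 0 ≤ (x - (-1)) * (x - b) * (c - x) * (x - (b + h)) := by
        have : 0 ≤ x - b := by linarith
        have : 0 ≤ c - x := by linarith
        have : 0 ≤ x - (b + h) := by linarith
        positivity
      rw [hW]; linarith
    have := mul_le_mul_of_nonpos_left (AB (by linarith)) hW0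
    linarith
  have hW0 : 0 ≤ W := by
    have : 0 ≤ x - b := by linarith
    have : 0 ≤ x - c := by linarith
    have : 0 ≤ x - (b + h) := by linarith
    rw [hW]; positivity
  rcases lt_or_gt_of_ne xe with l4 | l4
  · exact bad l1 hW0 (Or.inr ⟨l3, l4⟩)
  · have := mul_le_mul_of_nonneg_left (BA l4) hW0
    linarith

theorem stmt7 (μ : Measure ℝ) [IsProbabilityMeasure μ]
    (hsupp : μ (Set.Icc (-1 : ℝ) 1) = 1)
    (h1 : ∫ x, x ∂μ = 0) (h2 : ∫ x, x ^ 2 ∂μ = 1 / 3) (h3 : ∫ x, x ^ 3 ∂μ = 0)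
    (h4 : ∫ x, x ^ 4 ∂μ = 1 / 5)
    (f : ℝ → ℝ) (hcont : ContinuousOn f (Set.Icc (-1 : ℝ) 1))
    (hconv : NConvexOn 4 (Set.Icc (-1 : ℝ) 1) f) :
    (1 / 9) * f (-1) + ((16 + Real.sqrt 6) / 36) * f ((1 - Real.sqrt 6) / 5) +
        ((16 - Real.sqrt 6) / 36) * f ((1 + Real.sqrt 6) / 5) ≤ ∫ x, f x ∂μ := by
  have hae : ∀ᵐ x ∂μ, x ∈ Icc (-1 : ℝ) 1 := by
    rw [← prob_compl_eq_zero_iff measurableSet_Icc] at hsupp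
    exact hsupp
  have hrestr : μ.restrict (Icc (-1 : ℝ) 1) = μ := Measure.restrict_eq_self_of_ae_mem hae
  have hint : ∀ g : ℝ → ℝ, ContinuousOn g (Icc (-1 : ℝ) 1) → Integrable g μ := by
    intro g hg
    have := hg.integrableOn_compact (μ := μ) isCompact_Icc
    rwa [IntegrableOn, hrestr] at this
  have hfi := hint f hcont
  set s := Real.sqrt 6 with hs
  have s2 : s ^ 2 = 6 := Real.sq_sqrt (by norm_num)
  have s0 : 0 ≤ s := Real.sqrt_nonneg 6
  have sl : 24/10 < s := by nlinarith
  have sl' : 244/100 < s := by nlinarith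
  have su : s < 246/100 := by nlinarith
  obtain ⟨b, hb⟩ : ∃ b, b = (1 - s) / 5 := ⟨_, rfl⟩
  obtain ⟨c, hc⟩ : ∃ c, c = (1 + s) / 5 := ⟨_, rfl⟩
  rw [← hb, ← hc]
  have hb1 : -3/10 < b := by linarith
  have hb2 : b < -28/100 := by linarith
  have hc1 : 68/100 < c := by linarith
  have hc2 : c < 7/10 := by linarith
  set C := 16 * (|LL f (-1) b c (-2/5) (-1/2)| + |LL f (-1) b c 1 (9/10)|) with hC
  set S : ℕ → Set ℝ := fun n => Ioo b (b + 1 / ((n : ℝ) + 11)) ∪ Ioo c (c + 1 / ((n : ℝ) + 11))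
    with hS
  have hSm : ∀ n, MeasurableSet (S n) := fun n => measurableSet_Ioo.union measurableSet_Ioo
  have hlim : Filter.Tendsto (fun n => ∫ x, (S n).indicator (fun _ => (1 : ℝ)) x ∂μ)
      Filter.atTop (nhds 0) := by
    have hh : Filter.Tendsto (fun n : ℕ => 1 / ((n : ℝ) + 11)) Filter.atTop (nhds 0) := by
      have := (tendsto_const_nhds (x := (1:ℝ))).div_atTop
        (Filter.tendsto_atTop_add_const_right _ (11 : ℝ) tendsto_natCast_atTop_atTop)
      exact this
    have hpt : ∀ a x : ℝ, ∀ᶠ n : ℕ in Filter.atTop, x ∉ Ioo a (a + 1 / ((n : ℝ) + 11)) := by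
      intro a x
      rcases le_or_gt x a with hxa | hxa
      · exact Filter.Eventually.of_forall fun n hn => absurd hn.1 (not_lt.2 hxa)
      · filter_upwards [hh.eventually (gt_mem_nhds (sub_pos.2 hxa))] with n hn hn2
        have := hn2.2
        linarith
    rw [← integral_zero ℝ ℝ (μ := μ)]
    refine tendsto_integral_of_dominated_convergence (fun _ => (1 : ℝ)) ?_ (integrable_const _) ?_ ?_
    · intro n
      exact (measurable_const.indicator (hSm n)).aestronglyMeasurable
    · intro n
      refine Filter.Eventually.of_forall fun x => ?_
      by_cases hx : x ∈ S n <;> simp [hx]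
    · refine Filter.Eventually.of_forall fun x => ?_
      refine tendsto_const_nhds.congr' ?_
      filter_upwards [hpt b x, hpt c x] with n hn1 hn2
      rw [indicator_of_notMem]
      rintro (h | h)
      · exact hn1 h
      · exact hn2 h
  have hmain : ∀ n : ℕ, (1 / 9) * f (-1) + ((16 + s) / 36) * f b + ((16 - s) / 36) * f c -
      C * ∫ x, (S n).indicator (fun _ => (1 : ℝ)) x ∂μ ≤ ∫ x, f x ∂μ := by
    intro n
    obtain ⟨h, hh⟩ : ∃ h : ℝ, h = 1 / ((n : ℝ) + 11) := ⟨_, rfl⟩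
    have hn0 : (0 : ℝ) ≤ n := Nat.cast_nonneg n
    have hh0 : 0 < h := by rw [hh]; positivity
    have hh1 : h < 1 / 10 := by
      rw [hh]; apply one_div_lt_one_div_of_lt <;> linarith
    have hSn : S n = Ioo b (b + h) ∪ Ioo c (c + h) := by rw [hS, hh]
    obtain ⟨k0, k1, k2, k3, k4, hk⟩ :=
      quartic f (-1) b c (b + h) (LL f (-1) b c (b + h) (c + h))
    have fa : f (-1) = k0 + k1 * (-1) + k2 * (-1) ^ 2 + k3 * (-1) ^ 3 + k4 * (-1) ^ 4 := by
      rw [← hk, NN_a f _ _ _ _ (by linarith) (by linarith) (by linarith)]; ring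
    have fb : f b = k0 + k1 * b + k2 * b ^ 2 + k3 * b ^ 3 + k4 * b ^ 4 := by
      rw [← hk, NN_b f _ _ _ _ (by linarith) (by linarith) (by linarith)]; ring
    have fc : f c = k0 + k1 * c + k2 * c ^ 2 + k3 * c ^ 3 + k4 * c ^ 4 := by
      rw [← hk, NN_c f _ _ _ _ (by linarith) (by linarith) (by linarith)]; ring
    have hQ : (1 / 9) * f (-1) + ((16 + s) / 36) * f b + ((16 - s) / 36) * f c
        = k0 + k2 / 3 + k4 / 5 := by
      have s3 : s ^ 3 = 6 * s := by rw [pow_succ, s2]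
      have s4 : s ^ 4 = 36 := by rw [show s ^ 4 = (s ^ 2) ^ 2 by ring, s2]; norm_num
      have s5 : s ^ 5 = 36 * s := by rw [pow_succ, s4]
      rw [fa, fb, fc, hb, hc]
      ring_nf
      simp only [s2, s3, s4, s5]
      ring
    have iS : Integrable ((S n).indicator (fun _ => (1 : ℝ))) μ :=
      (integrable_const _).indicator (hSm n)
    have i1 : Integrable (fun x : ℝ => x) μ := hint _ (by fun_prop)
    have i2 : Integrable (fun x : ℝ => x ^ 2) μ := hint _ (by fun_prop)
    have i3 : Integrable (fun x : ℝ => x ^ 3) μ := hint _ (by fun_prop)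
    have i4 : Integrable (fun x : ℝ => x ^ 4) μ := hint _ (by fun_prop)
    have ip : Integrable (fun x : ℝ => k0 + k1 * x + k2 * x ^ 2 + k3 * x ^ 3 + k4 * x ^ 4) μ :=
      hint _ (by fun_prop)
    have hP : ∫ x, (k0 + k1 * x + k2 * x ^ 2 + k3 * x ^ 3 + k4 * x ^ 4) ∂μ
        = k0 + k2 / 3 + k4 / 5 := by
      rw [integral_add (hint _ (by fun_prop)) (i4.const_mul _),
        integral_add (hint _ (by fun_prop)) (i3.const_mul _),
        integral_add (hint _ (by fun_prop)) (i2.const_mul _),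
        integral_add (integrable_const _) (i1.const_mul _),
        integral_const_mul, integral_const_mul, integral_const_mul, integral_const_mul,
        h1, h2, h3, h4]
      simp
      ring
    rw [hQ, ← hP, ← integral_const_mul, ← integral_sub ip (iS.const_mul _)]
    refine integral_mono_ae (ip.sub (iS.const_mul _)) hfi ?_
    filter_upwards [hae] with x hx
    have := lower hconv b c h x hb1 hb2 hc1 hc2 hh0 hh1 hx
    rw [hk, ← hSn] at this
    exact this
  have hfin := (tendsto_const_nhds (x := (1 / 9) * f (-1) + ((16 + s) / 36) * f b +
    ((16 - s) / 36) * f c)).sub (hlim.const_mul C)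
  rw [mul_zero, sub_zero] at hfin
  exact le_of_tendsto' hfin hmain
end

section
/- Let μ be a Borel probability measure on [-1,1] such that ∫ x dμ = 0, ∫ x² dμ = 1/3, ∫ x³ dμ = 0 and ∫ x⁴ dμ = 1/5 (i.e. the first four moments of μ agree with those of the normalized Lebesgue measure on [-1,1]). Then for every continuous 4-convex function f : [-1,1] → ℝ one has ∫ f dμ ≤ ((16−√6)/36)·f(−(1+√6)/5) + ((16+√6)/36)·f((√6−1)/5) + (1/9)·f(1). -/
open MeasureTheory Set

/-- Lagrange form, by induction. -/
theorem dd_lagrange (f : ℝ → ℝ) (k : ℕ) (x : Fin (k + 1) → ℝ) (hx : Function.Injective x) :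
    dividedDiff f k x = ∑ i, f (x i) * ∏ j, (if j = i then 1 else (x i - x j)⁻¹) := by
  induction k with
  | zero => simp [dividedDiff]
  | succ k ih =>
    have hne : x (Fin.last (k + 1)) - x 0 ≠ 0 := sub_ne_zero.2 (hx.ne (by simp [Fin.ext_iff]))
    rw [dividedDiff, ih (fun i => x i.succ) (hx.comp (Fin.succ_injective _)),
      ih (fun i => x i.castSucc) (hx.comp (Fin.castSucc_injective _)), div_eq_iff hne]
    have e1 : ∑ i : Fin (k + 1), f (x i.succ) *
        ∏ j : Fin (k + 1), (if j = i then 1 else (x i.succ - x j.succ)⁻¹)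
        = ∑ i : Fin (k + 2), (x i - x 0) *
          (f (x i) * ∏ j, (if j = i then 1 else (x i - x j)⁻¹)) := by
      rw [Fin.sum_univ_succ (n := k + 1)]
      simp only [sub_self, zero_mul, zero_add]
      refine Finset.sum_congr rfl fun i _ => ?_
      rw [Fin.prod_univ_succ (n := k + 1)]
      have h0 : x i.succ - x 0 ≠ 0 := sub_ne_zero.2 (hx.ne (Fin.succ_ne_zero i))
      simp only [(Fin.succ_ne_zero i).symm, if_false, Fin.succ_inj]
      field_simp
    have e2 : ∑ i : Fin (k + 1), f (x i.castSucc) *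
        ∏ j : Fin (k + 1), (if j = i then 1 else (x i.castSucc - x j.castSucc)⁻¹)
        = ∑ i : Fin (k + 2), (x i - x (Fin.last (k + 1))) *
          (f (x i) * ∏ j, (if j = i then 1 else (x i - x j)⁻¹)) := by
      rw [Fin.sum_univ_castSucc (n := k + 1)]
      simp only [sub_self, zero_mul, add_zero]
      refine Finset.sum_congr rfl fun i _ => ?_
      rw [Fin.prod_univ_castSucc (n := k + 1)]
      have h0 : x i.castSucc - x (Fin.last (k + 1)) ≠ 0 :=
        sub_ne_zero.2 (hx.ne (Fin.castSucc_ne_last i))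
      simp only [(Fin.castSucc_ne_last i).symm, if_false, Fin.castSucc_inj]
      field_simp
    rw [e1, e2, ← Finset.sum_sub_distrib, Finset.sum_mul]
    refine Finset.sum_congr rfl fun i _ => ?_
    ring

theorem u_dd (a x y z : ℝ) (hx : a ≠ x) (hy : a ≠ y) (hz : a ≠ z) (hxy : x ≠ y) (hxz : x ≠ z)
    (hyz : y ≠ z) :
    (a - x)⁻¹ * (a - y)⁻¹ * (a - z)⁻¹ = (a - x)⁻¹ * ((x - y)⁻¹ * (x - z)⁻¹)
      + (a - y)⁻¹ * ((y - x)⁻¹ * (y - z)⁻¹) + (a - z)⁻¹ * ((z - x)⁻¹ * (z - y)⁻¹) := by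
  have := sub_ne_zero.2 hx
  have := sub_ne_zero.2 hy
  have := sub_ne_zero.2 hz
  have := sub_ne_zero.2 hxy
  have := sub_ne_zero.2 hxz
  have := sub_ne_zero.2 hyz
  rw [← neg_sub x y, ← neg_sub x z, ← neg_sub y z]
  field_simp
  ring

/-- `f[a,b,c,x]` in Lagrange form. -/
noncomputable def gg (f : ℝ → ℝ) (a b c x : ℝ) : ℝ :=
  f a * ((a - b)⁻¹ * (a - c)⁻¹ * (a - x)⁻¹) + f b * ((b - a)⁻¹ * (b - c)⁻¹ * (b - x)⁻¹)
    + f c * ((c - a)⁻¹ * (c - b)⁻¹ * (c - x)⁻¹) + f x * ((x - a)⁻¹ * (x - b)⁻¹ * (x - c)⁻¹)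

theorem gg_convex (f : ℝ → ℝ) (I : Set ℝ) (hconv : NConvexOn 4 I f) (a b c : ℝ)
    (ha : a ∈ I) (hb : b ∈ I) (hc : c ∈ I) (hab : a < b) (hbc : b < c)
    (x y z : ℝ) (hx : x ∈ I) (hy : y ∈ I) (hz : z ∈ I) (hxy : x < y) (hyz : y < z)
    (hxa : x ≠ a) (hxb : x ≠ b) (hxc : x ≠ c)
    (hya : y ≠ a) (hyb : y ≠ b) (hyc : y ≠ c)
    (hza : z ≠ a) (hzb : z ≠ b) (hzc : z ≠ c) :
    0 ≤ gg f a b c x * (z - y) - gg f a b c y * (z - x) + gg f a b c z * (y - x) := by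
  have hinj : Function.Injective ![a, b, c, x, y, z] := by
    have := hab.ne
    have := hbc.ne
    have := (hab.trans hbc).ne
    have := hxy.ne
    have := hyz.ne
    have := (hxy.trans hyz).ne
    intro i j h
    fin_cases i <;> fin_cases j <;> first | rfl | (exfalso; simp at h; grind)
  have key := hconv ![a, b, c, x, y, z] (by
    intro i; fin_cases i <;> simpa) hinj
  rw [dd_lagrange _ _ _ hinj] at key
  replace key : 0 ≤ ∑ i : Fin 6, f (![a, b, c, x, y, z] i) * ∏ j : Fin 6,
      (if j = i then 1 else (![a, b, c, x, y, z] i - ![a, b, c, x, y, z] j)⁻¹) := key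
  simp only [Fin.sum_univ_six, Fin.prod_univ_six] at key
  simp [Fin.ext_iff] at key
  have hpos : 0 < (y - x) * (z - x) * (z - y) :=
    mul_pos (mul_pos (by linarith) (by linarith)) (by linarith)
  have key2 : 0 ≤ gg f a b c x * ((x - y)⁻¹ * (x - z)⁻¹) + gg f a b c y * ((y - x)⁻¹ * (y - z)⁻¹)
      + gg f a b c z * ((z - x)⁻¹ * (z - y)⁻¹) := by
    refine key.trans_eq ?_
    have ua := u_dd a x y z hxa.symm hya.symm hza.symm hxy.ne (hxy.trans hyz).ne hyz.ne
    have ub := u_dd b x y z hxb.symm hyb.symm hzb.symm hxy.ne (hxy.trans hyz).ne hyz.ne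
    have uc := u_dd c x y z hxc.symm hyc.symm hzc.symm hxy.ne (hxy.trans hyz).ne hyz.ne
    unfold gg
    linear_combination f a * ((a - b)⁻¹ * (a - c)⁻¹) * ua + f b * ((b - a)⁻¹ * (b - c)⁻¹) * ub
      + f c * ((c - a)⁻¹ * (c - b)⁻¹) * uc
  have := mul_nonneg key2 hpos.le
  refine this.trans_eq ?_
  have e1 : x - y ≠ 0 := sub_ne_zero.2 hxy.ne
  have e2 : y - z ≠ 0 := sub_ne_zero.2 hyz.ne
  have e3 : x - z ≠ 0 := sub_ne_zero.2 (hxy.trans hyz).ne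
  rw [← neg_sub x y, ← neg_sub x z, ← neg_sub y z]
  field_simp
  ring

theorem gg_bdd (g : ℝ → ℝ) (p l r s : ℝ) (hlp : l < p) (hpr : p < r) (hrs : r < s)
    (h1 : ∀ u, p < u → u < r → 0 ≤ g l * (r - u) - g u * (r - l) + g r * (u - l))
    (h2 : ∀ u, p < u → u < r → 0 ≤ g u * (s - r) - g r * (s - u) + g s * (r - u)) :
    ∃ C, ∀ u, p < u → u < r → g u ∈ Icc (-C) C := by
  refine ⟨|g l| + |g r| + (|g r| + |g s|) * (s - p) / (s - r), fun u hu hur => ?_⟩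
  have q1 := h1 u hu hur
  have q2 := h2 u hu hur
  have sr : 0 < s - r := by linarith
  have A := abs_nonneg (g l)
  have B := abs_nonneg (g r)
  have C := abs_nonneg (g s)
  have D : 0 ≤ (|g r| + |g s|) * (s - p) / (s - r) :=
    div_nonneg (mul_nonneg (by linarith) (by linarith)) sr.le
  have hA := le_abs_self (g l)
  have hB := le_abs_self (g r)
  have hB' := neg_abs_le (g r)
  have hC := le_abs_self (g s)
  constructor
  · have : -((|g r| + |g s|) * (s - p) / (s - r)) ≤ g u := by
      rw [← neg_div, div_le_iff₀ sr]
      have t1 : -(|g r| * (s - p)) ≤ g r * (s - u) := by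
        nlinarith [mul_nonneg B (by linarith : 0 ≤ u - p)]
      have t2 : g s * (r - u) ≤ |g s| * (s - p) := by
        nlinarith [mul_nonneg C (by linarith : 0 ≤ (s - p) - (r - u))]
      linarith
    linarith
  · have : g u ≤ |g l| + |g r| := by
      have rl : 0 < r - l := by linarith
      by_contra hcon
      push Not at hcon
      have := mul_lt_mul_of_pos_right hcon rl
      have t1 : g l * (r - u) ≤ |g l| * (r - l) := by
        nlinarith [mul_nonneg A (by linarith : 0 ≤ u - l)]
      have t2 : g r * (u - l) ≤ |g r| * (r - l) := by
        nlinarith [mul_nonneg B (by linarith : 0 ≤ r - u)]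
      linarith
    linarith

theorem line_exists (g : ℝ → ℝ) (a b : ℝ) (ha : -1 < a) (hab : a < b) (hb : b < 1)
    (hg : ∀ x y z, -1 ≤ x → x < y → y < z → z < 1 → x ≠ a → x ≠ b → y ≠ a → y ≠ b →
      z ≠ a → z ≠ b → 0 ≤ g x * (z - y) - g y * (z - x) + g z * (y - x)) :
    ∃ A B : ℝ, ∀ x, -1 ≤ x → x < 1 →
      (x < a → 0 ≤ g x * (b - a) - A * (b - x) + B * (a - x)) ∧
      (a < x → x < b → g x * (b - a) - A * (b - x) + B * (a - x) ≤ 0) ∧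
      (b < x → 0 ≤ g x * (b - a) - A * (b - x) + B * (a - x)) := by
  obtain ⟨C, hC⟩ := gg_bdd g a (-1) ((2 * a + b) / 3) ((a + 2 * b) / 3) ha (by linarith)
    (by linarith)
    (fun u h1 h2 => hg _ _ _ (by grind) (by grind) (by grind) (by grind) (by grind) (by grind)
      (by grind) (by grind) (by grind) (by grind))
    (fun u h1 h2 => hg _ _ _ (by grind) (by grind) (by grind) (by grind) (by grind) (by grind)
      (by grind) (by grind) (by grind) (by grind))
  obtain ⟨D, hD⟩ := gg_bdd g b (-1) ((2 * b + 1) / 3) ((b + 2) / 3) (by linarith) (by linarith)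
    (by linarith)
    (fun u h1 h2 => hg _ _ _ (by grind) (by grind) (by grind) (by grind) (by grind) (by grind)
      (by grind) (by grind) (by grind) (by grind))
    (fun u h1 h2 => hg _ _ _ (by grind) (by grind) (by grind) (by grind) (by grind) (by grind)
      (by grind) (by grind) (by grind) (by grind))
  obtain ⟨d, d0, d1, d2⟩ : ∃ d : ℝ, 0 < d ∧ d < (b - a) / 3 ∧ d < (1 - b) / 3 := by
    refine ⟨min ((b - a) / 4) ((1 - b) / 4), lt_min (by linarith) (by linarith), ?_, ?_⟩
    · exact (min_le_left _ _).trans_lt (by linarith)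
    · exact (min_le_right _ _).trans_lt (by linarith)
  let e : ℕ → ℝ := fun n => d * (1 / ((n : ℝ) + 1))
  have e0 : ∀ n, 0 < e n := fun n => by positivity
  have e1 : ∀ n, e n ≤ d := fun n => by
    have : 1 / ((n : ℝ) + 1) ≤ 1 := by
      rw [div_le_one (by positivity)]; linarith [n.cast_nonneg (α := ℝ)]
    calc e n ≤ d * 1 := mul_le_mul_of_nonneg_left this d0.le
      _ = d := mul_one d
  have elim : Filter.Tendsto e Filter.atTop (nhds 0) := by
    have := (tendsto_one_div_add_atTop_nhds_zero_nat (𝕜 := ℝ)).const_mul d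
    rwa [mul_zero] at this
  have hcomp : IsCompact (Icc (-C) C ×ˢ Icc (-D) D) := isCompact_Icc.prod isCompact_Icc
  obtain ⟨⟨A, B⟩, -, φ, hφ, hlim⟩ := hcomp.tendsto_subseq
    (x := fun n => (g (a + e n), g (b + e n))) (fun n => ⟨hC _ (by linarith [e0 n])
      (by linarith [e1 n]), hD _ (by linarith [e0 n]) (by linarith [e1 n])⟩)
  have hA : Filter.Tendsto (fun n => g (a + e (φ n))) Filter.atTop (nhds A) :=
    (continuous_fst.tendsto _).comp hlim
  have hB : Filter.Tendsto (fun n => g (b + e (φ n))) Filter.atTop (nhds B) :=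
    (continuous_snd.tendsto _).comp hlim
  have el : Filter.Tendsto (fun n => e (φ n)) Filter.atTop (nhds 0) :=
    elim.comp hφ.tendsto_atTop
  refine ⟨A, B, fun x hx1 hx2 => ?_⟩
  have L : Filter.Tendsto (fun n => g x * (b - a) - g (a + e (φ n)) * (b + e (φ n) - x)
      + g (b + e (φ n)) * (a + e (φ n) - x)) Filter.atTop
      (nhds (g x * (b - a) - A * (b - x) + B * (a - x))) := by
    have := ((hA.mul ((el.const_add b).sub_const x)).const_sub (g x * (b - a))).add
      (hB.mul ((el.const_add a).sub_const x))
    simpa using this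
  refine ⟨fun h => ?_, fun h h' => ?_, fun h => ?_⟩
  · refine ge_of_tendsto' L fun n => ?_
    have p0 := e0 (φ n)
    have p1 := e1 (φ n)
    have := hg x (a + e (φ n)) (b + e (φ n)) hx1 (by linarith) (by linarith) (by linarith)
      (by grind) (by grind) (by grind) (by grind) (by grind) (by grind)
    linarith
  · refine le_of_tendsto L ?_
    filter_upwards [el.eventually_lt_const (by linarith : 0 < x - a)] with n hn
    have p0 := e0 (φ n)
    have p1 := e1 (φ n)
    have := hg (a + e (φ n)) x (b + e (φ n)) (by linarith) (by linarith) (by linarith)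
      (by linarith) (by grind) (by grind) (by grind) (by grind) (by grind) (by grind)
    linarith
  · refine ge_of_tendsto L ?_
    filter_upwards [el.eventually_lt_const (by linarith : 0 < x - b)] with n hn
    have p0 := e0 (φ n)
    have p1 := e1 (φ n)
    have := hg (a + e (φ n)) (b + e (φ n)) x (by linarith) (by linarith) (by linarith)
      (by linarith) (by grind) (by grind) (by grind) (by grind) (by grind) (by grind)
    linarith

theorem f_eq_gg (f : ℝ → ℝ) (a b c x : ℝ) (hab : a ≠ b) (hac : a ≠ c) (hbc : b ≠ c)
    (hxa : x ≠ a) (hxb : x ≠ b) (hxc : x ≠ c) :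
    f x = f a * ((x - b) * (x - c) / ((a - b) * (a - c)))
      + f b * ((x - a) * (x - c) / ((b - a) * (b - c)))
      + f c * ((x - a) * (x - b) / ((c - a) * (c - b)))
      + (x - a) * (x - b) * (x - c) * gg f a b c x := by
  have h1 := sub_ne_zero.2 hab
  have h2 := sub_ne_zero.2 hac
  have h3 := sub_ne_zero.2 hbc
  have h4 := sub_ne_zero.2 hxa
  have h5 := sub_ne_zero.2 hxb
  have h6 := sub_ne_zero.2 hxc
  unfold gg
  rw [← neg_sub a b, ← neg_sub a c, ← neg_sub b c, ← neg_sub x a, ← neg_sub x b, ← neg_sub x c]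
  field_simp
  ring

theorem poly_exists (f : ℝ → ℝ) (hconv : NConvexOn 4 (Icc (-1 : ℝ) 1) f) (a b : ℝ)
    (ha : -1 < a) (hab : a < b) (hb : b < 1) :
    ∃ c0 c1 c2 c3 c4 : ℝ,
      (∀ x ∈ Icc (-1 : ℝ) 1, f x ≤ c0 + c1 * x + c2 * x ^ 2 + c3 * x ^ 3 + c4 * x ^ 4) ∧
      (f a = c0 + c1 * a + c2 * a ^ 2 + c3 * a ^ 3 + c4 * a ^ 4) ∧
      (f b = c0 + c1 * b + c2 * b ^ 2 + c3 * b ^ 3 + c4 * b ^ 4) ∧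
      (f 1 = c0 + c1 + c2 + c3 + c4) := by
  obtain ⟨A, B, hAB⟩ := line_exists (gg f a b 1) a b ha hab hb (by
    intro x y z h1 h2 h3 h4 h5 h6 h7 h8 h9 h10
    exact gg_convex f _ hconv a b 1 (by grind) (by grind) (by grind) hab hb x y z
      (by grind) (by grind) (by grind) h2 h3 h5 h6 (by grind) h7 h8 (by grind) h9 h10 (by grind))
  have n1 : a - b ≠ 0 := by grind
  have n1' : b - a ≠ 0 := by grind
  have n2 : a - 1 ≠ 0 := by grind
  have n2' : 1 - a ≠ 0 := by grind
  have n3 : b - 1 ≠ 0 := by grind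
  have n3' : 1 - b ≠ 0 := by grind
  -- coefficients
  obtain ⟨s, hs⟩ : ∃ s, s = f a / ((a - b) * (a - 1)) := ⟨_, rfl⟩
  obtain ⟨t, ht⟩ : ∃ t, t = f b / ((b - a) * (b - 1)) := ⟨_, rfl⟩
  obtain ⟨w, hw⟩ : ∃ w, w = f 1 / ((1 - a) * (1 - b)) := ⟨_, rfl⟩
  obtain ⟨p, hp⟩ : ∃ p, p = (B - A) / (b - a) := ⟨_, rfl⟩
  obtain ⟨q, hq⟩ : ∃ q, q = (A * b - B * a) / (b - a) := ⟨_, rfl⟩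
  have hs' : f a = s * ((a - b) * (a - 1)) := by rw [hs]; field_simp
  have ht' : f b = t * ((b - a) * (b - 1)) := by rw [ht]; field_simp
  have hw' : f 1 = w * ((1 - a) * (1 - b)) := by rw [hw]; field_simp
  have hpq : ∀ x, A * (b - x) - B * (a - x) = (p * x + q) * (b - a) := by
    intro x; rw [hp, hq]; field_simp; ring
  have ident : ∀ x, s * b + t * a + w * a * b - a * b * q
      + (-s * (1 + b) - t * (1 + a) - w * (a + b) + q * (a * b + a + b) - a * b * p) * x
      + (s + t + w - q * (a + b + 1) + p * (a * b + a + b)) * x ^ 2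
      + (q - p * (a + b + 1)) * x ^ 3 + p * x ^ 4
      = s * ((x - b) * (x - 1)) + t * ((x - a) * (x - 1)) + w * ((x - a) * (x - b))
        + (x - a) * (x - b) * (x - 1) * (p * x + q) := by
    intro x; ring
  refine ⟨s * b + t * a + w * a * b - a * b * q,
    -s * (1 + b) - t * (1 + a) - w * (a + b) + q * (a * b + a + b) - a * b * p,
    s + t + w - q * (a + b + 1) + p * (a * b + a + b),
    q - p * (a + b + 1), p, ?_, ?_, ?_, ?_⟩
  · intro x hx
    rw [ident]
    by_cases xa : x = a
    · subst xa; rw [hs']; apply le_of_eq; ring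
    by_cases xb : x = b
    · subst xb; rw [ht']; apply le_of_eq; ring
    by_cases x1 : x = 1
    · subst x1; rw [hw']; apply le_of_eq; ring
    have hx1 : x < 1 := lt_of_le_of_ne hx.2 x1
    have hf := f_eq_gg f a b 1 x hab.ne (by grind) hb.ne xa xb x1
    have hf2 : f x = s * ((x - b) * (x - 1)) + t * ((x - a) * (x - 1)) + w * ((x - a) * (x - b))
        + (x - a) * (x - b) * (x - 1) * gg f a b 1 x := by
      rw [hs, ht, hw]; refine hf.trans ?_; ring
    rw [hf2]
    obtain ⟨k1, k2, k3⟩ := hAB x hx.1 hx1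
    have hx' := hpq x
    have ba : 0 < b - a := by linarith
    have sg : ∀ v : ℝ, 0 ≤ v * (b - a) → 0 ≤ v := fun v hv => nonneg_of_mul_nonneg_left hv ba
    rcases lt_or_gt_of_ne xa with h | h
    · have r := sg (gg f a b 1 x - (p * x + q)) (by linarith [k1 h])
      have o : 0 ≤ (a - x) * (b - x) * (1 - x) :=
        mul_nonneg (mul_nonneg (by linarith) (by linarith)) (by linarith)
      linarith [mul_nonneg o r]
    rcases lt_or_gt_of_ne xb with h' | h'
    · have r := sg ((p * x + q) - gg f a b 1 x) (by linarith [k2 h h'])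
      have o : 0 ≤ (x - a) * (b - x) * (1 - x) :=
        mul_nonneg (mul_nonneg (by linarith) (by linarith)) (by linarith)
      linarith [mul_nonneg o r]
    · have r := sg (gg f a b 1 x - (p * x + q)) (by linarith [k3 h'])
      have o : 0 ≤ (x - a) * (x - b) * (1 - x) :=
        mul_nonneg (mul_nonneg (by linarith) (by linarith)) (by linarith)
      linarith [mul_nonneg o r]
  · rw [ident, hs']; ring
  · rw [ident, ht']; ring
  · rw [hw']; ring

theorem stmt8 (μ : Measure ℝ) [IsProbabilityMeasure μ]
    (hsupp : μ (Set.Icc (-1 : ℝ) 1) = 1)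
    (h1 : ∫ x, x ∂μ = 0) (h2 : ∫ x, x ^ 2 ∂μ = 1 / 3) (h3 : ∫ x, x ^ 3 ∂μ = 0)
    (h4 : ∫ x, x ^ 4 ∂μ = 1 / 5)
    (f : ℝ → ℝ) (hcont : ContinuousOn f (Set.Icc (-1 : ℝ) 1))
    (hconv : NConvexOn 4 (Set.Icc (-1 : ℝ) 1) f) :
    ∫ x, f x ∂μ ≤
      ((16 - Real.sqrt 6) / 36) * f (-(1 + Real.sqrt 6) / 5) +
        ((16 + Real.sqrt 6) / 36) * f ((Real.sqrt 6 - 1) / 5) + (1 / 9) * f 1 := by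
  have hr : μ.restrict (Icc (-1 : ℝ) 1) = μ := by
    refine Measure.restrict_eq_self_of_ae_mem ?_
    exact (mem_ae_iff_prob_eq_one measurableSet_Icc).2 hsupp
  have hae : ∀ᵐ x ∂μ, x ∈ Icc (-1 : ℝ) 1 := (mem_ae_iff_prob_eq_one measurableSet_Icc).2 hsupp
  have hint : ∀ g : ℝ → ℝ, ContinuousOn g (Icc (-1 : ℝ) 1) → Integrable g μ := by
    intro g hg
    have := hg.integrableOn_compact (μ := μ) isCompact_Icc
    rwa [IntegrableOn, hr] at this
  have s6 : Real.sqrt 6 ^ 2 = 6 := Real.sq_sqrt (by norm_num)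
  have s0 : 0 ≤ Real.sqrt 6 := Real.sqrt_nonneg 6
  generalize Real.sqrt 6 = s at *
  have s2 : 2 < s := by nlinarith
  have s3 : s < 3 := by nlinarith
  obtain ⟨c0, c1, c2, c3, c4, hle, ea, eb, e1⟩ := poly_exists f hconv (-(1 + s) / 5)
    ((s - 1) / 5) (by linarith) (by linarith) (by linarith)
  have i1 : Integrable (fun x : ℝ => c1 * x) μ := hint _ (by fun_prop)
  have i2 : Integrable (fun x : ℝ => c2 * x ^ 2) μ := hint _ (by fun_prop)
  have i3 : Integrable (fun x : ℝ => c3 * x ^ 3) μ := hint _ (by fun_prop)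
  have i4 : Integrable (fun x : ℝ => c4 * x ^ 4) μ := hint _ (by fun_prop)
  have i0 : Integrable (fun _ : ℝ => c0) μ := integrable_const _
  have hI : ∫ x, f x ∂μ ≤ ∫ x, (c0 + c1 * x + c2 * x ^ 2 + c3 * x ^ 3 + c4 * x ^ 4) ∂μ := by
    refine integral_mono_ae (hint f hcont) (hint _ (by fun_prop)) ?_
    filter_upwards [hae] with x hx using hle x hx
  have hP : ∫ x, (c0 + c1 * x + c2 * x ^ 2 + c3 * x ^ 3 + c4 * x ^ 4) ∂μ
      = c0 + c2 / 3 + c4 / 5 := by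
    rw [integral_add (hint _ (by fun_prop)) i4, integral_add (hint _ (by fun_prop)) i3,
      integral_add (hint _ (by fun_prop)) i2, integral_add i0 i1]
    rw [integral_const_mul, integral_const_mul, integral_const_mul, integral_const_mul,
      h1, h2, h3, h4]
    simp
    ring
  rw [hP] at hI
  refine hI.trans (le_of_eq ?_)
  rw [ea, eb, e1]
  have s4 : s ^ 4 = 36 := by rw [show s ^ 4 = (s ^ 2) ^ 2 by ring, s6]; norm_num
  have s3' : s ^ 3 = 6 * s := by rw [show s ^ 3 = s ^ 2 * s by ring, s6]
  have s5 : s ^ 5 = 36 * s := by rw [show s ^ 5 = s ^ 4 * s by ring, s4]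
  ring_nf
  simp only [s3', s4, s5, s6]
  ring
end

section
/- Let a < b be real numbers. Then for every continuous 3-convex function f : [a,b] → ℝ one has (1/2)·[ f( ((3-√3)/6)·a + ((3+√3)/6)·b ) + f( ((3+√3)/6)·a + ((3-√3)/6)·b ) ] ≤ (1/(b-a)) ∫_a^b f(x) dx ≤ (1/6)·f(a) + (2/3)·f((a+b)/2) + (1/6)·f(b). -/
open MeasureTheory Set

lemma key_aux (f : ℝ → ℝ) (m r : ℝ) (hconv : NConvexOn 3 (Set.Icc (m - r) (m + r)) f)
    (x y z : ℝ) (hxy : |x| < y) (hyz : y < z) (hz : z ≤ r) :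
    0 ≤ f (m + x) * (2 * y * z * (z ^ 2 - y ^ 2))
      - (f (m + y) * (y + x) + f (m - y) * (y - x)) * (z * (z ^ 2 - x ^ 2))
      + (f (m + z) * (z + x) + f (m - z) * (z - x)) * (y * (y ^ 2 - x ^ 2)) := by
  obtain ⟨h1, h2⟩ := abs_lt.1 hxy
  have hinj : StrictMono ![m - z, m - y, m + x, m + y, m + z] := by
    rw [Fin.strictMono_iff_lt_succ]
    intro i
    fin_cases i <;> simp <;> linarith
  have h := hconv ![m - z, m - y, m + x, m + y, m + z] (by
    intro i
    fin_cases i <;> simp <;> constructor <;> linarith) hinj.injective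
  have e1 : 0 < y - x := by linarith
  have e2 : 0 < y + x := by linarith
  have e3 : 0 < z - x := by linarith
  have e4 : 0 < z + x := by linarith
  have e5 : 0 < z - y := by linarith
  have e6 : 0 < z + y := by linarith
  have e7 : 0 < y := by linarith
  have e8 : 0 < z := by linarith
  have h' : dividedDiff f 4 ![m - z, m - y, m + x, m + y, m + z] =
     (f (m + x) * (2 * y * z * (z ^ 2 - y ^ 2))
      - (f (m + y) * (y + x) + f (m - y) * (y - x)) * (z * (z ^ 2 - x ^ 2))
      + (f (m + z) * (z + x) + f (m - z) * (z - x)) * (y * (y ^ 2 - x ^ 2))) /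
      (2 * y * z * ((y - x) * (y + x)) * ((z - x) * (z + x)) * ((z - y) * (z + y))) := by
    have q1 : (m - y) - (m - z) = z - y := by ring
    have q2 : (m + x) - (m - z) = z + x := by ring
    have q3 : (m + y) - (m - z) = z + y := by ring
    have q4 : (m + z) - (m - z) = 2 * z := by ring
    have q5 : (m + x) - (m - y) = y + x := by ring
    have q6 : (m + y) - (m - y) = 2 * y := by ring
    have q7 : (m + z) - (m - y) = z + y := by ring
    have q8 : (m + y) - (m + x) = y - x := by ring
    have q9 : (m + z) - (m + x) = z - x := by ring
    have q0 : (m + z) - (m + y) = z - y := by ring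
    have hd : dividedDiff f 4 ![m - z, m - y, m + x, m + y, m + z] =
      ((((f (m+z) - f (m+y)) / (m+z-(m+y)) - (f (m+y) - f (m+x)) / (m+y-(m+x))) / (m+z-(m+x))
       - ((f (m+y) - f (m+x)) / (m+y-(m+x)) - (f (m+x) - f (m-y)) / (m+x-(m-y))) / (m+y-(m-y))) / (m+z-(m-y))
      - (((f (m+y) - f (m+x)) / (m+y-(m+x)) - (f (m+x) - f (m-y)) / (m+x-(m-y))) / (m+y-(m-y))
       - ((f (m+x) - f (m-y)) / (m+x-(m-y)) - (f (m-y) - f (m-z)) / (m-y-(m-z))) / (m+x-(m-z))) / (m+y-(m-z))) / (m+z-(m-z)) := rfl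
    rw [hd, q1, q2, q3, q4, q5, q6, q7, q8, q9, q0]
    generalize f (m + x) = A
    generalize f (m + y) = B
    generalize f (m - y) = C
    generalize f (m + z) = D
    generalize f (m - z) = E
    have := e1.ne'
    have := e2.ne'
    have := e3.ne'
    have := e4.ne'
    have := e5.ne'
    have := e6.ne'
    field_simp
    ring
  rw [h'] at h
  have hp : 0 < (2 * y * z * ((y - x) * (y + x)) * ((z - x) * (z + x)) * ((z - y) * (z + y))) := by
    positivity
  rw [le_div_iff₀ hp] at h
  linarith

lemma key_s9 (f : ℝ → ℝ) (m r : ℝ) (hconv : NConvexOn 3 (Set.Icc (m - r) (m + r)) f)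
    (x y z : ℝ) (hx : 0 ≤ x) (hxy : x < y) (hyz : y < z) (hz : z ≤ r) :
    0 ≤ (f (m + x) + f (m - x)) * (z ^ 2 - y ^ 2)
      - (f (m + y) + f (m - y)) * (z ^ 2 - x ^ 2)
      + (f (m + z) + f (m - z)) * (y ^ 2 - x ^ 2) := by
  have h1 := key_aux f m r hconv x y z (by rwa [abs_of_nonneg hx]) hyz hz
  have h2 := key_aux f m r hconv (-x) y z (by rwa [abs_neg, abs_of_nonneg hx]) hyz hz
  have hp : 0 < 2 * y * z := by
    have : 0 < y := by linarith
    have : 0 < z := by linarith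
    positivity
  refine nonneg_of_mul_nonneg_right (a := 2 * y * z) ?_ hp
  rw [← sub_eq_add_neg] at h2
  linarith

lemma hconvex (f : ℝ → ℝ) (m r : ℝ) (hr : 0 < r)
    (hconv : NConvexOn 3 (Set.Icc (m - r) (m + r)) f) :
    ConvexOn ℝ (Set.Icc 0 (r ^ 2)) (fun t => f (m + √t) + f (m - √t)) := by
  apply convexOn_of_slope_mono_adjacent (convex_Icc _ _)
  intro x y z hx hz hxy hyz
  have hk := key_s9 f m r hconv (√x) (√y) (√z) (Real.sqrt_nonneg _)
    (Real.sqrt_lt_sqrt hx.1 hxy) (Real.sqrt_lt_sqrt (by linarith [hx.1]) hyz)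
    (by rw [Real.sqrt_le_left hr.le]; exact hz.2)
  rw [Real.sq_sqrt hx.1, Real.sq_sqrt hz.1, Real.sq_sqrt (by linarith [hx.1])] at hk
  rw [div_le_div_iff₀ (by linarith) (by linarith)]
  linarith

lemma sqrt_abs_sum (f : ℝ → ℝ) (m y : ℝ) :
    f (m + √((y - m) ^ 2)) + f (m - √((y - m) ^ 2)) = f y + f (2 * m - y) := by
  rw [Real.sqrt_sq_eq_abs]
  rcases abs_cases (y - m) with ⟨h, _⟩ | ⟨h, _⟩ <;> rw [h]
  · congr 2 <;> ring
  · rw [add_comm]; congr 2 <;> ring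

theorem stmt9 (a b : ℝ) (hab : a < b)
    (f : ℝ → ℝ) (hcont : ContinuousOn f (Set.Icc a b))
    (hconv : NConvexOn 3 (Set.Icc a b) f) :
    (1 / 2) * (f ((3 - Real.sqrt 3) / 6 * a + (3 + Real.sqrt 3) / 6 * b) +
        f ((3 + Real.sqrt 3) / 6 * a + (3 - Real.sqrt 3) / 6 * b)) ≤
      (b - a)⁻¹ * ∫ x in a..b, f x ∧
    (b - a)⁻¹ * ∫ x in a..b, f x ≤
      (1 / 6) * f a + (2 / 3) * f ((a + b) / 2) + (1 / 6) * f b := by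
  obtain ⟨m, hm⟩ : ∃ m, m = (a + b) / 2 := ⟨_, rfl⟩
  obtain ⟨r, hr⟩ : ∃ r, r = (b - a) / 2 := ⟨_, rfl⟩
  have hr0 : 0 < r := by linarith
  obtain rfl : a = m - r := by linarith
  obtain rfl : b = m + r := by linarith
  have hc := hconvex f m r hr0 hconv
  set h : ℝ → ℝ := fun t => f (m + √t) + f (m - √t) with hh
  have hs : ∀ t ∈ Icc 0 (r ^ 2), √t ≤ r := fun t ht => by
    rw [Real.sqrt_le_left hr0.le]; exact ht.2
  have hcc : ContinuousOn h (Icc 0 (r ^ 2)) := by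
    apply ContinuousOn.add
    · apply hcont.comp (by fun_prop)
      intro t ht
      have := hs t ht
      have := Real.sqrt_nonneg t
      constructor <;> linarith
    · apply hcont.comp (by fun_prop)
      intro t ht
      have := hs t ht
      have := Real.sqrt_nonneg t
      constructor <;> linarith
  have hmem : ∀ y ∈ Icc (m - r) (m + r), (y - m) ^ 2 ∈ Icc 0 (r ^ 2) := by
    intro y hy
    exact ⟨sq_nonneg _, by nlinarith [hy.1, hy.2]⟩
  have hle : m - r ≤ m + r := by linarith
  have hcomp : ContinuousOn (h ∘ fun y => (y - m) ^ 2) (Icc (m - r) (m + r)) :=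
    hcc.comp (by fun_prop) hmem
  have hint : IntervalIntegrable (fun y => h ((y - m) ^ 2)) volume (m - r) (m + r) := by
    apply ContinuousOn.intervalIntegrable
    rw [uIcc_of_le hle]; exact hcomp
  have hf : IntervalIntegrable f volume (m - r) (m + r) := by
    apply ContinuousOn.intervalIntegrable
    rwa [uIcc_of_le hle]
  have hI : ∫ y in (m - r)..(m + r), h ((y - m) ^ 2) = 2 * ∫ y in (m - r)..(m + r), f y := by
    have h2 : IntervalIntegrable (fun y => f (2 * m - y)) volume (m - r) (m + r) := by
      apply ContinuousOn.intervalIntegrable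
      rw [uIcc_of_le hle]
      apply hcont.comp (by fun_prop)
      intro t ht
      constructor <;> linarith [ht.1, ht.2]
    simp only [hh, sqrt_abs_sum]
    rw [intervalIntegral.integral_add hf h2, intervalIntegral.integral_comp_sub_left]
    rw [show 2 * m - (m + r) = m - r by ring, show 2 * m - (m - r) = m + r by ring]
    ring
  have hsq : ∫ y in (m - r)..(m + r), (y - m) ^ 2 = 2 * r ^ 3 / 3 := by
    rw [intervalIntegral.integral_comp_sub_right (fun y => y ^ 2), integral_pow]
    push_cast
    ring
  have hlen : m + r - (m - r) = 2 * r := by ring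
  constructor
  · have hJ := hc.map_set_average_le (μ := volume) (t := Ioc (m - r) (m + r))
      (f := fun y => (y - m) ^ 2) hcc isClosed_Icc (by simp; linarith) (by simp)
      ((ae_restrict_mem measurableSet_Ioc).mono fun y hy => hmem y (Ioc_subset_Icc_self hy))
      ((by fun_prop : Continuous fun y : ℝ => (y - m) ^ 2).integrableOn_Ioc)
      (hcomp.integrableOn_Icc.mono_set Ioc_subset_Icc_self)
    rw [← uIoc_of_le hle, interval_average_eq, interval_average_eq, hI, hsq, hlen] at hJ
    have h3 : √((2 * r)⁻¹ • (2 * r ^ 3 / 3)) = r * √3 / 3 := by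
      rw [Real.sqrt_eq_iff_mul_self_eq_of_pos (by positivity), smul_eq_mul]
      have := Real.sq_sqrt (show (0:ℝ) ≤ 3 by norm_num)
      field_simp
      nlinarith
    simp only [hh] at hJ
    rw [h3, smul_eq_mul] at hJ
    rw [hlen, show (3 - √3) / 6 * (m - r) + (3 + √3) / 6 * (m + r) = m + r * √3 / 3 by ring,
      show (3 + √3) / 6 * (m - r) + (3 - √3) / 6 * (m + r) = m - r * √3 / 3 by ring]
    linarith
  · have hb : ∀ y ∈ Icc (m - r) (m + r), h ((y - m) ^ 2) ≤
        h 0 + (h (r ^ 2) - h 0) / r ^ 2 * (y - m) ^ 2 := by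
      intro y hy
      have ht := hmem y hy
      generalize (y - m) ^ 2 = t at ht
      have hc2 := hc.2
      have h1 := hc2 (left_mem_Icc.2 (sq_nonneg r)) (right_mem_Icc.2 (sq_nonneg r))
        (show 0 ≤ 1 - t / r ^ 2 by rw [sub_nonneg, div_le_one (by positivity)]; exact ht.2)
        (show 0 ≤ t / r ^ 2 from div_nonneg ht.1 (sq_nonneg r)) (by ring)
      have h4 : (1 - t / r ^ 2) • (0 : ℝ) + (t / r ^ 2) • r ^ 2 = t := by
        simp only [smul_eq_mul]; field_simp; ring
      rw [h4] at h1
      simp only [smul_eq_mul] at h1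
      calc h t ≤ _ := h1
        _ = _ := by ring
    have hm' := intervalIntegral.integral_mono_on hle hint
      (Continuous.intervalIntegrable (by fun_prop) _ _) hb
    rw [hI, intervalIntegral.integral_add (by simp)
      (Continuous.intervalIntegrable (by fun_prop) _ _),
      intervalIntegral.integral_const_mul, hsq, intervalIntegral.integral_const, hlen] at hm'
    have h0 : h 0 = 2 * f m := by simp [hh]; ring
    have h1 : h (r ^ 2) = f (m + r) + f (m - r) := by simp [hh, Real.sqrt_sq hr0.le]
    rw [h0, h1, smul_eq_mul] at hm'
    rw [hlen, show (m - r + (m + r)) / 2 = m by ring, inv_mul_le_iff₀ (by positivity)]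
    have h5 : (f (m + r) + f (m - r) - 2 * f m) / r ^ 2 * (2 * r ^ 3 / 3)
      = (f (m + r) + f (m - r) - 2 * f m) * (2 * r / 3) := by field_simp
    rw [h5] at hm'
    linarith
end

section
/- Let a < b be real numbers. Then for every continuous 2-convex function f : [a,b] → ℝ one has (1/4)·f(a) + (3/4)·f((a+2b)/3) ≤ (1/(b-a)) ∫_a^b f(x) dx ≤ (3/4)·f((2a+b)/3) + (1/4)·f(b). -/
open MeasureTheory Set

lemma slope_ineq (a b : ℝ) (f : ℝ → ℝ) (hconv : NConvexOn 2 (Set.Icc a b) f)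
    (e x c y : ℝ) (he : e ∈ Icc a b) (hx : x ∈ Icc a b) (hc : c ∈ Icc a b) (hy : y ∈ Icc a b)
    (hxc : x < c) (hcy : c < y) (hex : x ≠ e) (hec : c ≠ e) (hey : y ≠ e) :
    ((f c - f e) / (c - e) - (f x - f e) / (x - e)) / (c - x) ≤
    ((f y - f e) / (y - e) - (f c - f e) / (c - e)) / (y - c) := by
  have h := hconv ![e, x, c, y] (by intro i; fin_cases i <;> simpa) (by
    have h1 := hxc.ne
    have h2 := hcy.ne
    have h3 := (hxc.trans hcy).ne
    intro i j hij
    fin_cases i <;> fin_cases j <;> simp_all)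
  have e1 : dividedDiff f 3 ![e, x, c, y] =
      (((f y - f c) / (y - c) - (f c - f x) / (c - x)) / (y - x)
        - ((f c - f x) / (c - x) - (f x - f e) / (x - e)) / (c - e)) / (y - e) := by
    simp [dividedDiff, Fin.last]
  rw [e1] at h
  have n1 : x - e ≠ 0 := sub_ne_zero.2 hex
  have n2 : c - e ≠ 0 := sub_ne_zero.2 hec
  have n3 : y - e ≠ 0 := sub_ne_zero.2 hey
  have n4 : c - x ≠ 0 := (sub_pos.2 hxc).ne'
  have n5 : y - c ≠ 0 := (sub_pos.2 hcy).ne'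
  have n6 : y - x ≠ 0 := (sub_pos.2 (hxc.trans hcy)).ne'
  have key := mul_nonneg h (sub_pos.2 (hxc.trans hcy)).le
  rw [← sub_nonneg]
  refine key.trans (le_of_eq ?_)
  field_simp
  ring

lemma support (a b : ℝ) (f : ℝ → ℝ) (hconv : NConvexOn 2 (Set.Icc a b) f)
    (e c : ℝ) (he : e ∈ Icc a b) (hc : c ∈ Ioo a b) (hec : c ≠ e) :
    ∃ m, ∀ x ∈ Icc a b, x ≠ e →
      (f c - f e) / (c - e) + m * (x - c) ≤ (f x - f e) / (x - e) := by
  have hc' := Ioo_subset_Icc_self hc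
  set S := (fun x => ((f c - f e) / (c - e) - (f x - f e) / (x - e)) / (c - x)) ''
    {x | x ∈ Icc a b ∧ x < c ∧ x ≠ e} with hS
  have hub : ∀ y ∈ Icc a b, c < y → y ≠ e →
      ((f y - f e) / (y - e) - (f c - f e) / (c - e)) / (y - c) ∈ upperBounds S := by
    rintro y hy hcy hye _ ⟨x, ⟨hx, hxc, hxe⟩, rfl⟩
    exact slope_ineq a b f hconv e x c y he hx hc' hy hxc hcy hxe hec hye
  have hne : S.Nonempty := by
    obtain ⟨x, hx, hxe⟩ := ((Ioo_infinite hc.1).sdiff (finite_singleton e)).nonempty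
    exact ⟨_, x, ⟨⟨hx.1.le, (hx.2.trans hc.2).le⟩, hx.2, hxe⟩, rfl⟩
  have hbd : BddAbove S := by
    obtain ⟨y, hy, hye⟩ := ((Ioo_infinite hc.2).sdiff (finite_singleton e)).nonempty
    exact ⟨_, hub y ⟨(hc.1.trans hy.1).le, hy.2.le⟩ hy.1 hye⟩
  refine ⟨sSup S, fun x hx hxe => ?_⟩
  rcases lt_trichotomy x c with h | h | h
  · have := le_csSup hbd ⟨x, ⟨hx, h, hxe⟩, rfl⟩
    simp only at this
    rw [div_le_iff₀ (sub_pos.2 h)] at this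
    linarith
  · subst h; simp
  · have := csSup_le hne (hub x hx h hxe)
    rw [le_div_iff₀ (sub_pos.2 h)] at this
    linarith

lemma integ (a b e c p g m : ℝ) :
    ∫ x in a..b, (p + (x - e) * (g + m * (x - c))) =
      (p - e * g + m * e * c) * (b - a) + (g - m * c - m * e) * ((b ^ 2 - a ^ 2) / 2)
        + m * ((b ^ 3 - a ^ 3) / 3) := by
  have : ∀ x ∈ uIcc a b, HasDerivAt (fun x : ℝ => (p - e * g + m * e * c) * x
      + (g - m * c - m * e) * (x ^ 2 / 2) + m * (x ^ 3 / 3))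
      (p + (x - e) * (g + m * (x - c))) x := by
    intro x _
    have h := (((hasDerivAt_id x).const_mul (p - e * g + m * e * c)).add
      (((hasDerivAt_pow 2 x).div_const 2).const_mul (g - m * c - m * e))).add
      (((hasDerivAt_pow 3 x).div_const 3).const_mul m)
    refine HasDerivAt.congr_deriv h ?_
    norm_num
    ring
  rw [intervalIntegral.integral_eq_sub_of_hasDerivAt this
    (Continuous.intervalIntegrable (by fun_prop) _ _)]
  ring

theorem stmt10 (a b : ℝ) (hab : a < b)
    (f : ℝ → ℝ) (hcont : ContinuousOn f (Set.Icc a b))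
    (hconv : NConvexOn 2 (Set.Icc a b) f) :
    (1 / 4) * f a + (3 / 4) * f ((a + 2 * b) / 3) ≤ (b - a)⁻¹ * ∫ x in a..b, f x ∧
    (b - a)⁻¹ * ∫ x in a..b, f x ≤ (3 / 4) * f ((2 * a + b) / 3) + (1 / 4) * f b := by
  have hba : 0 < b - a := sub_pos.2 hab
  have hfi : IntervalIntegrable f volume a b :=
    ContinuousOn.intervalIntegrable (by rwa [uIcc_of_le hab.le])
  constructor
  · obtain ⟨m, hm⟩ := support a b f hconv a ((a + 2 * b) / 3) ⟨le_rfl, hab.le⟩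
      ⟨by linarith, by linarith⟩ (by intro h; linarith)
    have hle := intervalIntegral.integral_mono_on hab.le
      (Continuous.intervalIntegrable (by fun_prop) _ _) hfi
      (f := fun x => f a + (x - a) * ((f ((a + 2 * b) / 3) - f a) / ((a + 2 * b) / 3 - a)
        + m * (x - (a + 2 * b) / 3))) (g := f) (by
        intro x hx
        rcases eq_or_lt_of_le hx.1 with h | h
        · subst h; simp
        · have := hm x hx h.ne'
          rw [le_div_iff₀ (sub_pos.2 h)] at this
          linarith)
    rw [integ] at hle
    rw [inv_mul_eq_div, le_div_iff₀ hba]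
    refine le_trans (le_of_eq ?_) hle
    have : (a + 2 * b) / 3 - a = (b - a) * (2 / 3) := by ring
    rw [this]
    have := hba.ne'
    field_simp
    ring
  · obtain ⟨m, hm⟩ := support a b f hconv b ((2 * a + b) / 3) ⟨hab.le, le_rfl⟩
      ⟨by linarith, by linarith⟩ (by intro h; linarith)
    have hle := intervalIntegral.integral_mono_on hab.le hfi
      (Continuous.intervalIntegrable (by fun_prop) _ _)
      (g := fun x => f b + (x - b) * ((f ((2 * a + b) / 3) - f b) / ((2 * a + b) / 3 - b)
        + m * (x - (2 * a + b) / 3))) (f := f) (by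
        intro x hx
        rcases eq_or_lt_of_le hx.2 with h | h
        · subst h; simp
        · have := hm x hx h.ne
          rw [le_div_iff_of_neg (sub_neg.2 h)] at this
          linarith)
    rw [integ] at hle
    rw [inv_mul_eq_div, div_le_iff₀ hba]
    refine le_trans hle (le_of_eq ?_)
    have : (2 * a + b) / 3 - b = (b - a) * (-2 / 3) := by ring
    rw [this]
    have := hba.ne'
    field_simp
    ring
end

section
/- Let a < b, let m ∈ ℕ, let x₁, …, x_m ∈ [a,b] and let α₁, …, α_m > 0 with α₁ + ⋯ + α_m = 1 and Σᵢ αᵢ·xᵢ^k = (1/(b-a)) ∫_a^b x^k dx for k = 1, 2, 3. Then for every continuous 3-convex function f : [a,b] → ℝ one has (1/2)·[ f( ((3-√3)/6)·a + ((3+√3)/6)·b ) + f( ((3+√3)/6)·a + ((3-√3)/6)·b ) ] ≤ Σᵢ αᵢ·f(xᵢ) ≤ (1/6)·f(a) + (2/3)·f((a+b)/2) + (1/6)·f(b). -/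
open MeasureTheory Set

lemma newton_aux (f : ℝ → ℝ) (I : Set ℝ) (hconv : NConvexOn 3 I f) (p q r s : ℝ)
    (hp : p ∈ I) (hq : q ∈ I) (hr : r ∈ I) (hs : s ∈ I)
    (hpq : p < q) (hqr : q < r) (hrs : r < s) :
    ∃ c0 c1 c2 c3 : ℝ,
      (c0 + c1 * p + c2 * p ^ 2 + c3 * p ^ 3 = f p) ∧
      (c0 + c1 * q + c2 * q ^ 2 + c3 * q ^ 3 = f q) ∧
      (c0 + c1 * r + c2 * r ^ 2 + c3 * r ^ 3 = f r) ∧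
      (c0 + c1 * s + c2 * s ^ 2 + c3 * s ^ 3 = f s) ∧
      ∀ x ∈ I, ∃ D : ℝ, 0 ≤ D ∧ f x - (c0 + c1 * x + c2 * x ^ 2 + c3 * x ^ 3) =
        D * ((x - p) * (x - q) * (x - r) * (x - s)) := by
  have h1 : q - p ≠ 0 := (sub_pos.2 hpq).ne'
  have h2 : r - q ≠ 0 := (sub_pos.2 hqr).ne'
  have h3 : s - r ≠ 0 := (sub_pos.2 hrs).ne'
  have h4 : r - p ≠ 0 := (sub_pos.2 (hpq.trans hqr)).ne'
  have h5 : s - q ≠ 0 := (sub_pos.2 (hqr.trans hrs)).ne'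
  have h6 : s - p ≠ 0 := (sub_pos.2 (hpq.trans (hqr.trans hrs))).ne'
  obtain ⟨A, hA⟩ : ∃ A, A = (f q - f p) / (q - p) := ⟨_, rfl⟩
  obtain ⟨A', hA'⟩ : ∃ A, A = (f r - f q) / (r - q) := ⟨_, rfl⟩
  obtain ⟨A'', hA''⟩ : ∃ A, A = (f s - f r) / (s - r) := ⟨_, rfl⟩
  obtain ⟨B, hB⟩ : ∃ B, B = (A' - A) / (r - p) := ⟨_, rfl⟩
  obtain ⟨B', hB'⟩ : ∃ B, B = (A'' - A') / (s - q) := ⟨_, rfl⟩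
  obtain ⟨C, hC⟩ : ∃ C, C = (B' - B) / (s - p) := ⟨_, rfl⟩
  have eA : f q = f p + A * (q - p) := by rw [hA]; field_simp; ring
  have eA' : f r = f q + A' * (r - q) := by rw [hA']; field_simp; ring
  have eA'' : f s = f r + A'' * (s - r) := by rw [hA'']; field_simp; ring
  have eB : A' = A + B * (r - p) := by rw [hB]; field_simp; ring
  have eB' : A'' = A' + B' * (s - q) := by rw [hB']; field_simp; ring
  have eC : B' = B + C * (s - p) := by rw [hC]; field_simp; ring
  have Q : f q = f p - A * p + B * p * q - C * p * q * r +
      (A - B * (p + q) + C * (p * q + p * r + q * r)) * q +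
      (B - C * (p + q + r)) * q ^ 2 + C * q ^ 3 := by rw [eA]; ring
  have R : f r = f p - A * p + B * p * q - C * p * q * r +
      (A - B * (p + q) + C * (p * q + p * r + q * r)) * r +
      (B - C * (p + q + r)) * r ^ 2 + C * r ^ 3 := by rw [eA', eA, eB]; ring
  have S : f s = f p - A * p + B * p * q - C * p * q * r +
      (A - B * (p + q) + C * (p * q + p * r + q * r)) * s +
      (B - C * (p + q + r)) * s ^ 2 + C * s ^ 3 := by
    rw [eA'', eA', eA, eB', eB, eC]; ring
  refine ⟨f p - A * p + B * p * q - C * p * q * r,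
    A - B * (p + q) + C * (p * q + p * r + q * r),
    B - C * (p + q + r), C, by ring, Q.symm, R.symm, S.symm, ?_⟩
  intro x hx
  by_cases xp : x = p
  · exact ⟨0, le_rfl, by rw [xp]; ring⟩
  by_cases xq : x = q
  · exact ⟨0, le_rfl, by rw [xq]; linarith⟩
  by_cases xr : x = r
  · exact ⟨0, le_rfl, by rw [xr]; linarith⟩
  by_cases xs : x = s
  · exact ⟨0, le_rfl, by rw [xs]; linarith⟩
  have k1 : x - p ≠ 0 := sub_ne_zero.2 xp
  have k2 : x - q ≠ 0 := sub_ne_zero.2 xq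
  have k3 : x - r ≠ 0 := sub_ne_zero.2 xr
  have k4 : x - s ≠ 0 := sub_ne_zero.2 xs
  have hD := hconv ![p, q, r, s, x] (by intro i; fin_cases i <;> simpa)
    (by
      intro i j hij
      fin_cases i <;> fin_cases j <;> simp at hij ⊢ <;>
        first
        | (exfalso; linarith)
        | (exfalso; exact xp hij)
        | (exfalso; exact xq hij)
        | (exfalso; exact xr hij)
        | (exfalso; exact xs hij)
        | (exfalso; exact xp hij.symm)
        | (exfalso; exact xq hij.symm)
        | (exfalso; exact xr hij.symm)
        | (exfalso; exact xs hij.symm))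
  refine ⟨_, hD, ?_⟩
  have e : dividedDiff f 4 ![p, q, r, s, x] =
      ((((((f x - f s) / (x - s)) - A'') / (x - r) - B') / (x - q)) - C) / (x - p) := by
    rw [hC, hB', hB, hA'', hA', hA]
    simp [dividedDiff, Fin.last, Fin.succ, Fin.castSucc, Fin.castAdd, Fin.castLE]
    try rfl
  change _ = dividedDiff f 4 ![p, q, r, s, x] * _
  rw [e]
  have : ((((((f x - f s) / (x - s)) - A'') / (x - r) - B') / (x - q)) - C) / (x - p) *
      ((x - p) * (x - q) * (x - r) * (x - s)) =
      f x - f s - A'' * (x - s) - B' * (x - s) * (x - r)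
        - C * (x - s) * (x - r) * (x - q) := by
    field_simp
  rw [this, eA'', eA', eA, eB', eB, eC]
  ring

lemma small_aux {m : ℕ} (x : Fin m → ℝ) (c d ε : ℝ) (hε : 0 < ε) :
    ∃ h, 0 < h ∧ h < ε ∧ ∀ i, (x i ≤ c ∨ c + h ≤ x i) ∧ (x i ≤ d ∨ d + h ≤ x i) := by
  have key : ∀ c : ℝ, ∀ i, ∀ᶠ h in nhdsWithin (0 : ℝ) (Ioi 0), x i ≤ c ∨ c + h ≤ x i := by
    intro c i
    rcases le_or_gt (x i) c with h | h
    · exact Filter.Eventually.of_forall fun _ => Or.inl h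
    · filter_upwards [Ioo_mem_nhdsGT (sub_pos.2 h)] with t ht
      right; linarith [ht.2]
  have h1 := Filter.eventually_all.2 (key c)
  have h2 := Filter.eventually_all.2 (key d)
  obtain ⟨h, ⟨p1, p2⟩, p3⟩ := ((h1.and h2).and (Ioo_mem_nhdsGT hε)).exists
  exact ⟨h, p3.1, p3.2, fun i => ⟨p1 i, p2 i⟩⟩

lemma sum_aux {m : ℕ} (x α : Fin m → ℝ) (c0 c1 c2 c3 : ℝ) (hsum : ∑ i, α i = 1) :
    ∑ i, α i * (c0 + c1 * x i + c2 * x i ^ 2 + c3 * x i ^ 3) =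
      c0 + c1 * ∑ i, α i * x i ^ 1 + c2 * ∑ i, α i * x i ^ 2 + c3 * ∑ i, α i * x i ^ 3 := by
  rw [← mul_one c0, ← hsum]
  simp only [Finset.mul_sum, ← Finset.sum_add_distrib]
  apply Finset.sum_congr rfl
  intro i _
  rw [← Finset.mul_sum, hsum]
  ring

lemma pair_nonneg {y c h : ℝ} (hh : 0 < h) (H : y ≤ c ∨ c + h ≤ y) :
    0 ≤ (y - c) * (y - (c + h)) := by
  rcases H with H | H
  · exact mul_nonneg_of_nonpos_of_nonpos (by linarith) (by linarith)
  · exact mul_nonneg (by linarith) (by linarith)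

theorem stmt11 (a b : ℝ) (hab : a < b) (m : ℕ) (x : Fin m → ℝ) (α : Fin m → ℝ)
    (hx : ∀ i, x i ∈ Set.Icc a b) (hα : ∀ i, 0 < α i) (hsum : ∑ i, α i = 1)
    (hmom : ∀ k ∈ Finset.Icc 1 3, ∑ i, α i * x i ^ k = (b - a)⁻¹ * ∫ t in a..b, t ^ k)
    (f : ℝ → ℝ) (hcont : ContinuousOn f (Set.Icc a b))
    (hconv : NConvexOn 3 (Set.Icc a b) f) :
    (1 / 2) * (f ((3 - Real.sqrt 3) / 6 * a + (3 + Real.sqrt 3) / 6 * b) +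
        f ((3 + Real.sqrt 3) / 6 * a + (3 - Real.sqrt 3) / 6 * b)) ≤
      ∑ i, α i * f (x i) ∧
    ∑ i, α i * f (x i) ≤ (1 / 6) * f a + (2 / 3) * f ((a + b) / 2) + (1 / 6) * f b := by
  have hba : b - a ≠ 0 := (sub_pos.2 hab).ne'
  have m1 : ∑ i, α i * x i ^ 1 = (a + b) / 2 := by
    rw [hmom 1 (by simp), integral_pow]; field_simp; norm_num; ring
  have m2 : ∑ i, α i * x i ^ 2 = (a ^ 2 + a * b + b ^ 2) / 3 := by
    rw [hmom 2 (by simp), integral_pow]; field_simp; norm_num; ring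
  have m3 : ∑ i, α i * x i ^ 3 = (a ^ 3 + a ^ 2 * b + a * b ^ 2 + b ^ 3) / 4 := by
    rw [hmom 3 (by simp), integral_pow]; field_simp; norm_num; ring
  constructor
  · obtain ⟨s, hs⟩ : ∃ s, s = Real.sqrt 3 := ⟨_, rfl⟩
    have s2 : s ^ 2 = 3 := by rw [hs]; exact Real.sq_sqrt (by norm_num)
    have s0 : 0 < s := by rw [hs]; positivity
    have s3 : s < 3 := by nlinarith
    rw [← hs]
    obtain ⟨c, hc⟩ : ∃ c, c = (3 + s) / 6 * a + (3 - s) / 6 * b := ⟨_, rfl⟩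
    obtain ⟨d, hd⟩ : ∃ d, d = (3 - s) / 6 * a + (3 + s) / 6 * b := ⟨_, rfl⟩
    rw [← hc, ← hd]
    have hac : a < c := by rw [hc]; nlinarith
    have hcd : c < d := by rw [hc, hd]; nlinarith
    have hdb : d < b := by rw [hd]; nlinarith
    obtain ⟨h, h0, hε, H⟩ := small_aux x c d (min (d - c) (b - d))
      (lt_min (by linarith) (by linarith))
    have e1 := hε.trans_le (min_le_left _ _)
    have e2 := hε.trans_le (min_le_right _ _)
    obtain ⟨c0, c1, c2, c3, P1, -, P3, -, K⟩ := newton_aux f _ hconv c (c + h) d (d + h)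
      ⟨by linarith, by linarith⟩ ⟨by linarith, by linarith⟩ ⟨by linarith, by linarith⟩
      ⟨by linarith, by linarith⟩ (by linarith) (by linarith) (by linarith)
    have le : ∑ i, α i * (c0 + c1 * x i + c2 * x i ^ 2 + c3 * x i ^ 3) ≤
        ∑ i, α i * f (x i) := by
      apply Finset.sum_le_sum
      intro i _
      apply mul_le_mul_of_nonneg_left _ (hα i).le
      obtain ⟨D, hD, e⟩ := K (x i) (hx i)
      have := mul_nonneg hD (mul_nonneg (pair_nonneg h0 (H i).1) (pair_nonneg h0 (H i).2))
      linarith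
    refine le_trans (le_of_eq ?_) le
    rw [sum_aux x α c0 c1 c2 c3 hsum, m1, m2, m3, ← P1, ← P3]
    have q1 : c + d = a + b := by rw [hc, hd]; ring
    have q2 : c * d = (a ^ 2 + 4 * a * b + b ^ 2) / 6 := by
      rw [hc, hd]; linear_combination (-(a - b) ^ 2 / 36) * s2
    have q3 : c ^ 2 + d ^ 2 = 2 * ((a ^ 2 + a * b + b ^ 2) / 3) := by
      linear_combination (c + d + a + b) * q1 - 2 * q2
    have q4 : c ^ 3 + d ^ 3 = 2 * ((a ^ 3 + a ^ 2 * b + a * b ^ 2 + b ^ 3) / 4) := by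
      have : c ^ 3 + d ^ 3 = (c + d) * (c ^ 2 + d ^ 2 - c * d) := by ring
      rw [this, q1, q2, q3]; ring
    linear_combination c1 / 2 * q1 + c2 / 2 * q3 + c3 / 2 * q4
  · obtain ⟨c, hc⟩ : ∃ c, c = (a + b) / 2 := ⟨_, rfl⟩
    rw [← hc]
    obtain ⟨h, h0, hε, H⟩ := small_aux x c c (b - c) (by linarith)
    obtain ⟨c0, c1, c2, c3, P1, P2, -, P4, K⟩ := newton_aux f _ hconv a c (c + h) b
      ⟨by linarith, by linarith⟩ ⟨by linarith, by linarith⟩ ⟨by linarith, by linarith⟩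
      ⟨by linarith, by linarith⟩ (by linarith) (by linarith) (by linarith)
    have le : ∑ i, α i * f (x i) ≤
        ∑ i, α i * (c0 + c1 * x i + c2 * x i ^ 2 + c3 * x i ^ 3) := by
      apply Finset.sum_le_sum
      intro i _
      apply mul_le_mul_of_nonneg_left _ (hα i).le
      obtain ⟨D, hD, e⟩ := K (x i) (hx i)
      have := mul_nonneg hD (mul_nonneg (pair_nonneg h0 (H i).1)
        (mul_nonneg (sub_nonneg.2 (hx i).1) (sub_nonneg.2 (hx i).2)))
      linarith
    refine le.trans (le_of_eq ?_)
    rw [sum_aux x α c0 c1 c2 c3 hsum, m1, m2, m3, ← P1, ← P2, ← P4, hc]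
    ring
end

section
/- Let a < b, let m ∈ ℕ, let x₁, …, x_m ∈ [a,b] and let α₁, …, α_m > 0 with α₁ + ⋯ + α_m = 1 and Σᵢ αᵢ·xᵢ^k = (1/(b-a)) ∫_a^b x^k dx for k = 1, 2. Then for every continuous 2-convex function f : [a,b] → ℝ one has (1/4)·f(a) + (3/4)·f((a+2b)/3) ≤ Σᵢ αᵢ·f(xᵢ) ≤ (3/4)·f((2a+b)/3) + (1/4)·f(b). -/
open MeasureTheory Set

theorem aux_mono (a b : ℝ) (f : ℝ → ℝ) (h : NConvexOn 2 (Set.Icc a b) f)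
    (p c x y : ℝ) (hp : p ∈ Set.Icc a b) (hc : c ∈ Set.Icc a b) (hx : x ∈ Set.Icc a b)
    (hy : y ∈ Set.Icc a b) (hpc : p ≠ c) (hxp : x ≠ p) (hyp : y ≠ p) (hxc : x < c) (hcy : c < y) :
    ((f x - f c) / (x - c) - (f p - f c) / (p - c)) / (x - p) ≤
    ((f y - f c) / (y - c) - (f p - f c) / (p - c)) / (y - p) := by
  have hxy : x < y := hxc.trans hcy
  have h1 := h ![x, p, c, y] (by intro i; fin_cases i <;> simpa)
    (by
      intro i j hij
      fin_cases i <;> fin_cases j <;> simp at hij ⊢ <;> first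
        | exact absurd hij (by assumption)
        | exact absurd hij.symm (by assumption)
        | (exfalso; linarith))
  have e : dividedDiff f (2 + 1) ![x, p, c, y] =
      (((f y - f c) / (y - c) - (f c - f p) / (c - p)) / (y - p)
      - ((f c - f p) / (c - p) - (f p - f x) / (p - x)) / (c - x)) / (y - x) := by
    rfl
  rw [e] at h1
  have hd : 0 < y - x := by linarith
  have h2 := mul_nonneg h1 hd.le
  rw [div_mul_cancel₀ _ hd.ne'] at h2
  have n1 : c - p ≠ 0 := sub_ne_zero.2 hpc.symm
  have n2 : p - c ≠ 0 := sub_ne_zero.2 hpc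
  have n3 : x - p ≠ 0 := sub_ne_zero.2 hxp
  have n4 : p - x ≠ 0 := sub_ne_zero.2 hxp.symm
  have n5 : c - x ≠ 0 := by linarith
  have n6 : x - c ≠ 0 := by linarith
  have e1 : (f c - f p) / (c - p) = (f p - f c) / (p - c) := by
    rw [div_eq_div_iff n1 n2]; ring
  have e2 : ((f c - f p) / (c - p) - (f p - f x) / (p - x)) / (c - x)
      = ((f x - f c) / (x - c) - (f p - f c) / (p - c)) / (x - p) := by
    rw [show c - p = -(p - c) by ring, show p - x = -(x - p) by ring,
      show c - x = -(x - c) by ring]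
    field_simp
    ring
  rw [e2, e1] at h2
  linarith

theorem aux_quad (a b : ℝ) (f : ℝ → ℝ) (h : NConvexOn 2 (Set.Icc a b) f)
    (p c : ℝ) (hp : p ∈ Set.Icc a b) (hac : a < c) (hcb : c < b) (hpc : p ≠ c) :
    ∃ s t : ℝ, f p = f c + t * (p - c) ∧ ∀ x ∈ Set.Icc a b,
      0 ≤ (x - p) * (f x - (f c + t * (x - c) + s * (x - p) * (x - c))) := by
  set g : ℝ → ℝ := fun x => ((f x - f c) / (x - c) - (f p - f c) / (p - c)) / (x - p) with hg
  have hc : c ∈ Set.Icc a b := ⟨hac.le, hcb.le⟩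
  have n2 : p - c ≠ 0 := sub_ne_zero.2 hpc
  have key : ∃ s, (∀ x ∈ Set.Icc a b, x ≠ p → x < c → g x ≤ s) ∧
      (∀ x ∈ Set.Icc a b, x ≠ p → c < x → s ≤ g x) := by
    have ex1 : ∃ x ∈ Set.Icc a b, x ≠ p ∧ x < c := by
      by_cases hh : a = p
      · exact ⟨(a + c) / 2, ⟨by linarith, by linarith⟩, by intro h; linarith, by linarith⟩
      · exact ⟨a, ⟨le_refl _, by linarith⟩, hh, hac⟩
    have ex2 : ∃ x ∈ Set.Icc a b, x ≠ p ∧ c < x := by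
      by_cases hh : b = p
      · exact ⟨(b + c) / 2, ⟨by linarith, by linarith⟩, by intro h; linarith, by linarith⟩
      · exact ⟨b, ⟨by linarith, le_refl _⟩, hh, hcb⟩
    obtain ⟨y, hy, hyp, hcy⟩ := ex2
    obtain ⟨x0, hx0, hx0p, hx0c⟩ := ex1
    refine ⟨sSup (g '' {x | x ∈ Set.Icc a b ∧ x ≠ p ∧ x < c}), ?_, ?_⟩
    · intro x hx hxp hxc
      refine le_csSup ⟨g y, ?_⟩ ⟨x, ⟨hx, hxp, hxc⟩, rfl⟩
      rintro _ ⟨z, ⟨hz, hzp, hzc⟩, rfl⟩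
      exact aux_mono a b f h p c z y hp hc hz hy hpc hzp hyp hzc hcy
    · intro x hx hxp hxc
      refine csSup_le ⟨_, ⟨x0, ⟨hx0, hx0p, hx0c⟩, rfl⟩⟩ ?_
      rintro _ ⟨z, ⟨hz, hzp, hzc⟩, rfl⟩
      exact aux_mono a b f h p c z x hp hc hz hx hpc hzp hxp hzc hxc
  obtain ⟨s, hs1, hs2⟩ := key
  refine ⟨s, (f p - f c) / (p - c), by field_simp; ring, ?_⟩
  intro x hx
  by_cases hxp : x = p
  · simp [hxp]
  by_cases hxc : x = c
  · simp [hxc]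
  have n3 : x - p ≠ 0 := sub_ne_zero.2 hxp
  have n4 : x - c ≠ 0 := sub_ne_zero.2 hxc
  have e : (x - p) * (f x - (f c + (f p - f c) / (p - c) * (x - c) + s * (x - p) * (x - c)))
      = (x - p) ^ 2 * ((x - c) * (g x - s)) := by
    simp only [hg]
    field_simp
    ring
  rw [e]
  refine mul_nonneg (sq_nonneg _) ?_
  rcases lt_or_gt_of_ne hxc with hl | hl
  · exact mul_nonneg_of_nonpos_of_nonpos (by linarith) (by linarith [hs1 x hx hxp hl])
  · exact mul_nonneg (by linarith) (by linarith [hs2 x hx hxp hl])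

theorem stmt12 (a b : ℝ) (hab : a < b) (m : ℕ) (x : Fin m → ℝ) (α : Fin m → ℝ)
    (hx : ∀ i, x i ∈ Set.Icc a b) (hα : ∀ i, 0 < α i) (hsum : ∑ i, α i = 1)
    (hmom : ∀ k ∈ Finset.Icc 1 2, ∑ i, α i * x i ^ k = (b - a)⁻¹ * ∫ t in a..b, t ^ k)
    (f : ℝ → ℝ) (hcont : ContinuousOn f (Set.Icc a b))
    (hconv : NConvexOn 2 (Set.Icc a b) f) :
    (1 / 4) * f a + (3 / 4) * f ((a + 2 * b) / 3) ≤ ∑ i, α i * f (x i) ∧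
    ∑ i, α i * f (x i) ≤ (3 / 4) * f ((2 * a + b) / 3) + (1 / 4) * f b := by
  have m1 : ∑ i, α i * x i = (a + b) / 2 := by
    have := hmom 1 (by simp)
    rw [integral_pow] at this
    simp only [pow_one] at this
    rw [this]
    have : b - a ≠ 0 := by linarith
    field_simp
    norm_num
    ring
  have m2 : ∑ i, α i * x i ^ 2 = (a ^ 2 + a * b + b ^ 2) / 3 := by
    have := hmom 2 (by simp)
    rw [integral_pow] at this
    rw [this]
    have : b - a ≠ 0 := by linarith
    field_simp
    norm_num
    ring
  have Q : ∀ u v w : ℝ, ∑ i, α i * (u + v * x i + w * x i ^ 2) =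
      u + v * ((a + b) / 2) + w * ((a ^ 2 + a * b + b ^ 2) / 3) := by
    intro u v w
    rw [← m1, ← m2, Finset.mul_sum, Finset.mul_sum]
    nth_rewrite 2 [← mul_one u]
    rw [← hsum, Finset.mul_sum, ← Finset.sum_add_distrib, ← Finset.sum_add_distrib]
    exact Finset.sum_congr rfl fun i _ => by ring
  constructor
  · obtain ⟨s, t, h1, h2⟩ := aux_quad a b f hconv a ((a + 2 * b) / 3) ⟨le_refl _, hab.le⟩
      (by linarith) (by linarith) (by intro h; linarith)
    set c := (a + 2 * b) / 3 with hc
    have hle : ∑ i, α i * ((f c - t * c + s * a * c) + (t - s * a - s * c) * x i + s * x i ^ 2)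
        ≤ ∑ i, α i * f (x i) := by
      refine Finset.sum_le_sum fun i _ => mul_le_mul_of_nonneg_left ?_ (hα i).le
      have h3 := h2 (x i) (hx i)
      rcases (hx i).1.eq_or_lt with h | h
      · rw [← h, h1]; apply le_of_eq; ring
      · have := nonneg_of_mul_nonneg_right h3 (by linarith)
        linarith
    rw [Q] at hle
    refine le_trans (le_of_eq ?_) hle
    rw [h1, hc]; ring
  · obtain ⟨s, t, h1, h2⟩ := aux_quad a b f hconv b ((2 * a + b) / 3) ⟨hab.le, le_refl _⟩
      (by linarith) (by linarith) (by intro h; linarith)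
    set c := (2 * a + b) / 3 with hc
    have hle : ∑ i, α i * f (x i) ≤
        ∑ i, α i * ((f c - t * c + s * b * c) + (t - s * b - s * c) * x i + s * x i ^ 2) := by
      refine Finset.sum_le_sum fun i _ => mul_le_mul_of_nonneg_left ?_ (hα i).le
      have h3 := h2 (x i) (hx i)
      rcases (hx i).2.eq_or_lt with h | h
      · rw [h, h1]; apply le_of_eq; ring
      · by_contra hlt
        have := mul_neg_of_neg_of_pos (sub_neg.2 h)
          (show 0 < f (x i) - (f c + t * (x i - c) + s * (x i - b) * (x i - c)) by linarith)
        linarith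
    rw [Q] at hle
    refine le_trans hle (le_of_eq ?_)
    rw [h1, hc]; ring
end

section
/- For every continuous 3-convex function f : [-1,1] → ℝ one has (1/2)·[ f(−1/√3) + f(1/√3) ] ≤ (1/3)·[ f(−1/√2) + f(0) + f(1/√2) ]. -/
open MeasureTheory Set

theorem dd_formula (f : ℝ → ℝ) (a b : ℝ) (ha : 0 < a) (hab : a < b) :
    dividedDiff f 4 ![-b, -a, 0, a, b] =
      f 0 / (a ^ 2 * b ^ 2) - (f (-a) + f a) / (2 * a ^ 2 * (b ^ 2 - a ^ 2))
        + (f (-b) + f b) / (2 * b ^ 2 * (b ^ 2 - a ^ 2)) := by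
  have hb : b ≠ 0 := by linarith
  have ha' : a ≠ 0 := ha.ne'
  have h1 : b - a ≠ 0 := by linarith
  have h2 : b + a ≠ 0 := by linarith
  have e0 : dividedDiff f 4 ![-b, -a, 0, a, b] =
    ((((f b - f a) / (b - a) - (f a - f 0) / (a - 0)) / (b - 0) - ((f a - f 0) / (a - 0) - (f 0 - f (-a)) / (0 - (-a))) / (a - (-a))) / (b - (-a)) - (((f a - f 0) / (a - 0) - (f 0 - f (-a)) / (0 - (-a))) / (a - (-a)) - ((f 0 - f (-a)) / (0 - (-a)) - (f (-a) - f (-b)) / (-a - (-b))) / (0 - (-b))) / (a - (-b))) / (b - (-b)) := rfl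
  have r1 : a - -b = b + a := by ring
  have r2 : b - -b = 2 * b := by ring
  have r3 : a - -a = 2 * a := by ring
  have r4 : -a - -b = b - a := by ring
  have r5 : b - -a = b + a := by ring
  rw [r1, r2, r3, r4, r5] at e0
  simp only [sub_zero, zero_sub, neg_neg] at e0
  have h3 : b ^ 2 - a ^ 2 = (b - a) * (b + a) := by ring
  rw [e0, h3]
  field_simp
  ring

theorem stmt15 (f : ℝ → ℝ) (hcont : ContinuousOn f (Set.Icc (-1 : ℝ) 1))
    (hconv : NConvexOn 3 (Set.Icc (-1 : ℝ) 1) f) :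
    (1 / 2) * (f (-(1 / Real.sqrt 3)) + f (1 / Real.sqrt 3)) ≤
      (1 / 3) * (f (-(1 / Real.sqrt 2)) + f 0 + f (1 / Real.sqrt 2)) := by
  have h3 : (1 / Real.sqrt 3) ^ 2 = 1 / 3 := by
    rw [div_pow, Real.sq_sqrt (by norm_num)]; norm_num
  have h2 : (1 / Real.sqrt 2) ^ 2 = 1 / 2 := by
    rw [div_pow, Real.sq_sqrt (by norm_num)]; norm_num
  have ha : 0 < 1 / Real.sqrt 3 := by positivity
  have hb : 0 < 1 / Real.sqrt 2 := by positivity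
  generalize 1 / Real.sqrt 3 = a at *
  generalize 1 / Real.sqrt 2 = b at *
  have hab : a < b := by nlinarith
  have hb1 : b < 1 := by nlinarith
  have h := hconv ![-b, -a, 0, a, b]
    (by intro i; fin_cases i <;> simp <;> constructor <;> linarith)
    (by
      apply StrictMono.injective
      rw [Fin.strictMono_iff_lt_succ]
      intro i
      fin_cases i <;> simp <;> linarith)
  have h' := dd_formula f a b ha hab
  rw [h', h3, h2] at h
  norm_num at h
  linarith
end

section
/- For every continuous 3-convex function f : [-1,1] → ℝ one has (1/12)·f(−1) + (5/12)·f(−1/√5) + (5/12)·f(1/√5) + (1/12)·f(1) ≤ (1/6)·f(−1) + (2/3)·f(0) + (1/6)·f(1). -/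
open MeasureTheory Set

theorem stmt16 (f : ℝ → ℝ) (hcont : ContinuousOn f (Set.Icc (-1 : ℝ) 1))
    (hconv : NConvexOn 3 (Set.Icc (-1 : ℝ) 1) f) :
    (1 / 12) * f (-1) + (5 / 12) * f (-(1 / Real.sqrt 5)) + (5 / 12) * f (1 / Real.sqrt 5) +
        (1 / 12) * f 1 ≤ (1 / 6) * f (-1) + (2 / 3) * f 0 + (1 / 6) * f 1 := by
  obtain ⟨a, ha⟩ : ∃ a, a = 1 / Real.sqrt 5 := ⟨_, rfl⟩
  rw [← ha]
  have ha0 : 0 < a := by rw [ha]; positivity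
  have ha2 : a ^ 2 = 1 / 5 := by
    rw [ha, div_pow, Real.sq_sqrt (by norm_num)]; norm_num
  have ha1 : a < 1 := by nlinarith
  have hmono : StrictMono (![-1, -a, 0, a, 1] : Fin 5 → ℝ) := by
    rw [Fin.strictMono_iff_lt_succ]
    intro i
    fin_cases i <;> simp <;> linarith
  have h := hconv ![-1, -a, 0, a, 1]
    (by intro i; fin_cases i <;> simp <;> (try constructor) <;> linarith) hmono.injective
  have key : dividedDiff f (3 + 1) ![-1, -a, 0, a, 1] =
      (5 / 8) * f (-1) - (25 / 8) * f (-a) + 5 * f 0 - (25 / 8) * f a + (5 / 8) * f 1 := by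
    have e : dividedDiff f (3 + 1) ![-1, -a, 0, a, 1] =
      ((((f 1 - f a) / (1 - a) - (f a - f 0) / (a - 0)) / (1 - 0)
        - ((f a - f 0) / (a - 0) - (f 0 - f (-a)) / (0 - -a)) / (a - -a)) / (1 - -a)
      - (((f a - f 0) / (a - 0) - (f 0 - f (-a)) / (0 - -a)) / (a - -a)
        - ((f 0 - f (-a)) / (0 - -a) - (f (-a) - f (-1)) / (-a - -1)) / (0 - -1)) / (a - -1))
        / (1 - -1) := rfl
    rw [e]
    have h1 : 1 - a ≠ 0 := by linarith
    have h2 : 1 + a ≠ 0 := by linarith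
    have h3 : a ≠ 0 := ha0.ne'
    have e1 : 1 - -a = 1 + a := by ring
    have e2 : -a - -1 = 1 - a := by ring
    have e3 : a - -1 = 1 + a := by ring
    have e4 : a - -a = 2 * a := by ring
    have e5 : 0 - -a = a := by ring
    have i1 : (1 - a)⁻¹ = 5 / 4 * (1 + a) := by
      apply inv_eq_of_mul_eq_one_right; linear_combination (-5/4) * ha2
    have i2 : (1 + a)⁻¹ = 5 / 4 * (1 - a) := by
      apply inv_eq_of_mul_eq_one_right; linear_combination (-5/4) * ha2
    have i3 : a⁻¹ = 5 * a := by
      apply inv_eq_of_mul_eq_one_right; linear_combination 5 * ha2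
    rw [e1, e2, e3, e4, e5]
    simp only [div_eq_mul_inv, mul_inv, i1, i2, i3, sub_zero]
    have a3 : a ^ 3 = a / 5 := by linear_combination a * ha2
    have a4 : a ^ 4 = 1 / 25 := by linear_combination (a^2 + 1/5) * ha2
    ring_nf
    simp only [ha2, a3, a4]
    ring
  rw [key] at h
  linarith
end

section
/- For every continuous 3-convex function f : [-1,1] → ℝ one has (1/20)·f(−1) + (49/180)·f(−√(3/7)) + (16/45)·f(0) + (49/180)·f(√(3/7)) + (1/20)·f(1) ≤ (1/6)·f(−1) + (2/3)·f(0) + (1/6)·f(1). -/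
open MeasureTheory Set

theorem stmt17 (f : ℝ → ℝ) (hcont : ContinuousOn f (Set.Icc (-1 : ℝ) 1))
    (hconv : NConvexOn 3 (Set.Icc (-1 : ℝ) 1) f) :
    (1 / 20) * f (-1) + (49 / 180) * f (-Real.sqrt (3 / 7)) + (16 / 45) * f 0 +
        (49 / 180) * f (Real.sqrt (3 / 7)) + (1 / 20) * f 1 ≤
      (1 / 6) * f (-1) + (2 / 3) * f 0 + (1 / 6) * f 1 := by
  have hs2 : Real.sqrt (3 / 7) ^ 2 = 3 / 7 := Real.sq_sqrt (by norm_num)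
  have hs0 : 0 < Real.sqrt (3 / 7) := Real.sqrt_pos.mpr (by norm_num)
  generalize Real.sqrt (3 / 7) = s at hs2 hs0 ⊢
  have hs1 : s < 1 := by nlinarith
  have hm : StrictMono (![-1, -s, 0, s, 1] : Fin 5 → ℝ) := by
    rw [Fin.strictMono_iff_lt_succ]
    intro i
    fin_cases i <;> simp <;> linarith
  have key := hconv ![-1, -s, 0, s, 1] (by
    intro i
    fin_cases i <;> simp <;> constructor <;> linarith) hm.injective
  have h5 : dividedDiff f (3 + 1) ![-1, -s, 0, s, 1] =
      (((((f 1 - f s) / (1 - s) - (f s - f 0) / (s - 0)) / (1 - 0)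
        - ((f s - f 0) / (s - 0) - (f 0 - f (-s)) / (0 - -s)) / (s - -s)) / (1 - -s))
      - ((((f s - f 0) / (s - 0) - (f 0 - f (-s)) / (0 - -s)) / (s - -s)
        - ((f 0 - f (-s)) / (0 - -s) - (f (-s) - f (-1)) / (-s - -1)) / (0 - -1)) / (s - -1)))
        / (1 - -1) := by
    simp only [dividedDiff]
    rfl
  rw [h5] at key
  generalize f 1 = a at *
  generalize f s = b at *
  generalize f 0 = c at *
  generalize f (-s) = d at *
  generalize f (-1) = e at *
  have i1 : (1 - s)⁻¹ = 7 / 4 * (1 + s) := by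
    exact inv_eq_of_mul_eq_one_left (by nlinarith)
  have i2 : (1 + s)⁻¹ = 7 / 4 * (1 - s) := inv_eq_of_mul_eq_one_left (by nlinarith)
  have i3 : s⁻¹ = 7 / 3 * s := inv_eq_of_mul_eq_one_left (by nlinarith)
  have i4 : (s + s)⁻¹ = 7 / 6 * s := inv_eq_of_mul_eq_one_left (by nlinarith)
  have e1 : -s - -1 = 1 - s := by ring
  have e2 : s - -1 = 1 + s := by ring
  simp only [e1, e2, sub_neg_eq_add, sub_zero, zero_add, div_eq_mul_inv _ (1 - s), div_eq_mul_inv _ (1 + s), div_eq_mul_inv _ s, div_eq_mul_inv _ (s + s), i1, i2, i3, i4] at key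
  have s3 : s ^ 3 = 3 / 7 * s := by rw [pow_succ, hs2]
  have s4 : s ^ 4 = 9 / 49 := by rw [show s ^ 4 = (s ^ 2) ^ 2 by ring, hs2]; norm_num
  ring_nf at key
  simp only [hs2, s3, s4] at key
  linarith
end
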